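/- arXiv:1401.2124 — 2 statements merged into one kernel-verified Lean document; each statement's English description precedes it below -/
import Mathlib

section
/- Let P be a generalized truncation polytope of type (k; n_1, n_2) with n_1 ≥ n_2 > 1, K = K_P with vertex set V = V_1 ⊔ V_2 ⊔ NV (where V_1, V_2 are the vertex sets coming from the factors Δ^{n_1}, Δ^{n_2} and NV is the set of k new vertices), and let W be a nonempty proper subset of V. For p ∈ {1,2}, the reduced homology group H̃_{n_p−1}(K_W; k) is nontrivial if and only if W = V_1 ∪ N' (respectively W = V_2 ∪ N' in the case n_1 = n_2, either option) for some subset N' ⊆ NV when n_p = n_1 (respectively W = V_2 ∪ N' when n_p = n_2 < n_1); and whenever it is nontrivial, H̃_{n_p−1}(K_W; k) ≅ k. More precisely: H̃_{n_1−1}(K_W) ≠ 0 iff V_1 ⊆ W and W ∩ V_2 = ∅ (i.e., W = V_1 ∪ N', N' ⊆ NV), and H̃_{n_2−1}(K_W) ≠ 0 iff V_2 ⊆ W and W ∩ V_1 = ∅, and in each such case the group is one-dimensional. -/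
open Finset Module

/-- An abstract simplicial complex on the vertex type `V`: a collection of
nonempty finite subsets of `V` (the *faces*), closed under passing to
nonempty subsets. -/
structure SimComplex (V : Type*) where
  faces : Set (Finset V)
  not_empty_mem : ∅ ∉ faces
  down_closed : ∀ ⦃s t : Finset V⦄, s ∈ faces → t ⊆ s → t.Nonempty → t ∈ faces

namespace SimComplex

variable {V : Type*}

/-- The `n`-dimensional faces of `K` (faces with `n + 1` vertices). -/
def Face (K : SimComplex V) (n : ℕ) : Type _ :=
  {s : Finset V // s ∈ K.faces ∧ s.card = n + 1}

/-- The space of simplicial `n`-chains of `K` with coefficients in `𝕜`. -/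
abbrev chains (K : SimComplex V) (𝕜 : Type*) [Field 𝕜] (n : ℕ) : Type _ :=
  K.Face n →₀ 𝕜

variable (𝕜 : Type*) [Field 𝕜] [LinearOrder V]

/-- The boundary of a single `(n+1)`-dimensional face, as an alternating sum of its
codimension-one subfaces (signs determined by the linear order on the vertices). -/
noncomputable def faceBoundary (K : SimComplex V) (n : ℕ) (s : K.Face (n + 1)) :
    K.chains 𝕜 n :=
  ∑ a ∈ s.1.attach, ((-1 : 𝕜) ^ (s.1.filter (fun b => b < a.1)).card) •
    Finsupp.single
      ⟨s.1.erase a.1,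
        K.down_closed s.2.1 (Finset.erase_subset _ _)
          (Finset.card_pos.mp (by rw [Finset.card_erase_of_mem a.2, s.2.2]; omega)),
        by rw [Finset.card_erase_of_mem a.2, s.2.2]; omega⟩ (1 : 𝕜)

/-- The simplicial boundary operator `∂ : C_{n+1}(K) → C_n(K)`. -/
noncomputable def boundary (K : SimComplex V) (n : ℕ) :
    K.chains 𝕜 (n + 1) →ₗ[𝕜] K.chains 𝕜 n :=
  Finsupp.lsum 𝕜 fun s => LinearMap.toSpanSingleton 𝕜 _ (K.faceBoundary 𝕜 n s)

/-- The augmentation `C_0(K) → 𝕜` sending every vertex to `1`. -/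
noncomputable def augmentation (K : SimComplex V) : K.chains 𝕜 0 →ₗ[𝕜] 𝕜 :=
  Finsupp.lsum 𝕜 fun _ => LinearMap.id

/-- The reduced cycles in degree `n`. -/
noncomputable def cycles (K : SimComplex V) : (n : ℕ) → Submodule 𝕜 (K.chains 𝕜 n)
  | 0 => LinearMap.ker (K.augmentation 𝕜)
  | (n + 1) => LinearMap.ker (K.boundary 𝕜 n)

/-- The dimension of the reduced simplicial homology `H̃_n(K; 𝕜)` in degree `n ≥ 0`
(over the field `𝕜`, this also equals the dimension of reduced cohomology). -/
noncomputable def hdimNat (K : SimComplex V) (n : ℕ) : ℕ :=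
  finrank 𝕜 ↥(K.cycles 𝕜 n) -
    finrank 𝕜 ↥(LinearMap.range (K.boundary 𝕜 n) ⊓ K.cycles 𝕜 n)

/-- The dimension of reduced simplicial (co)homology `H̃_i(K; 𝕜)` for `i : ℤ`;
in degree `-1` it is `1` precisely for the empty complex. -/
noncomputable def hdim (K : SimComplex V) (i : ℤ) : ℕ :=
  letI := Classical.dec (K.faces = ∅)
  if i = -1 then (if K.faces = ∅ then 1 else 0)
  else if 0 ≤ i then K.hdimNat 𝕜 i.toNat else 0

/-- The full subcomplex of `K` on a vertex subset `J`. -/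
def restrict (K : SimComplex V) (J : Finset V) : SimComplex V where
  faces := {s | s ∈ K.faces ∧ s ⊆ J}
  not_empty_mem := fun h => K.not_empty_mem h.1
  down_closed := fun _ _ hs hts ht => ⟨K.down_closed hs.1 hts ht, hts.trans hs.2⟩

/-- The bigraded Betti numbers `β^{-i,2j}(𝕜[K]) = dim 𝕜Tor^{-i,2j}_{𝕜[v₁,…,v_m]}(𝕜[K],𝕜)`
of the Stanley–Reisner ring of `K`, expressed through Hochster's formula:
`β^{-i,2j}(K) = ∑_{J ⊆ [m], |J| = j} dim H̃^{j-i-1}(K_J; 𝕜)`. -/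
noncomputable def bbetti (K : SimComplex V) [Fintype V] (i j : ℕ) : ℕ :=
  ∑ J ∈ Finset.powersetCard j (Finset.univ : Finset V),
    (K.restrict J).hdim 𝕜 ((j : ℤ) - i - 1)

/-- Bigraded Betti numbers with integer (possibly out-of-range) indices:
`Tor^{-i,2j}` vanishes unless `i, j ≥ 0`. -/
noncomputable def bbettiZ (K : SimComplex V) [Fintype V] (i j : ℤ) : ℕ :=
  if 0 ≤ i ∧ 0 ≤ j then K.bbetti 𝕜 i.toNat j.toNat else 0

/-- `F` is a facet (maximal face) of `K`. -/
def IsFacet (K : SimComplex V) (F : Finset V) : Prop :=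
  F ∈ K.faces ∧ ∀ s ∈ K.faces, F ⊆ s → s = F

end SimComplex
namespace SimComplex

/-- The boundary complex `∂Δ^{n 0} * ⋯ * ∂Δ^{n (r-1)}` of the simplicial polytope dual to
the product of simplices `Δ^{n 0} × ⋯ × Δ^{n (r-1)}`: a subset is a face iff it is nonempty
and misses at least one vertex from every join factor. -/
def prodSimplicesDual (r : ℕ) (n : Fin r → ℕ) :
    SimComplex (Σ p : Fin r, Fin (n p + 1)) where
  faces := {s | s.Nonempty ∧
    ∀ p : Fin r, ∃ q : Fin (n p + 1), (⟨p, q⟩ : Σ p : Fin r, Fin (n p + 1)) ∉ s}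
  not_empty_mem := fun h => Finset.not_nonempty_empty h.1
  down_closed := fun _ _ hs hts ht =>
    ⟨ht, fun p => (hs.2 p).imp fun _ hq hmem => hq (hts hmem)⟩

/-- The stellar subdivision of the simplicial complex `K` at the face `F`, with a new
apex vertex `none`: faces of `K` not containing `F` survive, and cones (with apex `none`)
over proper subsets of `F` are added.  When `F` is a facet of `K`, this is the complex
obtained by replacing the facet `F` with the cone over its boundary, i.e. the operation
dual to cutting a vertex of a simple polytope. -/
def stellar (K : SimComplex V) (F : Finset V) : SimComplex (Option V) where
  faces := {s | s.Nonempty ∧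
    ((none ∉ s ∧ Finset.eraseNone s ∈ K.faces ∧ ¬ F ⊆ Finset.eraseNone s) ∨
     (none ∈ s ∧ Finset.eraseNone s ⊂ F ∧
        (Finset.eraseNone s ∈ K.faces ∨ Finset.eraseNone s = ∅)))}
  not_empty_mem := fun h => Finset.not_nonempty_empty h.1
  down_closed := by
    rintro s t ⟨hsne, hs⟩ hts htne
    refine ⟨htne, ?_⟩
    have hsub : Finset.eraseNone t ⊆ Finset.eraseNone s := by
      intro a ha
      rw [Finset.mem_eraseNone] at ha ⊢
      exact hts ha
    rcases hs with ⟨hn, hf, hF⟩ | ⟨hn, hF, hf⟩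
    · left
      have hnt : none ∉ t := fun h => hn (hts h)
      have htne' : (Finset.eraseNone t).Nonempty := by
        obtain ⟨x, hx⟩ := htne
        match x with
        | none => exact absurd hx hnt
        | some a => exact ⟨a, Finset.mem_eraseNone.mpr hx⟩
      exact ⟨hnt, K.down_closed hf hsub htne',
        fun h => hF (h.trans hsub)⟩
    · have hKs : (Finset.eraseNone t).Nonempty → Finset.eraseNone t ∈ K.faces := by
        intro htne'
        have hsne' : (Finset.eraseNone s).Nonempty := htne'.mono hsub
        rcases hf with hf | hf
        · exact K.down_closed hf hsub htne'
        · rw [hf] at hsub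
          exact absurd (Finset.subset_empty.mp hsub) htne'.ne_empty
      by_cases hnt : none ∈ t
      · right
        refine ⟨hnt, lt_of_le_of_lt hsub hF, ?_⟩
        rcases Finset.eq_empty_or_nonempty (Finset.eraseNone t) with h | h
        · exact Or.inr h
        · exact Or.inl (hKs h)
      · left
        have htne' : (Finset.eraseNone t).Nonempty := by
          obtain ⟨x, hx⟩ := htne
          match x with
          | none => exact absurd hx hnt
          | some a => exact ⟨a, Finset.mem_eraseNone.mpr hx⟩
        refine ⟨hnt, hKs htne', fun h => ?_⟩
        exact (lt_of_le_of_lt (h.trans hsub) hF).ne rfl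

/-- An isomorphism of simplicial complexes: a bijection of vertex types carrying
faces exactly to faces. -/
def Iso {W : Type*} (K : SimComplex V) (L : SimComplex W) : Prop :=
  ∃ e : V ≃ W, ∀ s : Finset V, s ∈ K.faces ↔ s.map e.toEmbedding ∈ L.faces

end SimComplex

open SimComplex in
/-- `K` is (isomorphic to) the boundary complex `K_P` of a generalized truncation polytope
`P = vc^k(Δ^{n 0} × ⋯ × Δ^{n (r-1)})` of type `(k; n)`, i.e. it is obtained from
`∂Δ^{n 0} * ⋯ * ∂Δ^{n (r-1)}` by `k` successive stellar subdivisions of facets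
(the operation dual to cutting a vertex of a simple polytope). -/
def IsGenTruncCx (r : ℕ) (n : Fin r → ℕ) : ℕ → (V : Type) → SimComplex V → Prop
  | 0, _, K => Iso (prodSimplicesDual r n) K
  | (k + 1), _, K => ∃ (W : Type) (L : SimComplex W) (F : Finset W),
      IsGenTruncCx r n k W L ∧ L.IsFacet F ∧ Iso (stellar L F) K
namespace SimComplex

/-- The join `∂Δ^{n₁} * ∂Δ^{n₂}` of two simplex boundaries, the boundary complex of
the simplicial polytope dual to `Δ^{n₁} × Δ^{n₂}`: the faces are the nonempty subsets
missing at least one vertex from each of the two factors. -/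
def twoSimplexJoin (n₁ n₂ : ℕ) : SimComplex (Fin (n₁ + 1) ⊕ Fin (n₂ + 1)) where
  faces := {s | s.Nonempty ∧ (∃ a, Sum.inl a ∉ s) ∧ (∃ b, Sum.inr b ∉ s)}
  not_empty_mem := fun h => Finset.not_nonempty_empty h.1
  down_closed := fun _ _ hs hts ht =>
    ⟨ht, (hs.2.1).imp fun _ ha hmem => ha (hts hmem),
      (hs.2.2).imp fun _ hb hmem => hb (hts hmem)⟩

end SimComplex

open SimComplex in
/-- `K` is the boundary complex `K_P` of a generalized truncation polytope
`P = vc^k(Δ^{n₁} × Δ^{n₂})`, together with the decomposition of its vertex set as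
`V₁ ⊔ V₂ ⊔ NV`, where `V₁, V₂` are the vertex sets coming from the two join factors
`∂Δ^{n₁}, ∂Δ^{n₂}` and `NV` is the set of `k` new apex vertices introduced by the `k`
successive stellar subdivisions of facets (dual to the `k` vertex cuts). -/
def IsGT2 (n₁ n₂ : ℕ) :
    ℕ → (V : Type) → SimComplex V → Finset V → Finset V → Finset V → Prop
  | 0, _, K, A, B, N =>
    ∃ e : (Fin (n₁ + 1) ⊕ Fin (n₂ + 1)) ≃ _,
      (∀ s, s ∈ (twoSimplexJoin n₁ n₂).faces ↔ s.map e.toEmbedding ∈ K.faces) ∧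
      A = (Finset.univ.map (Function.Embedding.inl)).map e.toEmbedding ∧
      B = (Finset.univ.map (Function.Embedding.inr)).map e.toEmbedding ∧
      N = ∅
  | (k + 1), V, K, A, B, N =>
    letI := Classical.decEq V
    ∃ (W : Type) (L : SimComplex W) (A' B' N' : Finset W) (F : Finset W)
      (e : Option W ≃ V),
      IsGT2 n₁ n₂ k W L A' B' N' ∧ L.IsFacet F ∧
      (∀ s, s ∈ (stellar L F).faces ↔ s.map e.toEmbedding ∈ K.faces) ∧
      A = (A'.map Function.Embedding.some).map e.toEmbedding ∧
      B = (B'.map Function.Embedding.some).map e.toEmbedding ∧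
      N = insert (e none) ((N'.map Function.Embedding.some).map e.toEmbedding)

set_option linter.unusedSectionVars false
namespace GTProof

section Chains

variable {V : Type} [Fintype V] [LinearOrder V] {𝕜 : Type} [Field 𝕜]

variable (𝕜) in
def sg (s : Finset V) (a : V) : 𝕜 := (-1) ^ (s.filter (fun b => b < a)).card

lemma sg_sq (s : Finset V) (a : V) : sg 𝕜 s a * sg 𝕜 s a = 1 := by
  unfold sg
  rw [← mul_pow]; simp

lemma sg_insert_self (s : Finset V) (a : V) : sg 𝕜 (insert a s) a = sg 𝕜 s a := by
  unfold sg
  congr 2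
  ext b; simp only [mem_filter, mem_insert]
  constructor
  · rintro ⟨rfl | h, h'⟩
    · exact absurd h' (lt_irrefl _)
    · exact ⟨h, h'⟩
  · rintro ⟨h, h'⟩; exact ⟨Or.inr h, h'⟩

lemma sg_erase_self (s : Finset V) (a : V) : sg 𝕜 (s.erase a) a = sg 𝕜 s a := by
  by_cases h : a ∈ s
  · conv_rhs => rw [← insert_erase h]
    rw [sg_insert_self]
  · rw [erase_eq_of_notMem h]

lemma sg_insert_lt (s : Finset V) (a b : V) (hb : b ∉ s) (h : b < a) :
    sg 𝕜 (insert b s) a = - sg 𝕜 s a := by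
  unfold sg
  rw [filter_insert, if_pos h, card_insert_of_notMem (by simp [hb]), pow_succ]
  ring

lemma sg_insert_gt (s : Finset V) (a b : V) (h : a < b) :
    sg 𝕜 (insert b s) a = sg 𝕜 s a := by
  unfold sg
  rw [filter_insert, if_neg (not_lt.mpr h.le)]

lemma sg_anti (s : Finset V) (a g : V) (ha : a ∉ s) (hg : g ∉ s) (hag : a ≠ g) :
    sg 𝕜 (insert g s) a * sg 𝕜 (insert a s) g = - (sg 𝕜 s g * sg 𝕜 s a) := by
  rcases lt_or_gt_of_ne hag with h | h
  · rw [sg_insert_gt _ _ _ h, sg_insert_lt _ _ _ ha h]; ring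
  · rw [sg_insert_gt _ _ _ h, sg_insert_lt _ _ _ hg h]; ring

variable (𝕜 V) in
abbrev Ch := Finset V → 𝕜

variable (𝕜 V) in
/-- global boundary operator -/
def D : Ch V 𝕜 →ₗ[𝕜] Ch V 𝕜 where
  toFun c := fun t => ∑ a, if a ∈ t then 0 else sg 𝕜 t a * c (insert a t)
  map_add' c d := by
    ext t
    simp only [Pi.add_apply]
    rw [← Finset.sum_add_distrib]
    refine Finset.sum_congr rfl fun a _ => ?_
    split_ifs <;> ring
  map_smul' r c := by
    ext t
    simp only [Pi.smul_apply, smul_eq_mul, RingHom.id_apply]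
    rw [Finset.mul_sum]
    refine Finset.sum_congr rfl fun a _ => ?_
    split_ifs <;> ring

variable (𝕜) in
/-- cone operator -/
def hc (g : V) : Ch V 𝕜 →ₗ[𝕜] Ch V 𝕜 where
  toFun c := fun t => if g ∈ t then sg 𝕜 t g * c (t.erase g) else 0
  map_add' c d := by
    ext t
    simp only [Pi.add_apply]
    split_ifs <;> ring
  map_smul' r c := by
    ext t
    simp only [Pi.smul_apply, smul_eq_mul, RingHom.id_apply]
    split_ifs <;> ring

lemma D_apply (c : Ch V 𝕜) (t : Finset V) :
    D V 𝕜 c t = ∑ a, if a ∈ t then 0 else sg 𝕜 t a * c (insert a t) := rfl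

lemma hc_apply (g : V) (c : Ch V 𝕜) (t : Finset V) :
    hc 𝕜 g c t = if g ∈ t then sg 𝕜 t g * c (t.erase g) else 0 := rfl

lemma homotopy (g : V) (c : Ch V 𝕜) : D V 𝕜 (hc 𝕜 g c) + hc 𝕜 g (D V 𝕜 c) = c := by
  ext t
  rw [Pi.add_apply, hc_apply]
  by_cases hg : g ∈ t
  · rw [if_pos hg, D_apply, D_apply]
    obtain ⟨s, hgs, rfl⟩ : ∃ s, g ∉ s ∧ t = insert g s :=
      ⟨t.erase g, notMem_erase _ _, (insert_erase hg).symm⟩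
    rw [erase_insert hgs, Finset.mul_sum, ← Finset.sum_add_distrib,
      Finset.sum_eq_single g]
    · simp only [mem_insert_self, if_true, hgs, if_false, zero_add]
      rw [sg_insert_self, ← mul_assoc, sg_sq, one_mul]
    · intro a _ hag
      by_cases has : a ∈ s
      · simp [has]
      · have h1 : a ∉ insert g s := by simp [hag, has]
        rw [if_neg h1, if_neg has, hc_apply, if_pos (by simp)]
        have h2 : (insert a (insert g s)).erase g = insert a s := by
          rw [erase_insert_of_ne hag, erase_insert hgs]
        have h3 : sg 𝕜 (insert a (insert g s)) g = sg 𝕜 (insert a s) g := by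
          rw [← sg_erase_self, h2]
        rw [h2, h3, ← mul_assoc, ← mul_assoc, sg_anti s a g has hgs hag, sg_insert_self]
        ring
    · simp
  · rw [if_neg hg, D_apply, Finset.sum_eq_single g]
    · rw [if_neg hg, hc_apply, if_pos (mem_insert_self _ _), erase_insert hg, sg_insert_self,
        ← mul_assoc, sg_sq]; simp
    · intro a _ hag
      by_cases hat : a ∈ t
      · simp [hat]
      · rw [if_neg hat, hc_apply, if_neg (by simp [hg, Ne.symm hag]), mul_zero]
    · simp

lemma D_hc (g : V) (c : Ch V 𝕜) : D V 𝕜 (hc 𝕜 g c) = c - hc 𝕜 g (D V 𝕜 c) :=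
  eq_sub_of_add_eq (homotopy g c)

lemma DD_apply (n : ℕ) : ∀ (t : Finset V), tᶜ.card = n → ∀ c : Ch V 𝕜,
    D V 𝕜 (D V 𝕜 c) t = 0 := by
  induction n with
  | zero =>
    intro t ht c
    have : t = univ := by simpa using ht
    subst this
    simp [D_apply]
  | succ n ih =>
    intro t ht c
    obtain ⟨g, hg⟩ : tᶜ.Nonempty := card_pos.mp (by omega)
    have hg' : g ∉ t := by simpa using hg
    have h1 : D V 𝕜 (D V 𝕜 (hc 𝕜 g c)) = hc 𝕜 g (D V 𝕜 (D V 𝕜 c)) := by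
      rw [D_hc, map_sub, D_hc]; abel
    have h2 := ih (insert g t) (by
      rw [compl_insert, card_erase_of_mem hg]; omega) (hc 𝕜 g c)
    rw [h1, hc_apply, if_pos (mem_insert_self _ _), erase_insert hg'] at h2
    have h3 : sg 𝕜 (insert g t) g ≠ 0 := by
      intro h
      have := sg_sq (𝕜 := 𝕜) (insert g t) g
      rw [h] at this; simp at this
    exact (mul_eq_zero.mp h2).resolve_left h3

lemma DD (c : Ch V 𝕜) : D V 𝕜 (D V 𝕜 c) = 0 := by
  ext t; exact DD_apply _ t rfl c

/-- `c` is supported on the sets of the family `F` with `m` elements -/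
def Sp (F : Set (Finset V)) (m : ℕ) (c : Ch V 𝕜) : Prop :=
  ∀ s, c s ≠ 0 → s ∈ F ∧ s.card = m

lemma Sp.add {F : Set (Finset V)} {m : ℕ} {c d : Ch V 𝕜} (hc : Sp F m c) (hd : Sp F m d) :
    Sp F m (c + d) := by
  intro s hs
  by_cases h : c s = 0
  · exact hd s (by simpa [h] using hs)
  · exact hc s h

lemma Sp.smul {F : Set (Finset V)} {m : ℕ} {c : Ch V 𝕜} (hc : Sp F m c) (t : 𝕜) :
    Sp F m (t • c) := by
  intro s hs
  exact hc s (fun h => hs (by simp [h]))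

lemma Sp.neg {F : Set (Finset V)} {m : ℕ} {c : Ch V 𝕜} (hc : Sp F m c) :
    Sp F m (-c) := by
  intro s hs
  exact hc s (fun h => hs (by simp [h]))

lemma Sp.sub {F : Set (Finset V)} {m : ℕ} {c d : Ch V 𝕜} (hc : Sp F m c) (hd : Sp F m d) :
    Sp F m (c - d) := by
  rw [sub_eq_add_neg]; exact hc.add hd.neg

lemma Sp.mono {F G : Set (Finset V)} {m : ℕ} {c : Ch V 𝕜} (hc : Sp F m c)
    (h : ∀ s ∈ F, s.card = m → s ∈ G) : Sp G m c :=
  fun s hs => ⟨h s (hc s hs).1 (hc s hs).2, (hc s hs).2⟩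

lemma Sp.hc {F G : Set (Finset V)} {m : ℕ} {c : Ch V 𝕜} {g : V} (h : Sp F m c)
    (hG : ∀ s ∈ F, s.card = m → g ∉ s → insert g s ∈ G) : Sp G (m + 1) (hc 𝕜 g c) := by
  intro s hs
  rw [hc_apply] at hs
  split_ifs at hs with hg
  · obtain ⟨h1, h2⟩ := h _ (right_ne_zero_of_mul hs)
    have := hG _ h1 h2 (notMem_erase _ _)
    rw [insert_erase hg] at this
    refine ⟨this, ?_⟩
    rw [card_erase_of_mem hg] at h2
    have := card_pos.mpr ⟨g, hg⟩
    omega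
  · exact absurd rfl hs

variable (𝕜) in
/-- acyclic in cardinality m -/
def Ac (F : Set (Finset V)) (m : ℕ) : Prop :=
  ∀ c : Ch V 𝕜, Sp F m c → D V 𝕜 c = 0 → ∃ c', Sp F (m + 1) c' ∧ D V 𝕜 c' = c

variable (𝕜) in
/-- one-dimensional homology in cardinality m -/
def On (F : Set (Finset V)) (m : ℕ) : Prop :=
  ∃ z : Ch V 𝕜, Sp F m z ∧ D V 𝕜 z = 0 ∧ (¬ ∃ c', Sp F (m + 1) c' ∧ D V 𝕜 c' = z) ∧
    ∀ c : Ch V 𝕜, Sp F m c → D V 𝕜 c = 0 →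
      ∃ (t : 𝕜) (c' : Ch V 𝕜), Sp F (m + 1) c' ∧ D V 𝕜 c' = c - t • z

lemma Sp_congr {F G : Set (Finset V)} {m : ℕ} (h : ∀ s, s.card = m → (s ∈ F ↔ s ∈ G))
    (c : Ch V 𝕜) : Sp F m c ↔ Sp G m c :=
  ⟨fun hc => hc.mono fun s hs hm => (h s hm).1 hs, fun hc => hc.mono fun s hs hm => (h s hm).2 hs⟩

lemma Ac_congr {F G : Set (Finset V)} {m : ℕ}
    (h : ∀ s, s.card = m ∨ s.card = m + 1 → (s ∈ F ↔ s ∈ G)) : Ac 𝕜 F m ↔ Ac 𝕜 G m := by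
  unfold Ac
  simp only [Sp_congr (𝕜 := 𝕜) (fun s hs => h s (Or.inl hs)),
    Sp_congr (𝕜 := 𝕜) (fun s hs => h s (Or.inr hs))]

lemma On_congr {F G : Set (Finset V)} {m : ℕ}
    (h : ∀ s, s.card = m ∨ s.card = m + 1 → (s ∈ F ↔ s ∈ G)) : On 𝕜 F m ↔ On 𝕜 G m := by
  unfold On
  simp only [Sp_congr (𝕜 := 𝕜) (fun s hs => h s (Or.inl hs)),
    Sp_congr (𝕜 := 𝕜) (fun s hs => h s (Or.inr hs))]

lemma Ac_cone {F : Set (Finset V)} {m : ℕ} (g : V)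
    (h : ∀ s ∈ F, s.card = m → g ∉ s → insert g s ∈ F) : Ac 𝕜 F m := by
  intro c hc1 hc2
  refine ⟨hc 𝕜 g c, hc1.hc h, ?_⟩
  rw [D_hc, hc2, map_zero, sub_zero]

lemma Ac_empty {F : Set (Finset V)} {m : ℕ}
    (h : ∀ s ∈ F, s.card ≠ m) : Ac 𝕜 F m := by
  intro c hc1 hc2
  have : c = 0 := by
    ext s
    by_contra hs
    exact h s (hc1 s hs).1 (hc1 s hs).2
  exact ⟨0, fun s hs => absurd rfl hs, by simp [this]⟩

/-- contraction -/
def con (v : V) (c : Ch V 𝕜) : Ch V 𝕜 :=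
  fun s => if v ∈ s then 0 else sg 𝕜 s v * c (insert v s)

lemma decomp_zero (v : V) (c : Ch V 𝕜) (s : Finset V) (hv : v ∈ s) :
    (c - hc 𝕜 v (con v c)) s = 0 := by
  rw [Pi.sub_apply, hc_apply, if_pos hv, con, if_neg (notMem_erase _ _), insert_erase hv,
    sg_erase_self, ← mul_assoc, sg_sq, one_mul, sub_self]

lemma decomp_of_notMem (v : V) (c : Ch V 𝕜) (s : Finset V) (hv : v ∉ s) :
    (c - hc 𝕜 v (con v c)) s = c s := by
  rw [Pi.sub_apply, hc_apply, if_neg hv, sub_zero]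

lemma D_zero_of_mem {v : V} {c : Ch V 𝕜} (h : ∀ s, v ∈ s → c s = 0) (s : Finset V) (hv : v ∈ s) :
    D V 𝕜 c s = 0 := by
  rw [D_apply]
  refine Finset.sum_eq_zero fun a _ => ?_
  rw [h _ (mem_insert_of_mem hv)]; simp

lemma D_con_zero (v : V) (c : Ch V 𝕜) (h : ∀ s, v ∈ s → D V 𝕜 c s = 0) :
    D V 𝕜 (con v c) = 0 := by
  have hcon : ∀ s, v ∈ s → con v c s = 0 := fun s hs => by simp [con, hs]
  ext t
  by_cases hv : v ∈ t
  · exact D_zero_of_mem hcon t hv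
  · have h1 := D_zero_of_mem (decomp_zero v c) (insert v t) (mem_insert_self _ _)
    rw [map_sub, D_hc, Pi.sub_apply, Pi.sub_apply, h _ (mem_insert_self _ _),
      hcon _ (mem_insert_self _ _), hc_apply, if_pos (mem_insert_self _ _), erase_insert hv] at h1
    have h3 : sg 𝕜 (insert v t) v ≠ 0 := by
      intro h
      have := sg_sq (𝕜 := 𝕜) (insert v t) v
      rw [h] at this; simp at this
    have h4 : sg 𝕜 (insert v t) v * D V 𝕜 (con v c) t = 0 := by
      linear_combination h1
    exact (mul_eq_zero.mp h4).resolve_left h3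

lemma Sp_con {G T : Set (Finset V)} {v : V} (hT : ∀ s, v ∉ s → insert v s ∈ G → s ∈ T)
    {m : ℕ} {c : Ch V 𝕜} (h : Sp G (m + 1) c) : Sp T m (con v c) := by
  intro s hs
  unfold con at hs
  split_ifs at hs with hv
  · exact absurd rfl hs
  · obtain ⟨h1, h2⟩ := h _ (right_ne_zero_of_mul hs)
    rw [card_insert_of_notMem hv] at h2
    exact ⟨hT s hv h1, by omega⟩

lemma Sp_dec {G M : Set (Finset V)} {v : V} (hM : ∀ s, v ∉ s → s ∈ G → s ∈ M)
    {m : ℕ} {c : Ch V 𝕜} (h : Sp G m c) : Sp M m (c - hc 𝕜 v (con v c)) := by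
  intro s hs
  by_cases hv : v ∈ s
  · exact absurd (decomp_zero v c s hv) hs
  · rw [decomp_of_notMem v c s hv] at hs
    exact ⟨hM s hv (h s hs).1, (h s hs).2⟩

lemma cone_surj {G M T : Set (Finset V)} {v : V}
    (hM : ∀ s, v ∉ s → s ∈ G → s ∈ M) (hT : ∀ s, v ∉ s → insert v s ∈ G → s ∈ T)
    (hT' : ∀ s ∈ T, insert v s ∈ G) {j : ℕ} (hTM : ∀ s ∈ T, s.card = j + 1 → s ∈ M)
    (hac : Ac 𝕜 T j) (c : Ch V 𝕜) (h : Sp G (j + 1) c) (hD : D V 𝕜 c = 0) :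
    ∃ x y : Ch V 𝕜, Sp M (j + 1) x ∧ Sp G (j + 2) y ∧ D V 𝕜 x = 0 ∧ c = x + D V 𝕜 y := by
  obtain ⟨b', hb', hDb⟩ := hac (con v c) (Sp_con hT h) (D_con_zero v c (by simp [hD]))
  refine ⟨c - hc 𝕜 v (con v c) + b', - hc 𝕜 v b', (Sp_dec hM h).add (hb'.mono hTM),
    (hb'.hc (fun s hs _ _ => hT' s hs)).neg, ?_, ?_⟩
  · have : c - hc 𝕜 v (con v c) + b' = c + D V 𝕜 (hc 𝕜 v b') := by
      rw [D_hc, hDb]; abel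
    rw [this, map_add, DD, hD, add_zero]
  · rw [map_neg, D_hc, hDb]; abel

lemma cone_inj {G M T : Set (Finset V)} {v : V}
    (hM : ∀ s, v ∉ s → s ∈ G → s ∈ M) (hMv : ∀ s ∈ M, v ∉ s)
    (hT : ∀ s, v ∉ s → insert v s ∈ G → s ∈ T)
    {m : ℕ} (hTM : ∀ s ∈ T, s.card = m + 1 → s ∈ M)
    (hac : Ac 𝕜 T m) (z c : Ch V 𝕜) (hz : Sp M m z) (h : Sp G (m + 1) c) (hD : D V 𝕜 c = z) :
    ∃ c', Sp M (m + 1) c' ∧ D V 𝕜 c' = z := by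
  have hcon := D_con_zero v c (by
    intro s hs
    rw [hD]
    by_contra hne
    exact hMv s (hz s hne).1 hs)
  obtain ⟨b', hb', hDb⟩ := hac (con v c) (Sp_con hT h) hcon
  refine ⟨c - hc 𝕜 v (con v c) + b', (Sp_dec hM h).add (hb'.mono hTM), ?_⟩
  rw [map_add, map_sub, D_hc, hcon, hDb, hD, map_zero]; abel

lemma Ac_attach {G M T : Set (Finset V)} {v : V} (hMG : M ⊆ G)
    (hM : ∀ s, v ∉ s → s ∈ G → s ∈ M) (hT : ∀ s, v ∉ s → insert v s ∈ G → s ∈ T)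
    (hT' : ∀ s ∈ T, insert v s ∈ G) {j : ℕ} (hTM : ∀ s ∈ T, s.card = j + 1 → s ∈ M)
    (hac : Ac 𝕜 T j) (h : Ac 𝕜 M (j + 1)) : Ac 𝕜 G (j + 1) := by
  intro c hc1 hc2
  obtain ⟨x, y, hx, hy, hDx, rfl⟩ := cone_surj hM hT hT' hTM hac c hc1 hc2
  obtain ⟨w, hw, rfl⟩ := h x hx hDx
  exact ⟨w + y, (hw.mono fun s hs _ => hMG hs).add hy, map_add _ _ _⟩

lemma On_attach {G M T : Set (Finset V)} {v : V} (hMG : M ⊆ G)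
    (hM : ∀ s, v ∉ s → s ∈ G → s ∈ M) (hMv : ∀ s ∈ M, v ∉ s)
    (hT : ∀ s, v ∉ s → insert v s ∈ G → s ∈ T)
    (hT' : ∀ s ∈ T, insert v s ∈ G) {j : ℕ} (hTM : ∀ s ∈ T, s.Nonempty → s ∈ M)
    (hac : Ac 𝕜 T j) (hac' : Ac 𝕜 T (j + 1)) (h : On 𝕜 M (j + 1)) : On 𝕜 G (j + 1) := by
  obtain ⟨z, hz, hDz, hn, hspan⟩ := h
  have hTM' : ∀ k, ∀ s ∈ T, s.card = k + 1 → s ∈ M :=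
    fun k s hs hk => hTM s hs (card_pos.mp (by omega))
  refine ⟨z, hz.mono fun s hs _ => hMG hs, hDz, ?_, ?_⟩
  · rintro ⟨c, hc1, hc2⟩
    exact hn (cone_inj hM hMv hT (hTM' _) hac' z c hz hc1 hc2)
  · intro c hc1 hc2
    obtain ⟨x, y, hx, hy, hDx, rfl⟩ := cone_surj hM hT hT' (hTM' _) hac c hc1 hc2
    obtain ⟨t, w, hw, hDw⟩ := hspan x hx hDx
    refine ⟨t, w + y, (hw.mono fun s hs _ => hMG hs).add hy, ?_⟩
    rw [map_add, hDw]; abel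

/-- augmented join of two simplex boundaries -/
def J (A B : Finset V) : Set (Finset V) := {s | s ⊆ A ∪ B ∧ ¬ A ⊆ s ∧ ¬ B ⊆ s}

lemma Ac_join (B : Finset V) (hB : B.Nonempty) (n : ℕ) : ∀ (A : Finset V), A.card = n + 1 →
    Disjoint A B → ∀ m, m + 3 ≤ A.card + B.card → Ac 𝕜 (J A B) m := by
  induction n with
  | zero =>
    intro A hA hAB m hm
    obtain ⟨b, hb⟩ := hB
    obtain ⟨a, rfl⟩ := card_eq_one.mp hA
    have hab : a ∉ B := by simpa using hAB
    refine Ac_cone b ?_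
    rintro s ⟨h1, h2, h3⟩ hs hbs
    refine ⟨insert_subset (by simp [hb]) h1, ?_, ?_⟩
    · intro h
      have ha : a ∈ insert b s := by simpa using h
      rw [mem_insert] at ha
      rcases ha with rfl | ha
      · exact hab hb
      · exact h2 (by simpa using ha)
    · intro h
      have := card_le_card h
      rw [card_insert_of_notMem hbs] at this
      simp at hm
      omega
  | succ n ih =>
    intro A hA hAB m hm
    obtain ⟨a, ha⟩ : A.Nonempty := card_pos.mp (by omega)
    have haB : a ∉ B := disjoint_left.mp hAB ha
    have hA' : (A.erase a).card = n + 1 := by rw [card_erase_of_mem ha]; omega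
    obtain ⟨g, hg⟩ : (A.erase a).Nonempty := card_pos.mp (by omega)
    have hgA : g ∈ A := mem_of_mem_erase hg
    have hgB : g ∉ B := disjoint_left.mp hAB hgA
    have hBg : ∀ s, ¬ B ⊆ s → ¬ B ⊆ insert g s := by
      intro s hs h
      exact hs fun b hb => (mem_insert.mp (h hb)).resolve_left (fun h => hgB (h ▸ hb))
    cases m with
    | zero =>
      refine Ac_cone g ?_
      rintro s ⟨h1, h2, h3⟩ hs hgs
      refine ⟨insert_subset (by simp [hgA]) h1, ?_, hBg s h3⟩
      intro h
      have := card_le_card h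
      rw [card_insert_of_notMem hgs] at this
      omega
    | succ j =>
      refine Ac_attach (v := a) (M := {s | s ∈ J A B ∧ a ∉ s}) (T := J (A.erase a) B)
        (fun s hs => hs.1) (fun s h1 h2 => ⟨h2, h1⟩) ?_ ?_ ?_ ?_ ?_
      · rintro s has ⟨h1, h2, h3⟩
        refine ⟨fun x hx => ?_, fun h => h2 ?_, fun h => h3 (h.trans (subset_insert _ _))⟩
        · have := h1 (mem_insert_of_mem hx)
          have hxa : x ≠ a := fun h => has (h ▸ hx)
          simpa [hxa] using this
        · rw [← insert_erase ha]; exact insert_subset_insert _ h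
      · rintro s ⟨h1, h2, h3⟩
        refine ⟨insert_subset (by simp [ha]) (h1.trans (union_subset_union_left (erase_subset _ _))),
          fun h => h2 ?_, fun h => h3 ?_⟩
        · intro x hx
          rw [mem_erase] at hx
          exact (mem_insert.mp (h hx.2)).resolve_left hx.1
        · intro x hx
          exact (mem_insert.mp (h hx)).resolve_left (fun h => haB (h ▸ hx))
      · rintro s ⟨h1, h2, h3⟩ _
        have has : a ∉ s := fun h => by
          have := h1 h
          simp [haB] at this
        exact ⟨⟨h1.trans (union_subset_union_left (erase_subset _ _)), fun h => has (h ha), h3⟩, has⟩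
      · exact ih _ hA' (hAB.mono_left (erase_subset _ _)) j (by omega)
      · refine Ac_cone g ?_
        rintro s ⟨⟨h1, h2, h3⟩, has⟩ hs hgs
        have : a ∉ insert g s := by
          rw [mem_insert, not_or]
          exact ⟨fun h => by simp [h] at hg, has⟩
        exact ⟨⟨insert_subset (by simp [hgA]) h1, fun h => this (h ha), hBg s h3⟩, this⟩

lemma single_zero_of_card {A : Finset V} {F : Set (Finset V)} {m : ℕ} (hA : A.card = m)
    (hF : ∀ s ∈ F, s ⊆ A) (c : Ch V 𝕜) (h : Sp F m c) : c = c A • Pi.single A 1 := by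
  ext s
  by_cases hs : s = A
  · subst hs; simp
  · simp only [Pi.smul_apply, smul_eq_mul, Pi.single_eq_of_ne hs, mul_zero]
    by_contra hne
    obtain ⟨h1, h2⟩ := h s hne
    exact hs (eq_of_subset_of_card_le (hF s h1) (by omega))

/-- boundary of a simplex -/
lemma On_simplex (A : Finset V) (m : ℕ) (hA : A.card = m + 1) (F : Set (Finset V))
    (hF : ∀ s, s.Nonempty → (s ∈ F ↔ s ⊂ A)) (hm : 1 ≤ m) : On 𝕜 F m := by
  obtain ⟨g, hg⟩ : A.Nonempty := card_pos.mp (by omega)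
  have hsp : Sp F m (D V 𝕜 (Pi.single A 1)) := by
    intro s hs
    rw [D_apply] at hs
    obtain ⟨a, -, ha⟩ := Finset.exists_ne_zero_of_sum_ne_zero hs
    split_ifs at ha with has
    · exact absurd rfl ha
    · have h1 : insert a s = A := by
        by_contra hne
        exact ha (by rw [Pi.single_eq_of_ne hne, mul_zero])
      have h2 : s.card = m := by
        rw [← h1, card_insert_of_notMem has] at hA; omega
      refine ⟨(hF s (card_pos.mp (by omega))).2 ?_, h2⟩
      rw [← h1]; exact ssubset_insert has
  have hne : D V 𝕜 (Pi.single A 1) ≠ 0 := by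
    intro h
    have h1 := homotopy g (Pi.single A (1 : 𝕜))
    rw [h, map_zero, add_zero] at h1
    have h2 : hc 𝕜 g (Pi.single A (1 : 𝕜)) = 0 := by
      ext s
      rw [hc_apply]
      split_ifs with hgs
      · rw [Pi.single_eq_of_ne, mul_zero]; · rfl
        intro h
        rw [← h] at hg
        simp at hg
      · rfl
    rw [h2, map_zero] at h1
    have := congrFun h1 A
    simp at this
  refine ⟨_, hsp, DD _, ?_, ?_⟩
  · rintro ⟨c, hc1, hc2⟩
    have : c = 0 := by
      ext s
      by_contra hs
      obtain ⟨h1, h2⟩ := hc1 s hs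
      have := card_lt_card ((hF s (card_pos.mp (by omega))).1 h1)
      omega
    rw [this, map_zero] at hc2
    exact hne hc2.symm
  · intro c hc1 hc2
    have h1 : Sp {s | s ⊆ A} (m + 1) (hc 𝕜 g c) := by
      refine hc1.hc fun s hs hsm _ => ?_
      exact insert_subset hg ((hF s (card_pos.mp (by omega))).1 hs).1
    have h2 := single_zero_of_card hA (fun s hs => hs) _ h1
    refine ⟨hc 𝕜 g c A, 0, fun s hs => absurd rfl hs, ?_⟩
    rw [← map_smul, ← h2, D_hc, hc2, map_zero, map_zero]; abel

lemma Ac_simplex (A : Finset V) (n m : ℕ) (hA : A.card = n + 1) (F : Set (Finset V))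
    (hF : ∀ s, s.Nonempty → (s ∈ F ↔ s ⊂ A)) (hm : 1 ≤ m) (hmn : m ≠ n) : Ac 𝕜 F m := by
  rcases lt_or_gt_of_ne hmn with h | h
  · obtain ⟨g, hg⟩ : A.Nonempty := card_pos.mp (by omega)
    refine Ac_cone g fun s hs hsm hgs => ?_
    rw [hF _ (insert_nonempty _ _)]
    have h1 := (hF s (card_pos.mp (by omega))).1 hs
    refine ⟨insert_subset hg h1.1, fun h => ?_⟩
    have := card_le_card h
    rw [card_insert_of_notMem hgs] at this
    omega
  · refine Ac_empty fun s hs hsm => ?_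
    have := card_lt_card ((hF s (card_pos.mp (by omega))).1 hs)
    omega

def Rs (F : Set (Finset V)) (W : Finset V) : Set (Finset V) := {s | s ∈ F ∧ s ⊆ W}

variable (𝕜) in
def Goal (n₁ n₂ : ℕ) (A B W : Finset V) (F : Set (Finset V)) (m : ℕ) : Prop :=
  (((m = n₁ ∧ A ⊆ W ∧ Disjoint W B) ∨ (m = n₂ ∧ B ⊆ W ∧ Disjoint W A)) → On 𝕜 (Rs F W) m) ∧
  (¬ ((m = n₁ ∧ A ⊆ W ∧ Disjoint W B) ∨ (m = n₂ ∧ B ⊆ W ∧ Disjoint W A)) → Ac 𝕜 (Rs F W) m)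

inductive GTF (n₁ n₂ : ℕ) (A B : Finset V) : Set (Finset V) → Prop
  | base (F : Set (Finset V)) (hA : A.card = n₁ + 1) (hB : B.card = n₂ + 1) (hAB : Disjoint A B)
      (hF : ∀ s, s ∈ F ↔ s.Nonempty ∧ s ⊆ A ∪ B ∧ ¬ A ⊆ s ∧ ¬ B ⊆ s) : GTF n₁ n₂ A B F
  | step (L G : Set (Finset V)) (F : Finset V) (v : V) (hL : GTF n₁ n₂ A B L)
      (hF : F ∈ L) (hF' : ∀ s ∈ L, F ⊆ s → s = F) (hF'' : ∀ s ⊂ F, s.Nonempty → s ∈ L)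
      (hv : ∀ s ∈ L, v ∉ s)
      (hG : ∀ s, s ∈ G ↔ (s ∈ L ∧ s ≠ F) ∨ (v ∈ s ∧ s.erase v ⊂ F)) : GTF n₁ n₂ A B G

lemma Goal_base (n₁ n₂ : ℕ) (hn₁ : 2 ≤ n₁) (hn₂ : 2 ≤ n₂) (A B W : Finset V)
    (F : Set (Finset V)) (hA : A.card = n₁ + 1) (hB : B.card = n₂ + 1) (hAB : Disjoint A B)
    (hF : ∀ s, s ∈ F ↔ s.Nonempty ∧ s ⊆ A ∪ B ∧ ¬ A ⊆ s ∧ ¬ B ⊆ s) (m : ℕ)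
    (hm : 2 ≤ m) (hm' : m + 2 ≤ n₁ + n₂) :
    Goal 𝕜 n₁ n₂ A B W F m := by
  have hAne : A.Nonempty := card_pos.mp (by omega)
  have hBne : B.Nonempty := card_pos.mp (by omega)
  -- only A
  have key1 : A ⊆ W → Disjoint W B → ∀ s : Finset V, s.Nonempty → (s ∈ Rs F W ↔ s ⊂ A) := by
    intro hAW hWB s hs
    simp only [Rs, Set.mem_ofPred_eq, hF]
    constructor
    · rintro ⟨⟨-, h1, h2, h3⟩, h4⟩
      refine ⟨fun x hx => ?_, h2⟩
      exact (mem_union.mp (h1 hx)).resolve_right (disjoint_left.mp hWB (h4 hx))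
    · rintro ⟨h1, h2⟩
      obtain ⟨b, hb⟩ := hBne
      exact ⟨⟨hs, h1.trans subset_union_left, h2,
        fun h => disjoint_left.mp hAB (h1 (h hb)) hb⟩, h1.trans hAW⟩
  have key2 : B ⊆ W → Disjoint W A → ∀ s : Finset V, s.Nonempty → (s ∈ Rs F W ↔ s ⊂ B) := by
    intro hAW hWB s hs
    simp only [Rs, Set.mem_ofPred_eq, hF]
    constructor
    · rintro ⟨⟨-, h1, h2, h3⟩, h4⟩
      refine ⟨fun x hx => ?_, h3⟩
      exact (mem_union.mp (h1 hx)).resolve_left (disjoint_left.mp hWB (h4 hx))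
    · rintro ⟨h1, h2⟩
      obtain ⟨b, hb⟩ := hAne
      exact ⟨⟨hs, h1.trans subset_union_right,
        fun h => disjoint_left.mp hAB hb (h1 (h hb)), h2⟩, h1.trans hAW⟩
  -- cone
  have key3 : ∀ g ∈ W, g ∈ A → ¬ A ⊆ W → Ac 𝕜 (Rs F W) m := by
    intro g hgW hgA hAW
    refine Ac_cone g ?_
    rintro s ⟨h1, h2⟩ - -
    rw [hF] at h1
    obtain ⟨-, h3, h4, h5⟩ := h1
    have h6 : insert g s ⊆ W := insert_subset hgW h2
    refine ⟨(hF _).2 ⟨insert_nonempty _ _, insert_subset (by simp [hgA]) h3,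
      fun h => hAW (h.trans h6), fun h => h5 fun b hb => ?_⟩, h6⟩
    exact (mem_insert.mp (h hb)).resolve_left (fun h => disjoint_left.mp hAB hgA (h ▸ hb))
  have key4 : ∀ g ∈ W, g ∈ B → ¬ B ⊆ W → Ac 𝕜 (Rs F W) m := by
    intro g hgW hgB hBW
    refine Ac_cone g ?_
    rintro s ⟨h1, h2⟩ - -
    rw [hF] at h1
    obtain ⟨-, h3, h4, h5⟩ := h1
    have h6 : insert g s ⊆ W := insert_subset hgW h2
    refine ⟨(hF _).2 ⟨insert_nonempty _ _, insert_subset (by simp [hgB]) h3,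
      fun h => h4 fun b hb => ?_, fun h => hBW (h.trans h6)⟩, h6⟩
    exact (mem_insert.mp (h hb)).resolve_left (fun h => disjoint_left.mp hAB hb (h ▸ hgB))
  constructor
  · rintro (⟨rfl, h1, h2⟩ | ⟨rfl, h1, h2⟩)
    · exact On_simplex A m hA _ (key1 h1 h2) (by omega)
    · exact On_simplex B m hB _ (key2 h1 h2) (by omega)
  · intro hno
    rw [not_or] at hno
    by_cases hAW : A ⊆ W
    · by_cases hWB : Disjoint W B
      · exact Ac_simplex A n₁ m hA _ (key1 hAW hWB) (by omega) (fun h => hno.1 ⟨h, hAW, hWB⟩)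
      · obtain ⟨g, hg1, hg2⟩ := not_disjoint_iff.mp hWB
        by_cases hBW : B ⊆ W
        · rw [Ac_congr (G := J A B)]
          · exact Ac_join B hBne n₁ A hA hAB m (by omega)
          · intro s hs
            have hsne : s.Nonempty := card_pos.mp (by omega)
            simp only [Rs, J, Set.mem_ofPred_eq, hF]
            constructor
            · rintro ⟨h, -⟩; exact h.2
            · intro h; exact ⟨⟨hsne, h⟩, h.1.trans (union_subset hAW hBW)⟩
        · exact key4 g hg1 hg2 hBW
    · by_cases hWA : Disjoint W A
      · by_cases hBW : B ⊆ W
        · exact Ac_simplex B n₂ m hB _ (key2 hBW hWA) (by omega) (fun h => hno.2 ⟨h, hBW, hWA⟩)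
        · by_cases hWB : Disjoint W B
          · refine Ac_empty ?_
            rintro s ⟨h1, h2⟩ hs
            rw [hF] at h1
            obtain ⟨x, hx⟩ := h1.1
            rcases mem_union.mp (h1.2.1 hx) with h | h
            · exact disjoint_left.mp hWA (h2 hx) h
            · exact disjoint_left.mp hWB (h2 hx) h
          · obtain ⟨g, hg1, hg2⟩ := not_disjoint_iff.mp hWB
            exact key4 g hg1 hg2 hBW
      · obtain ⟨g, hg1, hg2⟩ := not_disjoint_iff.mp hWA
        exact key3 g hg1 hg2 hAW

lemma GTF_pure {n₁ n₂ : ℕ} {A B : Finset V} {F : Set (Finset V)} (h : GTF n₁ n₂ A B F) :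
    ∀ s ∈ F, ∃ t ∈ F, s ⊆ t ∧ t.card = n₁ + n₂ := by
  induction h with
  | base F hA hB hAB hF =>
    intro s hs
    rw [hF] at hs
    obtain ⟨h0, h1, h2, h3⟩ := hs
    obtain ⟨a, ha, has⟩ := not_subset.mp h2
    obtain ⟨b, hb, hbs⟩ := not_subset.mp h3
    have hst : s ⊆ ((A ∪ B).erase a).erase b := by
      intro x hx
      simp only [mem_erase]
      exact ⟨fun h => hbs (h ▸ hx), fun h => has (h ▸ hx), h1 hx⟩
    refine ⟨((A ∪ B).erase a).erase b, ?_, hst, ?_⟩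
    · rw [hF]
      refine ⟨h0.mono hst, ?_, fun h => ?_, fun h => ?_⟩
      · exact (erase_subset _ _).trans (erase_subset _ _)
      · have := h ha; simp at this
      · have := h hb; simp at this
    · have hab : b ≠ a := fun h => disjoint_left.mp hAB ha (h ▸ hb)
      rw [card_erase_of_mem (by simp [hab, hb]), card_erase_of_mem (by simp [ha]),
        card_union_of_disjoint hAB]
      omega
  | step L G F v hL hF hF' hF'' hv hG ih =>
    have hFc : F.card = n₁ + n₂ := by
      obtain ⟨t, ht, hFt, htc⟩ := ih F hF
      rw [← hF' t ht hFt]; exact htc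
    have hvF := hv F hF
    have main : ∀ s, s.erase v ⊂ F → ∃ t ∈ G, s ⊆ t ∧ t.card = n₁ + n₂ := by
      intro s hs
      obtain ⟨a, haF, has⟩ := exists_of_ssubset hs
      have hva : v ∉ F.erase a := fun h => hvF (mem_of_mem_erase h)
      refine ⟨insert v (F.erase a), ?_, ?_, ?_⟩
      · rw [hG]; right
        refine ⟨mem_insert_self _ _, ?_⟩
        rw [erase_insert hva]
        exact erase_ssubset haF
      · intro x hx
        by_cases hxv : x = v
        · simp [hxv]
        · have hx' : x ∈ s.erase v := mem_erase.mpr ⟨hxv, hx⟩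
          refine mem_insert_of_mem (mem_erase.mpr ⟨fun h => has (h ▸ hx'), hs.1 hx'⟩)
      · rw [card_insert_of_notMem hva, card_erase_of_mem haF]
        have := card_pos.mpr ⟨a, haF⟩
        omega
    intro s hs
    rw [hG] at hs
    rcases hs with ⟨h1, h2⟩ | ⟨h1, h2⟩
    · obtain ⟨t, ht, hst, htc⟩ := ih s h1
      by_cases htF : t = F
      · refine main s ?_
        rw [erase_eq_of_notMem (hv s h1)]
        subst htF
        exact hst.ssubset_of_ne h2
      · exact ⟨t, (hG t).2 (Or.inl ⟨ht, htF⟩), hst, htc⟩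
    · exact main s h2

lemma Goal_all (n₁ n₂ : ℕ) (hn₁ : 2 ≤ n₁) (hn₂ : 2 ≤ n₂) (A B W : Finset V)
    (F : Set (Finset V)) (h : GTF n₁ n₂ A B F) (m : ℕ)
    (hm : 2 ≤ m) (hm' : m + 2 ≤ n₁ + n₂) : Goal 𝕜 n₁ n₂ A B W F m := by
  induction h with
  | base F hA hB hAB hF => exact Goal_base n₁ n₂ hn₁ hn₂ A B W F hA hB hAB hF m hm hm'
  | step L G F v hL hF hF' hF'' hv hG ih =>
    have hFc : F.card = n₁ + n₂ := by
      obtain ⟨t, ht, hFt, htc⟩ := GTF_pure hL F hF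
      rw [← hF' t ht hFt]; exact htc
    have hvF := hv F hF
    set M : Set (Finset V) := {s | s ∈ L ∧ s ≠ F ∧ s ⊆ W} with hMdef
    have hcongr : ∀ s : Finset V, s.card = m ∨ s.card = m + 1 → (s ∈ Rs L W ↔ s ∈ M) := by
      intro s hs
      have hsF : s ≠ F := by rintro rfl; omega
      simp [Rs, hMdef, hsF]
    have hMv : ∀ s ∈ M, v ∉ s := fun s hs => hv s hs.1
    by_cases hvW : v ∈ W
    · set T : Set (Finset V) := {s | s ⊂ F ∧ s ⊆ W} with hTdef
      obtain ⟨j, rfl⟩ : ∃ j, m = j + 1 := ⟨m - 1, by omega⟩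
      have hMG : M ⊆ Rs G W := fun s hs => ⟨(hG s).2 (Or.inl ⟨hs.1, hs.2.1⟩), hs.2.2⟩
      have hM : ∀ s, v ∉ s → s ∈ Rs G W → s ∈ M := by
        rintro s hvs ⟨h1, h2⟩
        rw [hG] at h1
        rcases h1 with h1 | h1
        · exact ⟨h1.1, h1.2, h2⟩
        · exact absurd h1.1 hvs
      have hT : ∀ s, v ∉ s → insert v s ∈ Rs G W → s ∈ T := by
        rintro s hvs ⟨h1, h2⟩
        rw [hG] at h1
        rcases h1 with h1 | h1
        · exact absurd (mem_insert_self _ _) (hv _ h1.1)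
        · rw [erase_insert hvs] at h1
          exact ⟨h1.2, (subset_insert _ _).trans h2⟩
      have hT' : ∀ s ∈ T, insert v s ∈ Rs G W := by
        rintro s ⟨h1, h2⟩
        have hvs : v ∉ s := fun h => hvF (h1.1 h)
        refine ⟨(hG _).2 (Or.inr ⟨mem_insert_self _ _, ?_⟩), insert_subset hvW h2⟩
        rwa [erase_insert hvs]
      have hTM : ∀ s ∈ T, s.Nonempty → s ∈ M := by
        rintro s ⟨h1, h2⟩ hs
        exact ⟨hF'' s h1 hs, h1.ne, h2⟩
      have hac : ∀ i, 1 ≤ i → i ≤ j + 1 → Ac 𝕜 T i := by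
        intro i hi hij
        by_cases hne : (F ∩ W).Nonempty
        · obtain ⟨g, hg⟩ := hne
          rw [mem_inter] at hg
          refine Ac_cone g ?_
          rintro s ⟨h1, h2⟩ hs hgs
          refine ⟨⟨insert_subset hg.1 h1.1, fun h => ?_⟩, insert_subset hg.2 h2⟩
          have := card_le_card h
          rw [card_insert_of_notMem hgs] at this
          omega
        · refine Ac_empty ?_
          rintro s ⟨h1, h2⟩ hs
          obtain ⟨x, hx⟩ : s.Nonempty := card_pos.mp (by omega)
          exact hne ⟨x, mem_inter.mpr ⟨h1.1 hx, h2 hx⟩⟩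
      refine ⟨fun h => ?_, fun h => ?_⟩
      · exact On_attach hMG hM hMv hT hT' hTM (hac j (by omega) (by omega))
          (hac (j + 1) (by omega) le_rfl) ((On_congr hcongr).1 (ih.1 h))
      · exact Ac_attach hMG hM hT hT' (fun s hs hc => hTM s hs (card_pos.mp (by omega)))
          (hac j (by omega) (by omega)) ((Ac_congr hcongr).1 (ih.2 h))
    · have : Rs G W = M := by
        ext s
        constructor
        · rintro ⟨h1, h2⟩
          rw [hG] at h1
          rcases h1 with h1 | h1
          · exact ⟨h1.1, h1.2, h2⟩
          · exact absurd (h2 h1.1) hvW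
        · rintro ⟨h1, h2, h3⟩
          exact ⟨(hG s).2 (Or.inl ⟨h1, h2⟩), h3⟩
      refine ⟨fun h => ?_, fun h => ?_⟩
      · rw [this]; exact (On_congr hcongr).1 (ih.1 h)
      · rw [this]; exact (Ac_congr hcongr).1 (ih.2 h)

end Chains

section Conv

variable {V : Type} [Fintype V] [LinearOrder V]

lemma conv_GT (n₁ n₂ : ℕ) (k : ℕ) : ∀ (V' : Type) (L : SimComplex V') (A B N : Finset V'),
    IsGT2 n₁ n₂ k V' L A B N → ∀ f : V' ↪ V,
    GTF n₁ n₂ (A.map f) (B.map f) {s | ∃ t ∈ L.faces, t.map f = s} := by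
  induction k with
  | zero =>
    intro V' L A B N h f
    obtain ⟨e, he, rfl, rfl, -⟩ := h
    refine GTF.base _ (by simp) (by simp) ?_ ?_
    · rw [disjoint_map, disjoint_map, disjoint_left]
      intro x hx hy
      simp only [mem_map, mem_univ, true_and] at hx hy
      obtain ⟨a, rfl⟩ := hx
      obtain ⟨b, hb⟩ := hy
      simp at hb
    · intro s
      constructor
      · rintro ⟨t, ht, rfl⟩
        obtain ⟨u, rfl⟩ : ∃ u, t = u.map e.toEmbedding :=
          ⟨t.map e.symm.toEmbedding, by ext; simp [mem_map_equiv]⟩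
        obtain ⟨h1, ⟨a, ha⟩, ⟨b, hb⟩⟩ := (he u).2 ht
        refine ⟨by simpa using h1, ?_, ?_, ?_⟩
        · intro x hx
          simp only [mem_map] at hx
          obtain ⟨_, ⟨y, hy, rfl⟩, rfl⟩ := hx
          rcases y with y | y <;> simp
        · rw [map_subset_map, map_subset_map]
          intro h; exact ha (h (by simp))
        · rw [map_subset_map, map_subset_map]
          intro h; exact hb (h (by simp))
      · rintro ⟨h1, h2, h3, h4⟩
        classical
        rw [← map_union, ← map_union] at h2
        obtain ⟨t, -, rfl⟩ := subset_map_iff.mp h2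
        obtain ⟨u, rfl⟩ : ∃ u, t = u.map e.toEmbedding :=
          ⟨t.map e.symm.toEmbedding, by ext; simp [mem_map_equiv]⟩
        refine ⟨_, (he u).1 ⟨by simpa using h1, ?_, ?_⟩, rfl⟩
        · by_contra! hcon
          rw [map_subset_map, map_subset_map] at h3
          apply h3
          intro x hx
          simp only [mem_map, mem_univ, true_and] at hx
          obtain ⟨a, rfl⟩ := hx
          exact hcon a
        · by_contra! hcon
          rw [map_subset_map, map_subset_map] at h4
          apply h4
          intro x hx
          simp only [mem_map, mem_univ, true_and] at hx
          obtain ⟨a, rfl⟩ := hx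
          exact hcon a
  | succ k ih =>
    intro V' K A B N h f
    obtain ⟨W, L, A', B', N', F, e, hL, hF, he, rfl, rfl, -⟩ := h
    set φ : Option W ↪ V := e.toEmbedding.trans f with hφ
    set f' : W ↪ V := Function.Embedding.some.trans φ with hf'
    have h0 := ih W L A' B' N' hL f'
    have hmap : ∀ X : Finset W, ((X.map Function.Embedding.some).map e.toEmbedding).map f
        = X.map f' := by
      intro X; simp only [map_map, hf', hφ]; rfl
    rw [hmap, hmap]
    have hvf : ∀ X : Finset W, φ none ∉ X.map f' := by
      intro X hX
      obtain ⟨x, -, hx⟩ := mem_map.mp hX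
      have := φ.injective hx
      simp at this
    have hnn : ∀ u : Finset (Option W), none ∉ u → u.map φ = (eraseNone u).map f' := by
      intro u hu
      ext x
      simp only [mem_map, mem_eraseNone]
      constructor
      · rintro ⟨y, hy, rfl⟩
        match y with
        | none => exact absurd hy hu
        | some y => exact ⟨y, hy, rfl⟩
      · rintro ⟨y, hy, rfl⟩
        exact ⟨some y, hy, rfl⟩
    have hnm : ∀ u : Finset (Option W), none ∈ u →
        u.map φ = insert (φ none) ((eraseNone u).map f') := by
      intro u hu
      ext x
      simp only [mem_map, mem_eraseNone, mem_insert]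
      constructor
      · rintro ⟨y, hy, rfl⟩
        match y with
        | none => exact Or.inl rfl
        | some y => exact Or.inr ⟨y, hy, rfl⟩
      · rintro (rfl | ⟨y, hy, rfl⟩)
        · exact ⟨none, hu, rfl⟩
        · exact ⟨some y, hy, rfl⟩
    have hFne : F.Nonempty := by
      rw [nonempty_iff_ne_empty]; rintro rfl; exact L.not_empty_mem hF.1
    refine GTF.step _ _ (F.map f') (φ none) h0 ⟨F, hF.1, rfl⟩ ?_ ?_ ?_ ?_
    · rintro _ ⟨t, ht, rfl⟩ hFt
      rw [map_subset_map] at hFt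
      rw [hF.2 t ht hFt]
    · intro s hs hsne
      obtain ⟨t, htF, rfl⟩ := subset_map_iff.mp hs.1
      exact ⟨t, L.down_closed hF.1 htF (by simpa using hsne), rfl⟩
    · rintro _ ⟨t, ht, rfl⟩
      exact hvf t
    · intro s
      have hK : s ∈ {s | ∃ t ∈ K.faces, t.map f = s} ↔ ∃ u ∈ (SimComplex.stellar L F).faces, u.map φ = s := by
        constructor
        · rintro ⟨t, ht, rfl⟩
          obtain ⟨u, rfl⟩ : ∃ u, t = u.map e.toEmbedding :=
            ⟨t.map e.symm.toEmbedding, by ext; simp [mem_map_equiv]⟩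
          exact ⟨u, (he u).2 ht, by rw [map_map]⟩
        · rintro ⟨u, hu, rfl⟩
          exact ⟨_, (he u).1 hu, by rw [map_map]⟩
      rw [hK]
      constructor
      · rintro ⟨u, ⟨hune, hu⟩, rfl⟩
        rcases hu with ⟨h1, h2, h3⟩ | ⟨h1, h2, h3⟩
        · left
          rw [hnn u h1]
          refine ⟨⟨_, h2, rfl⟩, fun h => h3 ?_⟩
          rw [map_inj] at h
          exact h.ge
        · right
          rw [hnm u h1, erase_insert (hvf _)]
          exact ⟨mem_insert_self _ _, map_ssubset_map.mpr h2⟩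
      · rintro (⟨⟨t, ht, rfl⟩, hne⟩ | ⟨h1, h2⟩)
        · refine ⟨t.map Function.Embedding.some, ⟨?_, Or.inl ⟨by simp, ?_, ?_⟩⟩, ?_⟩
          · rw [map_nonempty, nonempty_iff_ne_empty]; rintro rfl; exact L.not_empty_mem ht
          · rwa [eraseNone_map_some]
          · rw [eraseNone_map_some]
            intro h
            exact hne (by rw [hF.2 t ht h])
          · rw [map_map]
        · obtain ⟨t, htF, ht⟩ := subset_map_iff.mp h2.1
          rw [ht, map_ssubset_map] at h2
          refine ⟨insertNone t, ⟨⟨none, by simp⟩, Or.inr ⟨by simp, ?_, ?_⟩⟩, ?_⟩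
          · rwa [eraseNone_insertNone]
          · rw [eraseNone_insertNone]
            rcases t.eq_empty_or_nonempty with h | h
            · exact Or.inr h
            · exact Or.inl (L.down_closed hF.1 htF h)
          · rw [hnm _ (by simp), eraseNone_insertNone, ← ht, insert_erase h1]

end Conv

section Homology

variable {V : Type} [Fintype V] [LinearOrder V] {𝕜 : Type} [Field 𝕜]

instance (K : SimComplex V) (n : ℕ) : Finite (K.Face n) :=
  inferInstanceAs (Finite {s : Finset V // s ∈ K.faces ∧ s.card = n + 1})

variable (𝕜) in
noncomputable def ex (K : SimComplex V) (n : ℕ) : K.chains 𝕜 n →ₗ[𝕜] Ch V 𝕜 :=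
  Finsupp.linearCombination 𝕜 (fun s : K.Face n => Pi.single s.1 1)

lemma ex_apply_face (K : SimComplex V) (n : ℕ) (c : K.chains 𝕜 n) (s : K.Face n) :
    ex 𝕜 K n c s.1 = c s := by
  induction c using Finsupp.induction_linear with
  | zero => simp
  | add c d hc hd => rw [map_add, Pi.add_apply, hc, hd, Finsupp.add_apply]
  | single t r =>
    rw [ex, Finsupp.linearCombination_single]
    by_cases h : s = t
    · subst h; simp
    · rw [Finsupp.single_eq_of_ne h, Pi.smul_apply, Pi.single_eq_of_ne, smul_zero]
      exact fun h' => h (Subtype.ext h')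

lemma ex_sp (K : SimComplex V) (n : ℕ) (c : K.chains 𝕜 n) : Sp K.faces (n + 1) (ex 𝕜 K n c) := by
  induction c using Finsupp.induction_linear with
  | zero => intro s hs; simp at hs
  | add c d hc hd => rw [map_add]; exact hc.add hd
  | single t r =>
    rw [ex, Finsupp.linearCombination_single]
    refine Sp.smul ?_ r
    intro s hs
    have : s = t.1 := by
      by_contra h
      exact hs (Pi.single_eq_of_ne h _)
    rw [this]; exact t.2

lemma ex_inj (K : SimComplex V) (n : ℕ) : Function.Injective (ex 𝕜 K n) := by
  intro c d h
  ext s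
  rw [← ex_apply_face, h, ex_apply_face]

lemma ex_surj (K : SimComplex V) (n : ℕ) (c : Ch V 𝕜) (hc : Sp K.faces (n + 1) c) :
    ∃ d, ex 𝕜 K n d = c := by
  refine ⟨Finsupp.equivFunOnFinite.symm (fun s => c s.1), ?_⟩
  ext s
  by_cases hs : s ∈ K.faces ∧ s.card = n + 1
  · exact ex_apply_face K n _ ⟨s, hs⟩
  · have h1 : c s = 0 := by
      by_contra h; exact hs (hc s h)
    rw [h1]
    by_contra h
    exact hs (ex_sp K n _ s h)

lemma D_single (s : Finset V) : D V 𝕜 (Pi.single s 1) =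
    ∑ a ∈ s.attach, sg 𝕜 s a.1 • Pi.single (s.erase a.1) (1 : 𝕜) := by
  ext t
  have h0 := Finset.sum_attach s
    (fun a => sg 𝕜 s a * (Pi.single (s.erase a) (1 : 𝕜) : Ch V 𝕜) t)
  rw [D_apply, Finset.sum_apply]
  simp only [Pi.smul_apply, smul_eq_mul]
  rw [h0, ← Finset.sum_subset (subset_univ s)]
  · refine Finset.sum_congr rfl fun a ha => ?_
    by_cases h : t = s.erase a
    · subst h
      rw [if_neg (notMem_erase _ _), insert_erase ha, sg_erase_self]
      simp
    · rw [Pi.single_eq_of_ne h, mul_zero]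
      split_ifs with hat
      · rfl
      · rw [Pi.single_eq_of_ne, mul_zero]
        intro h'
        apply h
        rw [← h', erase_insert hat]
  · intro a _ ha
    split_ifs with hat
    · rfl
    · rw [Pi.single_eq_of_ne, mul_zero]
      intro h'
      exact ha (h' ▸ mem_insert_self _ _)

lemma ex_boundary (K : SimComplex V) (n : ℕ) (c : K.chains 𝕜 (n + 1)) :
    ex 𝕜 K n (K.boundary 𝕜 n c) = D V 𝕜 (ex 𝕜 K (n + 1) c) := by
  induction c using Finsupp.induction_linear with
  | zero => simp
  | add c d hc hd => simp only [map_add, hc, hd]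
  | single t r =>
    have h1 : K.boundary 𝕜 n (Finsupp.single t r) = r • K.faceBoundary 𝕜 n t := by
      simp [SimComplex.boundary]
    have h2 : ex 𝕜 K (n + 1) (Finsupp.single t r) = r • Pi.single t.1 1 := by
      rw [ex, Finsupp.linearCombination_single]
    rw [h1, h2, map_smul, map_smul, D_single]
    congr 1
    rw [SimComplex.faceBoundary, map_sum]
    refine Finset.sum_congr rfl fun a _ => ?_
    rw [map_smul]
    refine congrArg (fun x => sg 𝕜 t.1 a.1 • x) ?_
    exact (Finsupp.linearCombination_single 𝕜 (1 : 𝕜) _).trans (one_smul 𝕜 _)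

lemma mem_cycles (K : SimComplex V) (n : ℕ) (c : K.chains 𝕜 (n + 1)) :
    c ∈ K.cycles 𝕜 (n + 1) ↔ D V 𝕜 (ex 𝕜 K (n + 1) c) = 0 := by
  rw [← ex_boundary, SimComplex.cycles, LinearMap.mem_ker]
  constructor
  · intro h; rw [h, map_zero]
  · intro h; exact ex_inj K n (by rw [h, map_zero])

lemma mem_bd (K : SimComplex V) (n : ℕ) (c : K.chains 𝕜 n) :
    c ∈ LinearMap.range (K.boundary 𝕜 n) ↔
      ∃ c', Sp K.faces (n + 2) c' ∧ D V 𝕜 c' = ex 𝕜 K n c := by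
  constructor
  · rintro ⟨d, rfl⟩
    exact ⟨_, ex_sp K (n + 1) d, (ex_boundary K n d).symm⟩
  · rintro ⟨c', h1, h2⟩
    obtain ⟨d, rfl⟩ := ex_surj K (n + 1) c' h1
    exact ⟨d, ex_inj K n (by rw [ex_boundary, h2])⟩

lemma hdim_Ac (K : SimComplex V) (n : ℕ) (h : Ac 𝕜 K.faces (n + 2)) :
    K.hdimNat 𝕜 (n + 1) = 0 := by
  have : K.cycles 𝕜 (n + 1) ≤ LinearMap.range (K.boundary 𝕜 (n + 1)) := by
    intro c hc
    rw [mem_cycles] at hc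
    rw [mem_bd]
    exact h _ (ex_sp K (n + 1) c) hc
  rw [SimComplex.hdimNat, inf_eq_right.mpr this, Nat.sub_self]

lemma hdim_On (K : SimComplex V) (n : ℕ) (h : On 𝕜 K.faces (n + 2)) :
    K.hdimNat 𝕜 (n + 1) = 1 := by
  obtain ⟨z, h1, h2, h3, h4⟩ := h
  obtain ⟨z, rfl⟩ := ex_surj K (n + 1) z h1
  have hz : z ∈ K.cycles 𝕜 (n + 1) := (mem_cycles K n z).2 h2
  have hz' : z ∉ LinearMap.range (K.boundary 𝕜 (n + 1)) := fun h => h3 ((mem_bd K (n + 1) z).1 h)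
  set S := LinearMap.range (K.boundary 𝕜 (n + 1)) ⊓ K.cycles 𝕜 (n + 1) with hS
  have hsup : K.cycles 𝕜 (n + 1) = S ⊔ Submodule.span 𝕜 {z} := by
    apply le_antisymm
    · intro c hc
      obtain ⟨t, c', hc', hD⟩ := h4 _ (ex_sp K (n + 1) c) ((mem_cycles K n c).1 hc)
      rw [← map_smul, ← map_sub] at hD
      have : c - t • z ∈ S := ⟨(mem_bd K (n + 1) _).2 ⟨c', hc', hD⟩,
        Submodule.sub_mem _ hc (Submodule.smul_mem _ t hz)⟩
      rw [Submodule.mem_sup]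
      exact ⟨_, this, t • z, Submodule.smul_mem _ _ (Submodule.mem_span_singleton_self z), by abel⟩
    · exact sup_le inf_le_right (by simpa using hz)
  have hf : finrank 𝕜 (K.cycles 𝕜 (n + 1)) = finrank 𝕜 S + 1 := by
    rw [hsup]
    exact Submodule.finrank_sup_span_singleton (fun h => hz' h.1)
  rw [SimComplex.hdimNat, ← hS, hf]; omega

end Homology

end GTProof

/-- **Nontrivial homology of full subcomplexes** (Limonchenko, Lemma 2.3(ii)).
Let `P` be a generalized truncation polytope of type `(k; n₁, n₂)` with `n₁ ≥ n₂ > 1`,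
`K = K_P` with vertex set `V = V₁ ⊔ V₂ ⊔ NV` (`V₁, V₂` the vertex sets of the factors
`Δ^{n₁}, Δ^{n₂}`, `NV` the set of `k` new vertices), and let `W` be a nonempty proper
subset of `V`.  Then, over a field `𝕜` of characteristic zero,
`H̃_{n₁-1}(K_W) ≠ 0` iff `W = V₁ ∪ N'` for some `N' ⊆ NV` (i.e. `V₁ ⊆ W` and
`W ∩ V₂ = ∅`) — or, in case `n₁ = n₂`, also if `W = V₂ ∪ N'` —, symmetrically
`H̃_{n₂-1}(K_W) ≠ 0` iff `V₂ ⊆ W` and `W ∩ V₁ = ∅` (or the other option when `n₁ = n₂`),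
and in each such case the homology group is one-dimensional, `H̃(K_W) ≅ 𝕜`. -/
theorem genTrunc_two_factors_full_subcomplex_homology_nontrivial
    (k n₁ n₂ : ℕ) (hn : n₂ ≤ n₁) (hn₂ : 2 ≤ n₂)
    {V : Type} [Fintype V] [LinearOrder V] (K : SimComplex V)
    (V₁ V₂ NV : Finset V) (hK : IsGT2 n₁ n₂ k V K V₁ V₂ NV)
    (𝕜 : Type) [Field 𝕜] [CharZero 𝕜]
    (W : Finset V) (hWne : W.Nonempty) (hWproper : W ≠ Finset.univ) :
    ((K.restrict W).hdimNat 𝕜 (n₁ - 1) ≠ 0 ↔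
      (V₁ ⊆ W ∧ Disjoint W V₂) ∨ (n₁ = n₂ ∧ V₂ ⊆ W ∧ Disjoint W V₁)) ∧
    ((K.restrict W).hdimNat 𝕜 (n₂ - 1) ≠ 0 ↔
      (V₂ ⊆ W ∧ Disjoint W V₁) ∨ (n₁ = n₂ ∧ V₁ ⊆ W ∧ Disjoint W V₂)) ∧
    ((K.restrict W).hdimNat 𝕜 (n₁ - 1) ≠ 0 →
      (K.restrict W).hdimNat 𝕜 (n₁ - 1) = 1) ∧
    ((K.restrict W).hdimNat 𝕜 (n₂ - 1) ≠ 0 →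
      (K.restrict W).hdimNat 𝕜 (n₂ - 1) = 1) := by
  have hGT : GTProof.GTF n₁ n₂ V₁ V₂ K.faces := by
    have h := GTProof.conv_GT (V := V) n₁ n₂ k V K V₁ V₂ NV hK (Function.Embedding.refl V)
    simpa using h
  have hne1 : V₁.Nonempty ∧ V₂.Nonempty := by
    clear hWne hWproper
    generalize K.faces = G at hGT
    induction hGT with
    | base F hA hB hAB hF => exact ⟨card_pos.mp (by omega), card_pos.mp (by omega)⟩
    | step L G F v hL hF hF' hF'' hv hG ih => exact ih
  have main : ∀ m, 2 ≤ m → m + 2 ≤ n₁ + n₂ →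
      (((m = n₁ ∧ V₁ ⊆ W ∧ Disjoint W V₂) ∨ (m = n₂ ∧ V₂ ⊆ W ∧ Disjoint W V₁)) →
        (K.restrict W).hdimNat 𝕜 (m - 1) = 1) ∧
      (¬ ((m = n₁ ∧ V₁ ⊆ W ∧ Disjoint W V₂) ∨ (m = n₂ ∧ V₂ ⊆ W ∧ Disjoint W V₁)) →
        (K.restrict W).hdimNat 𝕜 (m - 1) = 0) := by
    intro m hm hm'
    have hg := GTProof.Goal_all (𝕜 := 𝕜) n₁ n₂ (by omega) hn₂ V₁ V₂ W K.faces hGT m hm hm'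
    obtain ⟨j, rfl⟩ : ∃ j, m = j + 2 := ⟨m - 2, by omega⟩
    exact ⟨fun h => GTProof.hdim_On _ j (hg.1 h), fun h => GTProof.hdim_Ac _ j (hg.2 h)⟩
  have m1 := main n₁ (by omega) (by omega)
  have m2 := main n₂ (by omega) (by omega)
  clear main
  refine ⟨?_, ?_, ?_, ?_⟩
  · by_cases h : (n₁ = n₁ ∧ V₁ ⊆ W ∧ Disjoint W V₂) ∨ (n₁ = n₂ ∧ V₂ ⊆ W ∧ Disjoint W V₁)
    · rw [m1.1 h]; simpa using h
    · rw [m1.2 h]; simpa using h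
  · by_cases h : (n₂ = n₁ ∧ V₁ ⊆ W ∧ Disjoint W V₂) ∨ (n₂ = n₂ ∧ V₂ ⊆ W ∧ Disjoint W V₁)
    · rw [m2.1 h]
      refine ⟨fun _ => ?_, fun _ => one_ne_zero⟩
      rcases h with h | h
      · exact Or.inr ⟨h.1.symm, h.2⟩
      · exact Or.inl h.2
    · rw [m2.2 h]
      refine ⟨fun h => absurd rfl h, fun h' => absurd ?_ h⟩
      rcases h' with h' | h'
      · exact Or.inr ⟨rfl, h'⟩
      · exact Or.inl ⟨h'.1.symm, h'.2⟩
  · intro h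
    exact m1.1 (by by_contra hc; exact h (m1.2 hc))
  · intro h
    exact m2.1 (by by_contra hc; exact h (m2.2 hc))
end

section
/- Let K_1 and K_2 be simplicial complexes whose vertex sets intersect exactly in a set σ which spans a common face of both, and let K = K_1 ∪_σ K_2 be the simplicial complex obtained by gluing K_1 and K_2 along this common simplex (so K_1 ∩ K_2 is the full simplex on σ). If K_1 and K_2 are both Golod over a field k of characteristic zero, then K is Golod over k. -/
open Finset Module

open scoped TensorProduct

namespace SimComplex

variable {V : Type} [Fintype V]

/-- The vertices of `K`, as a type. -/
abbrev VertexType (K : SimComplex V) : Type := {v : V // {v} ∈ K.faces}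

noncomputable instance (K : SimComplex V) : Fintype K.VertexType :=
  Fintype.ofFinite _

variable (𝕜 : Type) [Field 𝕜]

/-- The Stanley–Reisner ideal of `K`: the ideal of the polynomial ring on the vertices
of `K` generated by the squarefree monomials corresponding to the non-faces of `K`. -/
noncomputable def faceIdeal (K : SimComplex V) : Ideal (MvPolynomial K.VertexType 𝕜) :=
  Ideal.span ((fun s : Finset K.VertexType => ∏ i ∈ s, MvPolynomial.X i) ''
    {s : Finset K.VertexType |
      s.Nonempty ∧ s.map (Function.Embedding.subtype _) ∉ K.faces})

/-- The Stanley–Reisner ring (face ring) `𝕜[K]` of the simplicial complex `K`. -/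
abbrev FaceRing (K : SimComplex V) : Type :=
  MvPolynomial K.VertexType 𝕜 ⧸ K.faceIdeal 𝕜

/-- The Koszul complex `Λ[u_1, …, u_m] ⊗ 𝕜[K]` of the face ring, whose homology is
`Tor_{𝕜[v_1,…,v_m]}(𝕜[K], 𝕜)`, as a `𝕜`-algebra.  (Since `𝕜[K]` sits in even degrees,
the multiplication carries no Koszul signs.) -/
abbrev KoszulCx (K : SimComplex V) : Type :=
  ExteriorAlgebra 𝕜 (K.VertexType → 𝕜) ⊗[𝕜] K.FaceRing 𝕜

/-- The Koszul differential on `Λ[u_1, …, u_m] ⊗ 𝕜[K]`, determined by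
`d(u_i) = v_i`, `d(v_i) = 0` and the graded Leibniz rule: the sum over the vertices `i`
of (contraction against the `i`-th coordinate) ⊗ (multiplication by `v_i`). -/
noncomputable def koszulD (K : SimComplex V) : K.KoszulCx 𝕜 →ₗ[𝕜] K.KoszulCx 𝕜 :=
  ∑ i : K.VertexType,
    TensorProduct.map
      (CliffordAlgebra.contractLeft
        (Q := (0 : QuadraticForm 𝕜 (K.VertexType → 𝕜))) (LinearMap.proj i))
      (LinearMap.mulLeft 𝕜 (Ideal.Quotient.mk (K.faceIdeal 𝕜) (MvPolynomial.X i)))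

/-- The augmentation `Λ[u_1, …, u_m] ⊗ 𝕜[K] → 𝕜`, killing all `u_i` and `v_i`. -/
noncomputable def koszulAug (K : SimComplex V) : K.KoszulCx 𝕜 →ₐ[𝕜] 𝕜 :=
  Algebra.TensorProduct.lift
    (CliffordAlgebra.lift _ ⟨0, fun m => by simp⟩)
    (Ideal.Quotient.liftₐ (K.faceIdeal 𝕜) (MvPolynomial.aeval fun _ => (0 : 𝕜))
      (by
        intro a ha
        refine Submodule.span_induction ?_ ?_ ?_ ?_ ha
        · rintro x ⟨s, ⟨hne, -⟩, rfl⟩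
          simp only [map_prod, MvPolynomial.aeval_X]
          exact Finset.prod_eq_zero hne.choose_spec rfl
        · exact map_zero _
        · intro x y _ _ hx hy
          rw [map_add, hx, hy, add_zero]
        · intro c x _ hx
          rw [smul_eq_mul, map_mul, hx, mul_zero]))
    (fun x y => Commute.all _ _)

/-- The sign operator `x ↦ x̄ = (-1)^{1+deg x}·x` on the Koszul complex: the negative of
the grade involution (v's have even degree, so only the exterior degree matters). -/
noncomputable def koszulBar (K : SimComplex V) : K.KoszulCx 𝕜 →ₗ[𝕜] K.KoszulCx 𝕜 :=
  - TensorProduct.map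
      (CliffordAlgebra.involute
        (Q := (0 : QuadraticForm 𝕜 (K.VertexType → 𝕜)))).toLinearMap
      (LinearMap.id : K.FaceRing 𝕜 →ₗ[𝕜] K.FaceRing 𝕜)

/-- **Golodness** of the face ring `𝕜[K]` (equivalently, of `K`): the multiplication and
all higher Massey operations in `Tor_{𝕜[v_1,…,v_m]}(𝕜[K], 𝕜)` are trivial.  Following
the standard formulation, this says that the Koszul complex of `𝕜[K]` admits a *trivial
Massey operation*: there are a set `Z` of cycles of positive degree representing all of
the positive-degree homology (= `Tor₊`), and a function `μ` on nonempty words in `Z`,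
extending the identity on letters, with values in the augmentation ideal, such that
`d μ(z_1, …, z_p) = ∑_{j=1}^{p-1} \overline{μ(z_1,…,z_j)}·μ(z_{j+1},…,z_p)`.
(In particular all products of positive-degree homology classes vanish.) -/
def IsGolod (K : SimComplex V) : Prop :=
  ∃ (Z : Set (K.KoszulCx 𝕜)) (μ : List (K.KoszulCx 𝕜) → K.KoszulCx 𝕜),
    (∀ z ∈ Z, K.koszulD 𝕜 z = 0 ∧ K.koszulAug 𝕜 z = 0) ∧
    (∀ x : K.KoszulCx 𝕜, K.koszulD 𝕜 x = 0 → K.koszulAug 𝕜 x = 0 →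
      x ∈ Submodule.span 𝕜 Z ⊔ LinearMap.range (K.koszulD 𝕜)) ∧
    (∀ z ∈ Z, μ [z] = z) ∧
    (∀ l : List (K.KoszulCx 𝕜), 2 ≤ l.length → (∀ z ∈ l, z ∈ Z) →
      K.koszulAug 𝕜 (μ l) = 0 ∧
      K.koszulD 𝕜 (μ l) =
        ∑ j ∈ Finset.Ioo 0 l.length,
          K.koszulBar 𝕜 (μ (l.take j)) * μ (l.drop j))

/-- The deletion `K - v` of a vertex from `K`: the full subcomplex on the remaining
vertices. -/
noncomputable def deleteVertex (K : SimComplex V) (v : V) : SimComplex V :=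
  letI := Classical.decEq V
  K.restrict (Finset.univ.erase v)

/-- **Minimal non-Golodness**: `K` is not Golod, but deleting any vertex `v` from `K`
turns the full subcomplex `K - v` into a Golod one. -/
def IsMinimallyNonGolod (K : SimComplex V) : Prop :=
  ¬ K.IsGolod 𝕜 ∧ ∀ v : V, {v} ∈ K.faces → (K.deleteVertex v).IsGolod 𝕜

end SimComplex
namespace SimComplex

/-- The union (gluing) of two simplicial complexes on a common vertex type. -/
def glue {V : Type*} (K₁ K₂ : SimComplex V) : SimComplex V where
  faces := K₁.faces ∪ K₂.faces
  not_empty_mem := fun h => h.elim K₁.not_empty_mem K₂.not_empty_mem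
  down_closed := fun _ _ hs hts ht =>
    hs.elim (fun h => Or.inl (K₁.down_closed h hts ht))
      (fun h => Or.inr (K₂.down_closed h hts ht))

end SimComplex

section ConvSec
variable {B : Type*} [Ring B] {X : Type*} {M : Type*} [AddCommGroup M] [Module B M]

/-- Concatenation convolution of functions on words. -/
def gConv (f : List X → B) (g : List X → M) : List X → M
  | [] => f [] • g []
  | x :: l => f [] • g (x :: l) + gConv (fun t => f (x :: t)) g l

theorem gConv_add_left (f f' : List X → B) (g : List X → M) (l : List X) :
    gConv (fun t => f t + f' t) g l = gConv f g l + gConv f' g l := by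
  induction l generalizing f f' with
  | nil => simp [gConv, add_smul]
  | cons x l ih => simp only [gConv, add_smul, ih]; abel

theorem gConv_smul_left (b : B) (f : List X → B) (g : List X → M) (l : List X) :
    gConv (fun t => b * f t) g l = b • gConv f g l := by
  induction l generalizing f with
  | nil => simp [gConv, mul_smul]
  | cons x l ih => simp only [gConv, mul_smul, ih, smul_add]

theorem gConv_assoc (f g : List X → B) (h : List X → M) (l : List X) :
    gConv (gConv f g) h l = gConv f (gConv g h) l := by
  induction l generalizing f with
  | nil => simp [gConv, mul_smul]
  | cons x l ih =>
    simp only [gConv, gConv_add_left, ih, smul_add]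
    simp only [smul_eq_mul, mul_smul, gConv_smul_left]
    abel

theorem gConv_eq_sum (f : List X → B) (g : List X → M) (l : List X) :
    gConv f g l = ∑ j ∈ Finset.range (l.length + 1), f (l.take j) • g (l.drop j) := by
  induction l generalizing f with
  | nil => simp [gConv]
  | cons x l ih =>
    rw [gConv, ih, List.length_cons, Finset.sum_range_succ' _ (l.length + 1)]
    simp [add_comm]

theorem gConv_derive (d : B →+ B) (s : B →+* B)
    (D : M →+ M) (hD : ∀ (b : B) (m : M), D (b • m) = d b • m + s b • D m)
    (f : List X → B) (g : List X → M) (l : List X) :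
    D (gConv f g l) = gConv (fun t => d (f t)) g l + gConv (fun t => s (f t)) (fun t => D (g t)) l := by
  induction l generalizing f with
  | nil => simp [gConv, hD]
  | cons x l ih => simp only [gConv, map_add, hD, ih]; abel

theorem gConv_zero_left (f : List X → B) (g : List X → M) (l : List X) (h : ∀ t, f t = 0) :
    gConv f g l = 0 := by
  rw [gConv_eq_sum]; exact Finset.sum_eq_zero fun j _ => by rw [h, zero_smul]

theorem gConv_mem (S : AddSubgroup M) (f : List X → B) (g : List X → M) (l : List X)
    (h : ∀ t t', f t • g t' ∈ S) : gConv f g l ∈ S := by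
  rw [gConv_eq_sum]; exact AddSubgroup.sum_mem _ fun j _ => h _ _

/-- If `f` vanishes on shorter words only the full prefix contributes. -/
theorem gConv_top (f : List X → B) (g : List X → M) (l : List X)
    (h : ∀ t : List X, t.length < l.length → f t = 0) : gConv f g l = f l • g [] := by
  rw [gConv_eq_sum, Finset.sum_range_succ, Finset.sum_eq_zero]
  · simp
  · intro j hj
    rw [h, zero_smul]
    simp at hj ⊢; omega

theorem gConv_congr_right (f : List X → B) (g g' : List X → M) (l : List X) (hf : f [] = 0)
    (h : ∀ t : List X, t.length < l.length → g t = g' t) : gConv f g l = gConv f g' l := by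
  rw [gConv_eq_sum, gConv_eq_sum]
  refine Finset.sum_congr rfl fun j hj => ?_
  rcases Nat.eq_zero_or_pos j with rfl | hj0
  · simp [hf]
  · rcases l with _ | ⟨x, l⟩
    · simp at hj; omega
    · rw [h]; simp at hj ⊢; omega

theorem gConv_congr_left (f f' : List X → B) (g : List X → M) (l : List X) (hg : g [] = 0)
    (h : ∀ t : List X, t.length < l.length → f t = f' t) : gConv f g l = gConv f' g l := by
  rw [gConv_eq_sum, gConv_eq_sum]
  refine Finset.sum_congr rfl fun j hj => ?_
  simp at hj
  rcases Nat.lt_or_ge j l.length with hj0 | hj0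
  · rw [h]; simp; omega
  · rw [List.drop_eq_nil_of_le hj0, hg]; simp

theorem gExists_rec {α β : Type*} [Nonempty β] (good : List α → (List α → β) → β → Prop)
    (hdep : ∀ l f g b, (∀ l' : List α, l'.length < l.length → f l' = g l') →
      good l f b → good l g b)
    (hstep : ∀ l f, (∀ l' : List α, l'.length < l.length → good l' f (f l')) → ∃ b, good l f b) :
    ∃ f : List α → β, ∀ l, good l f (f l) := by
  classical
  let wf : WellFounded (fun a b : List α => a.length < b.length) :=
    InvImage.wf List.length Nat.lt_wfRel.wf
  let ext : (l : List α) → ((l' : List α) → l'.length < l.length → β) → List α → β :=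
    fun l r l' => if h : l'.length < l.length then r l' h else Classical.arbitrary β
  let F : (l : List α) → ((l' : List α) → l'.length < l.length → β) → β :=
    fun l r => if h : ∃ b, good l (ext l r) b then h.choose else Classical.arbitrary β
  let f : List α → β := wf.fix F
  have hf : ∀ l, f l = F l (fun l' _ => f l') := fun l => wf.fix_eq F l
  refine ⟨f, fun l => ?_⟩
  induction l using wf.induction with
  | _ l ih =>
    have hag : ∀ l' : List α, l'.length < l.length → f l' = ext l (fun l' _ => f l') l' := by
      intro l' hl'
      simp only [ext, dif_pos hl']
    obtain ⟨b, hb⟩ := hstep l f ih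
    have hex : ∃ b, good l (ext l (fun l' _ => f l')) b := ⟨b, hdep _ _ _ _ hag hb⟩
    have : f l = hex.choose := by
      rw [hf l]; exact dif_pos hex
    rw [this]
    exact hdep _ _ _ _ (fun l' hl' => (hag l' hl').symm) hex.choose_spec

end ConvSec

section ExtSec
variable {B : Type*} [Ring B] {X : Type*}

/-- The basis words of the free module on words. -/
noncomputable def gEta (B : Type*) [Ring B] {X : Type*} (w : List X) : List X →₀ B :=
  Finsupp.single w 1

/-- The twisted differential on the free module on words. -/
noncomputable def gD (d : B →+ B) (s : B →+* B) (ω : List X → B) :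
    (List X →₀ B) →+ (List X →₀ B) :=
  Finsupp.liftAddHom fun w =>
    { toFun := fun b => d b • gEta B w + s b • gConv ω (gEta B) w
      map_zero' := by simp
      map_add' := fun a b => by simp only [map_add, add_smul]; abel }

theorem gD_single (d : B →+ B) (s : B →+* B) (ω : List X → B) (w : List X) (b : B) :
    gD d s ω (Finsupp.single w b) = d b • gEta B w + s b • gConv ω (gEta B) w := by
  simp [gD]

theorem gD_smul (d : B →+ B) (s : B →+* B) (leib : ∀ a b, d (a * b) = d a * b + s a * d b)
    (ω : List X → B) (b : B) (q : List X →₀ B) :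
    gD d s ω (b • q) = d b • q + s b • gD d s ω q := by
  induction q using Finsupp.induction_linear with
  | zero => simp
  | add p q hp hq => simp only [smul_add, map_add, hp, hq]; abel
  | single w c =>
    have : (Finsupp.single w c : List X →₀ B) = c • gEta B w := by simp [gEta]
    rw [Finsupp.smul_single, smul_eq_mul, gD_single, gD_single, leib, map_mul, this]
    simp only [add_smul, mul_smul, smul_add]
    abel

theorem gd_one (d : B →+ B) (s : B →+* B) (leib : ∀ a b, d (a * b) = d a * b + s a * d b) :
    d 1 = 0 := by
  have := leib 1 1
  simpa using this

theorem gD_eta (d : B →+ B) (s : B →+* B) (leib : ∀ a b, d (a * b) = d a * b + s a * d b)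
    (ω : List X → B) (w : List X) : gD d s ω (gEta B w) = gConv ω (gEta B) w := by
  rw [gEta, gD_single, gd_one d s leib]; simp

theorem gD_gD (d : B →+ B) (s : B →+* B) (leib : ∀ a b, d (a * b) = d a * b + s a * d b)
    (hdd : ∀ b, d (d b) = 0) (hds : ∀ b, d (s b) = - s (d b))
    (ω : List X → B) (hMC : ∀ l, d (ω l) = - gConv (fun t => s (ω t)) ω l) (q : List X →₀ B) :
    gD d s ω (gD d s ω q) = 0 := by
  have h1 : ∀ w, gD d s ω (gConv ω (gEta B) w) = 0 := by
    intro w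
    rw [gConv_derive d s _ (gD_smul d s leib ω)]
    simp only [gD_eta d s leib]
    rw [show (fun t => gConv ω (gEta B) t) = gConv ω (gEta B) from rfl, ← gConv_assoc,
      ← gConv_add_left]
    exact gConv_zero_left _ _ _ fun t => by rw [hMC]; simp
  induction q using Finsupp.induction_linear with
  | zero => simp
  | add p q hp hq => simp only [map_add, hp, hq, add_zero]
  | single w c =>
    rw [gD_single, map_add, gD_smul d s leib, gD_smul d s leib, h1, hdd, hds, gD_eta d s leib]
    simp

/-- Combinations of words of length `< n` with coefficients in `𝔪`. -/
def gMQ (𝔪 : AddSubgroup B) (X : Type*) (n : ℕ) : AddSubgroup (List X →₀ B) where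
  carrier := {S | ∀ w, S w ∈ 𝔪 ∧ (n ≤ w.length → S w = 0)}
  zero_mem' := fun w => ⟨𝔪.zero_mem, fun _ => rfl⟩
  add_mem' := fun ha hb w => ⟨𝔪.add_mem (ha w).1 (hb w).1, fun h => by
    rw [Finsupp.add_apply, (ha w).2 h, (hb w).2 h, add_zero]⟩
  neg_mem' := fun ha w => ⟨𝔪.neg_mem (ha w).1, fun h => by
    rw [Finsupp.neg_apply, (ha w).2 h, neg_zero]⟩

theorem gMQ_mono (𝔪 : AddSubgroup B) {m n : ℕ} (h : m ≤ n) : gMQ 𝔪 X m ≤ gMQ 𝔪 X n :=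
  fun _ hS w => ⟨(hS w).1, fun hn => (hS w).2 (h.trans hn)⟩

theorem gMQ_single (𝔪 : AddSubgroup B) (w : List X) (b : B) (hb : b ∈ 𝔪) :
    Finsupp.single w b ∈ gMQ 𝔪 X (w.length + 1) := by
  classical
  intro w'
  rw [Finsupp.single_apply]
  split_ifs with h
  · subst h; exact ⟨hb, fun h => by omega⟩
  · exact ⟨𝔪.zero_mem, fun _ => rfl⟩

theorem gMQ_smul (𝔪 : AddSubgroup B) (hml : ∀ b, ∀ a ∈ 𝔪, b * a ∈ 𝔪) (n : ℕ) (b : B)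
    (q : List X →₀ B) (hq : q ∈ gMQ 𝔪 X n) : b • q ∈ gMQ 𝔪 X n := fun w =>
  ⟨hml _ _ (hq w).1, fun h => by rw [Finsupp.smul_apply, (hq w).2 h, smul_zero]⟩

theorem gConv_eta_mem (𝔪 : AddSubgroup B) (F : List X → B) (hF : ∀ l, F l ∈ 𝔪) (w : List X) :
    gConv F (gEta B) w ∈ gMQ 𝔪 X (w.length + 1) := by
  induction w generalizing F with
  | nil =>
    have := gMQ_single 𝔪 ([] : List X) _ (hF [])
    simpa [gConv, gEta] using this
  | cons x l ih =>
    have := gMQ_single 𝔪 (x :: l) _ (hF [])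
    rw [gConv]
    refine AddSubgroup.add_mem _ (by simpa [gEta] using this)
      (gMQ_mono 𝔪 (by simp) (ih (fun t => F (x :: t)) fun t => hF _))

theorem gConv_eta_mem' (𝔪 : AddSubgroup B) (F : List X → B) (hF : ∀ l, F l ∈ 𝔪) (w : List X) :
    gConv F (gEta B) w - Finsupp.single w (F []) ∈ gMQ 𝔪 X w.length := by
  cases w with
  | nil => 
    have : gConv F (gEta B) [] - Finsupp.single [] (F []) = 0 := by simp [gConv, gEta]
    rw [this]; exact AddSubgroup.zero_mem _
  | cons x l =>
    have := gConv_eta_mem 𝔪 (fun t => F (x :: t)) (fun t => hF _) l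
    rw [gConv]
    simpa [gEta] using this

theorem gReduce1 (d : B →+ B) (s : B →+* B) (leib : ∀ a b, d (a * b) = d a * b + s a * d b)
    (hds : ∀ b, d (s b) = - s (d b)) (hss : ∀ b, s (s b) = b)
    (ω : List X → B) (hω0 : ω [] = 0)
    (𝔪 : AddSubgroup B) (hml : ∀ b, ∀ a ∈ 𝔪, b * a ∈ 𝔪) (hωm : ∀ l, ω l ∈ 𝔪)
    (r : B) (hr : r ∈ AddSubgroup.closure {r | ∃ b x, d b = 0 ∧ r = b * ω [x]} ⊔ d.range)
    (v : List X) : ∃ T, Finsupp.single v r - gD d s ω T ∈ gMQ 𝔪 X v.length := by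
  let N : AddSubgroup B :=
    { carrier := {r | ∃ T, Finsupp.single v r - gD d s ω T ∈ gMQ 𝔪 X v.length}
      zero_mem' := ⟨0, by simp⟩
      add_mem' := by
        rintro a b ⟨T, hT⟩ ⟨T', hT'⟩
        refine ⟨T + T', ?_⟩
        have := AddSubgroup.add_mem _ hT hT'
        rw [map_add, Finsupp.single_add]
        convert this using 1; abel
      neg_mem' := by
        rintro a ⟨T, hT⟩
        refine ⟨-T, ?_⟩
        have := AddSubgroup.neg_mem _ hT
        rw [map_neg, Finsupp.single_neg]
        convert this using 1; abel }
  suffices h : AddSubgroup.closure {r | ∃ b x, d b = 0 ∧ r = b * ω [x]} ⊔ d.range ≤ N from h hr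
  refine sup_le ?_ ?_
  · rw [AddSubgroup.closure_le]
    rintro _ ⟨b, x, hb, rfl⟩
    refine ⟨Finsupp.single (x :: v) (s b), ?_⟩
    rw [gD_single, hds, hb, hss, gConv, hω0]
    have := gMQ_smul 𝔪 hml _ b _ (AddSubgroup.neg_mem _
      (gConv_eta_mem' 𝔪 (fun t => ω (x :: t)) (fun t => hωm _) v))
    convert this using 1
    simp [smul_sub]
  · rintro _ ⟨y, rfl⟩
    refine ⟨Finsupp.single v y, ?_⟩
    rw [gD_single]
    have := gMQ_smul 𝔪 hml _ (s y) _ (AddSubgroup.neg_mem _ (gConv_eta_mem' 𝔪 ω hωm v))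
    convert this using 1
    simp [hω0, gEta]

theorem gD_top (d : B →+ B) (s : B →+* B) (ω : List X → B) (hω0 : ω [] = 0)
    (n : ℕ) (S : List X →₀ B) (hS : S ∈ gMQ ⊤ X (n + 1)) (v : List X) (hv : v.length = n) :
    gD d s ω S v = d (S v) := by
  classical
  have key : ∀ w b, w.length ≤ n → gD d s ω (Finsupp.single w b) v = d (Finsupp.single w b v) := by
    intro w b hw
    rw [gD_single]
    have h1 := ((gMQ_smul ⊤ (by simp) _ (s b) _ (gConv_eta_mem' ⊤ ω (by simp) w)) v).2 (by omega)
    rw [hω0] at h1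
    simp only [Finsupp.single_zero, sub_zero] at h1
    rw [Finsupp.add_apply, h1, add_zero, gEta, Finsupp.smul_apply, Finsupp.single_apply,
      Finsupp.single_apply]
    split_ifs <;> simp
  have hsum : S = ∑ w ∈ S.support, Finsupp.single w (S w) := (Finsupp.sum_single S).symm
  conv_lhs => rw [hsum]
  conv_rhs => rw [hsum]
  simp only [map_sum, Finsupp.coe_finsetSum, Finset.sum_apply]
  refine Finset.sum_congr rfl fun w hw => key w _ ?_
  by_contra hlt
  exact (Finsupp.mem_support_iff.mp hw) ((hS w).2 (by omega))

theorem gReduce (d : B →+ B) (s : B →+* B) (leib : ∀ a b, d (a * b) = d a * b + s a * d b)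
    (hdd : ∀ b, d (d b) = 0) (hds : ∀ b, d (s b) = - s (d b)) (hss : ∀ b, s (s b) = b)
    (ω : List X → B) (hω0 : ω [] = 0) (hMC : ∀ l, d (ω l) = - gConv (fun t => s (ω t)) ω l)
    (𝔪 : AddSubgroup B) (hml : ∀ b, ∀ a ∈ 𝔪, b * a ∈ 𝔪) (hωm : ∀ l, ω l ∈ 𝔪)
    (hb : ∀ r ∈ 𝔪, d r = 0 →
      r ∈ AddSubgroup.closure {r | ∃ b x, d b = 0 ∧ r = b * ω [x]} ⊔ d.range)
    (n : ℕ) (S : List X →₀ B) (hS : S ∈ gMQ 𝔪 X (n + 1))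
    (hDS : ∀ v, v ≠ [] → gD d s ω S v = 0) :
    ∃ T, S - gD d s ω T ∈ gMQ 𝔪 X 1 := by
  classical
  induction n generalizing S with
  | zero => exact ⟨0, by simpa using hS⟩
  | succ n ih =>
    have hcyc : ∀ v : List X, v.length = n + 1 → d (S v) = 0 := by
      intro v hv
      rw [← gD_top d s ω hω0 (n + 1) S (fun w => ⟨trivial, (hS w).2⟩) v hv]
      exact hDS v (by rintro rfl; simp at hv)
    have hT : ∀ v : List X, ∃ T, v.length = n + 1 →
        Finsupp.single v (S v) - gD d s ω T ∈ gMQ 𝔪 X (n + 1) := by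
      intro v
      by_cases hv : v.length = n + 1
      · obtain ⟨T, hT⟩ := gReduce1 d s leib hds hss ω hω0 𝔪 hml hωm (S v)
          (hb _ (hS v).1 (hcyc v hv)) v
        exact ⟨T, fun _ => hv ▸ hT⟩
      · exact ⟨0, fun h => absurd h hv⟩
    choose T hT using hT
    let T0 := ∑ v ∈ S.support.filter (fun v => v.length = n + 1), T v
    have hS' : S - gD d s ω T0 ∈ gMQ 𝔪 X (n + 1) := by
      have hsum : S = ∑ w ∈ S.support, Finsupp.single w (S w) := (Finsupp.sum_single S).symm
      have : S - gD d s ω T0 =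
          ∑ v ∈ S.support.filter (fun v => v.length = n + 1),
            (Finsupp.single v (S v) - gD d s ω (T v)) +
          ∑ v ∈ S.support.filter (fun v => ¬ v.length = n + 1), Finsupp.single v (S v) := by
        conv_lhs => rw [hsum]
        rw [← Finset.sum_filter_add_sum_filter_not S.support (fun v => v.length = n + 1)]
        simp only [T0, map_sum, Finset.sum_sub_distrib]
        abel
      rw [this]
      refine AddSubgroup.add_mem _ (AddSubgroup.sum_mem _ fun v hv => hT v (by simp at hv; exact hv.2))
        (AddSubgroup.sum_mem _ fun v hv => ?_)
      refine gMQ_mono 𝔪 ?_ (gMQ_single 𝔪 v (S v) (hS v).1)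
      simp at hv
      have : ¬ (n + 1 + 1 ≤ v.length) := fun h => hv.1 ((hS v).2 h)
      omega
    obtain ⟨T1, hT1⟩ := ih (S - gD d s ω T0) hS' (fun v hv => by
      rw [map_sub, gD_gD d s leib hdd hds ω hMC, sub_zero]; exact hDS v hv)
    exact ⟨T0 + T1, by rw [map_add]; convert hT1 using 1; abel⟩

theorem gExists_bound (𝔪 : AddSubgroup B) (S : List X →₀ B) (h : ∀ w, S w ∈ 𝔪) :
    ∃ n, S ∈ gMQ 𝔪 X (n + 1) := by
  refine ⟨S.support.sup List.length, fun w => ⟨h w, fun hw => ?_⟩⟩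
  by_contra hne
  have := Finset.le_sup (f := List.length) (Finsupp.mem_support_iff.mpr hne)
  omega

theorem gReduce' (d : B →+ B) (s : B →+* B) (leib : ∀ a b, d (a * b) = d a * b + s a * d b)
    (hdd : ∀ b, d (d b) = 0) (hds : ∀ b, d (s b) = - s (d b)) (hss : ∀ b, s (s b) = b)
    (ω : List X → B) (hω0 : ω [] = 0) (hMC : ∀ l, d (ω l) = - gConv (fun t => s (ω t)) ω l)
    (𝔪 : AddSubgroup B) (hml : ∀ b, ∀ a ∈ 𝔪, b * a ∈ 𝔪) (hωm : ∀ l, ω l ∈ 𝔪)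
    (hb : ∀ r ∈ 𝔪, d r = 0 →
      r ∈ AddSubgroup.closure {r | ∃ b x, d b = 0 ∧ r = b * ω [x]} ⊔ d.range)
    (S : List X →₀ B) (hS : ∀ w, S w ∈ 𝔪) (hDS : ∀ v, v ≠ [] → gD d s ω S v = 0) :
    ∃ T, ∃ R ∈ 𝔪, S - gD d s ω T = Finsupp.single [] R := by
  obtain ⟨n, hn⟩ := gExists_bound 𝔪 S hS
  obtain ⟨T, hT⟩ := gReduce d s leib hdd hds hss ω hω0 hMC 𝔪 hml hωm hb n S hn hDS
  refine ⟨T, _, (hT []).1, ?_⟩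
  ext w
  rcases w with _ | ⟨x, w⟩
  · simp
  · rw [(hT (x :: w)).2 (by simp)]; simp

theorem gReduce2 (d : B →+ B) (s : B →+* B) (leib : ∀ a b, d (a * b) = d a * b + s a * d b)
    (hdd : ∀ b, d (d b) = 0) (hds : ∀ b, d (s b) = - s (d b)) (hss : ∀ b, s (s b) = b)
    (ω : List X → B) (hω0 : ω [] = 0) (hMC : ∀ l, d (ω l) = - gConv (fun t => s (ω t)) ω l)
    (𝔪 : AddSubgroup B) (hml : ∀ b, ∀ a ∈ 𝔪, b * a ∈ 𝔪) (hωm : ∀ l, ω l ∈ 𝔪)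
    (hb : ∀ r ∈ 𝔪, d r = 0 →
      r ∈ AddSubgroup.closure {r | ∃ b x, d b = 0 ∧ r = b * ω [x]} ⊔ d.range)
    (S : List X →₀ B) (hS : ∀ w, S w ∈ 𝔪) (hDS : gD d s ω S = 0) :
    ∃ T, gD d s ω T = S := by
  obtain ⟨T, R, hR, hT⟩ := gReduce' d s leib hdd hds hss ω hω0 hMC 𝔪 hml hωm hb S hS
    (by simp [hDS])
  have h0 : gD d s ω (Finsupp.single [] R) = 0 := by
    rw [← hT, map_sub, hDS, gD_gD d s leib hdd hds ω hMC, sub_zero]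
  have hdR : d R = 0 := by
    rw [gD_single] at h0
    have := DFunLike.congr_fun h0 []
    simpa [gConv, hω0, gEta] using this
  obtain ⟨T', hT'⟩ := gReduce1 d s leib hds hss ω hω0 𝔪 hml hωm R (hb R hR hdR) []
  refine ⟨T + T', ?_⟩
  have : Finsupp.single [] R - gD d s ω T' = 0 := by
    ext w; rw [(hT' w).2 (by simp)]; simp
  rw [map_add, ← sub_eq_zero.mp this, ← hT]; abel

/-- Truncation of a function on words to words shorter than `l`. -/
def gTr {Y C : Type*} [Zero C] (l : List Y) (f : List Y → C) (t : List Y) : C :=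
  if t.length < l.length then f t else 0

theorem gExt (d : B →+ B) (s : B →+* B) (leib : ∀ a b, d (a * b) = d a * b + s a * d b)
    (hdd : ∀ b, d (d b) = 0) (hds : ∀ b, d (s b) = - s (d b)) (hss : ∀ b, s (s b) = b)
    (ω : List X → B) (hω0 : ω [] = 0) (hMC : ∀ l, d (ω l) = - gConv (fun t => s (ω t)) ω l)
    (𝔪 : AddSubgroup B) (hml : ∀ b, ∀ a ∈ 𝔪, b * a ∈ 𝔪) (hmr : ∀ b, ∀ a ∈ 𝔪, a * b ∈ 𝔪)
    (hωm : ∀ l, ω l ∈ 𝔪)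
    (hb : ∀ r ∈ 𝔪, d r = 0 →
      r ∈ AddSubgroup.closure {r | ∃ b x, d b = 0 ∧ r = b * ω [x]} ⊔ d.range)
    (𝔞 : AddSubgroup B) (h𝔞 : 𝔞 ≤ 𝔪) (hal : ∀ b, ∀ a ∈ 𝔞, b * a ∈ 𝔞)
    (hc : ∀ R ∈ 𝔪, d R ∈ 𝔞 → ∃ y, R - d y ∈ 𝔞)
    {Y : Type*} (z : Y → B) (hz : ∀ y, z y ∈ 𝔞 ∧ d (z y) = 0) :
    ∃ ω' : List Y → B, ω' [] = 0 ∧ (∀ y, ω' [y] = z y) ∧ (∀ l, ω' l ∈ 𝔞) ∧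
      ∀ l, d (ω' l) = - gConv (fun t => s (ω' t)) ω' l := by
  classical
  let good : List Y → (List Y → B × (List X →₀ B)) → B × (List X →₀ B) → Prop := fun l f p =>
    if l = [] then p = (0, gEta B []) else
      p.1 ∈ 𝔞 ∧ d p.1 = - gConv (fun t => s (gTr l (fun t => (f t).1) t)) (gTr l (fun t => (f t).1)) l ∧
      gD d s ω p.2 = p.1 • gEta B [] + gConv (gTr l (fun t => (f t).1)) (gTr l (fun t => (f t).2)) l ∧
      ∀ y, l = [y] → p.1 = z y
  obtain ⟨f, hf⟩ := gExists_rec good (by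
    intro l f g p hfg h
    have e1 : gTr l (fun t => (f t).1) = gTr l (fun t => (g t).1) := by
      funext t; simp only [gTr]; split_ifs with h
      · rw [hfg t h]
      · rfl
    have e2 : gTr l (fun t => (f t).2) = gTr l (fun t => (g t).2) := by
      funext t; simp only [gTr]; split_ifs with h
      · rw [hfg t h]
      · rfl
    simp only [good] at h ⊢
    rwa [e1, e2] at h) (by
    intro l f ih
    by_cases hl : l = []
    · exact ⟨(0, gEta B []), by simp only [good, if_pos hl]⟩
    have hpos : 0 < l.length := List.length_pos_iff.mpr hl
    have hf0 : f [] = (0, gEta B []) := by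
      have := ih [] (by simpa using hpos)
      simpa only [good, if_true] using this
    set u := gTr l (fun t => (f t).1) with hu
    set G := gTr l (fun t => (f t).2) with hG
    have hu0 : u [] = 0 := by simp [hu, gTr, hf0]
    have hG0 : G [] = gEta B [] := by simp [hG, gTr, hf0, hpos]
    have hlt : ∀ t : List Y, t.length < l.length → t ≠ [] →
        u t ∈ 𝔞 ∧ d (u t) = - gConv (fun t => s (u t)) u t ∧
        gD d s ω (G t) = gConv u G t := by
      intro t ht htn
      have h := ih t ht
      simp only [good, if_neg htn] at h
      have hut : u t = (f t).1 := by simp [hu, gTr, ht]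
      have hGt : G t = (f t).2 := by simp [hG, gTr, ht]
      have tu : ∀ t' : List Y, t'.length < t.length → gTr t (fun t => (f t).1) t' = u t' := by
        intro t' h'
        simp [gTr, hu, h', h'.trans ht]
      have tG : ∀ t' : List Y, t'.length < t.length → gTr t (fun t => (f t).2) t' = G t' := by
        intro t' h'
        simp [gTr, hG, h', h'.trans ht]
      have htpos : 0 < t.length := List.length_pos_iff.mpr htn
      have hu0' : gTr t (fun t => (f t).1) [] = 0 := by rw [tu [] (by simpa using htpos), hu0]
      refine ⟨hut ▸ h.1, ?_, ?_⟩
      · rw [hut, h.2.1, gConv_congr_right _ _ u t (by simp [hu0']) tu,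
          gConv_congr_left _ (fun t => s (u t)) u t hu0 (fun t' h' => by rw [tu t' h'])]
      · rw [hGt, h.2.2.1, gConv_congr_right _ _ G t hu0' tG, gConv_eq_sum, gConv_eq_sum,
          Finset.sum_range_succ, Finset.sum_range_succ _ t.length]
        have e1 : ∑ j ∈ Finset.range t.length, gTr t (fun t => (f t).1) (t.take j) • G (t.drop j)
            = ∑ j ∈ Finset.range t.length, u (t.take j) • G (t.drop j) :=
          Finset.sum_congr rfl fun j hj => by
            rw [tu]; simp at hj ⊢; omega
        rw [e1, List.take_length, List.drop_length, hG0, hut]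
        simp [gTr, add_comm]
    have hu𝔞 : ∀ t, u t ∈ 𝔞 := by
      intro t
      by_cases htn : t = []
      · rw [htn, hu0]; exact 𝔞.zero_mem
      by_cases ht : t.length < l.length
      · exact (hlt t ht htn).1
      · simp [hu, gTr, ht, 𝔞.zero_mem]
    set o := gConv (fun t => s (u t)) u l with ho
    set S := gConv u G l with hS
    have hul : u l = 0 := by simp [hu, gTr]
    have hSm : ∀ w, S w ∈ 𝔪 := by
      intro w
      rw [hS, gConv_eq_sum, Finsupp.coe_finsetSum, Finset.sum_apply]
      exact 𝔪.sum_mem fun j _ => hmr _ _ (h𝔞 (hu𝔞 _))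
    have hDS : gD d s ω S = o • gEta B [] := by
      rw [hS, gConv_derive d s _ (gD_smul d s leib ω)]
      rw [gConv_congr_right (fun t => s (u t)) _ (gConv u G) l (by simp [hu0]) ?_]
      · rw [← gConv_assoc, ← gConv_add_left, gConv_top]
        · rw [hul, map_zero, zero_add, hG0]
        · intro t ht
          by_cases htn : t = []
          · subst htn; simp [hu0, gConv]
          · rw [(hlt t ht htn).2.1]; simp
      · intro t ht
        by_cases htn : t = []
        · subst htn
          rw [hG0, gD_eta d s leib]; simp [gConv, hu0, hω0]
        · exact (hlt t ht htn).2.2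
    have hDSv : ∀ v, v ≠ [] → gD d s ω S v = 0 := by
      intro v hv
      rw [hDS]; simp [gEta, Finsupp.single_apply, hv.symm]
    have ho𝔞 : o ∈ 𝔞 := gConv_mem 𝔞 _ _ _ fun t t' => hal _ _ (hu𝔞 _)
    have hkey : ∃ a ∈ 𝔞, d a = - o ∧ ∀ y, l = [y] → a = z y := by
      by_cases hy : ∃ y, l = [y]
      · obtain ⟨y, rfl⟩ := hy
        refine ⟨z y, (hz y).1, ?_, ?_⟩
        · rw [(hz y).2, ho]; simp [gConv, hu0, hul]
        · intro y' h; simp at h; rw [h]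
      · obtain ⟨T, R, hR, hT⟩ := gReduce' d s leib hdd hds hss ω hω0 hMC 𝔪 hml hωm hb S hSm hDSv
        have hdR : d R = o := by
          have h1 : gD d s ω (Finsupp.single [] R) = o • gEta B [] := by
            rw [← hT, map_sub, hDS, gD_gD d s leib hdd hds ω hMC, sub_zero]
          rw [gD_single] at h1
          have := DFunLike.congr_fun h1 []
          simpa [gConv, hω0, gEta] using this
        obtain ⟨y, hy'⟩ := hc R hR (by rw [hdR]; exact ho𝔞)
        refine ⟨-(R - d y), 𝔞.neg_mem hy', ?_, fun y h => absurd ⟨y, h⟩ hy⟩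
        rw [map_neg, map_sub, hdd, sub_zero, hdR]
    obtain ⟨a, ha, hda, hay⟩ := hkey
    obtain ⟨T, hT⟩ := gReduce2 d s leib hdd hds hss ω hω0 hMC 𝔪 hml hωm hb
      (a • gEta B [] + S) (fun w => by
        rw [Finsupp.add_apply]
        exact 𝔪.add_mem (hmr _ _ (h𝔞 ha)) (hSm w)) (by
        rw [map_add, hDS, gD_smul d s leib, hda, gD_eta d s leib]
        simp [gConv, hω0])
    refine ⟨(a, T), ?_⟩
    simp only [good, if_neg hl]
    exact ⟨ha, hda, hT, hay⟩)
  have hf0 : (f []).1 = 0 := by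
    have := hf []
    simp only [good, if_true] at this
    rw [this]
  refine ⟨fun l => (f l).1, hf0, ?_, ?_, ?_⟩
  · intro y
    have := hf [y]
    simp only [good] at this
    exact this.2.2.2 y rfl
  · intro l
    by_cases hl : l = []
    · subst hl; simp only [hf0]; exact 𝔞.zero_mem
    · have := hf l
      simp only [good, if_neg hl] at this
      exact this.1
  · intro l
    by_cases hl : l = []
    · subst hl; simp [hf0, gConv]
    · have := hf l
      simp only [good, if_neg hl] at this
      have hpos : 0 < l.length := List.length_pos_iff.mpr hl
      have tu : ∀ t' : List Y, t'.length < l.length →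
          gTr l (fun t => (f t).1) t' = (f t').1 := by
        intro t' h'
        simp [gTr, h']
      have hu0' : gTr l (fun t => (f t).1) [] = 0 := by rw [tu [] (by simpa using hpos), hf0]
      rw [this.2.1, gConv_congr_right _ _ (fun t => (f t).1) l (by simp [hu0']) tu,
          gConv_congr_left _ (fun t => s (f t).1) _ l hf0 (fun t' h' => by rw [tu t' h'])]

end ExtSec

section KosSec
set_option linter.unusedSectionVars false
open scoped TensorProduct
variable {𝕜 : Type} [Field 𝕜] {U : Type} [Fintype U] {R : Type} [CommRing R] [Algebra 𝕜 R]

/-- Contraction with the `i`-th coordinate. -/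
noncomputable abbrev gCtr (𝕜 : Type) [Field 𝕜] {U : Type} (i : U) :
    ExteriorAlgebra 𝕜 (U → 𝕜) →ₗ[𝕜] ExteriorAlgebra 𝕜 (U → 𝕜) :=
  CliffordAlgebra.contractLeft (Q := (0 : QuadraticForm 𝕜 (U → 𝕜))) (LinearMap.proj i)

/-- The sign automorphism. -/
noncomputable abbrev gInv (𝕜 : Type) [Field 𝕜] (U : Type) :
    ExteriorAlgebra 𝕜 (U → 𝕜) →ₐ[𝕜] ExteriorAlgebra 𝕜 (U → 𝕜) :=
  CliffordAlgebra.involute (Q := (0 : QuadraticForm 𝕜 (U → 𝕜)))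

/-- The generators. -/
noncomputable abbrev gIota (𝕜 : Type) [Field 𝕜] {U : Type} (m : U → 𝕜) :
    ExteriorAlgebra 𝕜 (U → 𝕜) := ExteriorAlgebra.ι 𝕜 m

theorem gCtr_iota_mul (i : U) (m : U → 𝕜) (x : ExteriorAlgebra 𝕜 (U → 𝕜)) :
    gCtr 𝕜 i (ExteriorAlgebra.ι 𝕜 m * x) = m i • x - ExteriorAlgebra.ι 𝕜 m * gCtr 𝕜 i x :=
  CliffordAlgebra.contractLeft_ι_mul _ _ _

theorem gInv_iota (m : U → 𝕜) : gInv 𝕜 U (ExteriorAlgebra.ι 𝕜 m) = - ExteriorAlgebra.ι 𝕜 m :=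
  CliffordAlgebra.involute_ι _

theorem gExt_induction {C : ExteriorAlgebra 𝕜 (U → 𝕜) → Prop}
    (h0 : ∀ r, C (algebraMap 𝕜 _ r)) (hadd : ∀ a b, C a → C b → C (a + b))
    (hm : ∀ m x, C x → C (ExteriorAlgebra.ι 𝕜 m * x)) (a) : C a :=
  CliffordAlgebra.left_induction (Q := (0 : QuadraticForm 𝕜 (U → 𝕜))) (P := C) h0
    (fun x y hx hy => hadd x y hx hy) (fun x m hx => hm m x hx) a

theorem gCtr_mul (i : U) (a b : ExteriorAlgebra 𝕜 (U → 𝕜)) :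
    gCtr 𝕜 i (a * b) = gCtr 𝕜 i a * b + gInv 𝕜 U a * gCtr 𝕜 i b := by
  induction a using gExt_induction with
  | h0 r =>
    rw [← Algebra.smul_def, map_smul, AlgHom.commutes, ← Algebra.smul_def,
      CliffordAlgebra.contractLeft_algebraMap, zero_mul, zero_add]
  | hadd a a' h h' => simp only [add_mul, map_add, h, h']; abel
  | hm m x h =>
    rw [mul_assoc, gCtr_iota_mul, h, gCtr_iota_mul, map_mul, gInv_iota]
    simp only [mul_add, sub_mul, smul_mul_assoc, mul_assoc, neg_mul]
    abel

theorem gCtr_inv (i : U) (a : ExteriorAlgebra 𝕜 (U → 𝕜)) :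
    gCtr 𝕜 i (gInv 𝕜 U a) = - gInv 𝕜 U (gCtr 𝕜 i a) := by
  induction a using gExt_induction with
  | h0 r =>
    rw [AlgHom.commutes, CliffordAlgebra.contractLeft_algebraMap, map_zero, neg_zero]
  | hadd a a' h h' => simp only [map_add, h, h']; abel
  | hm m x h =>
    rw [map_mul, gInv_iota, gCtr_iota_mul, neg_mul, map_neg, gCtr_iota_mul, h, map_sub, map_smul,
      map_mul, gInv_iota]
    simp

theorem gInv_inv (a : ExteriorAlgebra 𝕜 (U → 𝕜)) : gInv 𝕜 U (gInv 𝕜 U a) = a :=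
  CliffordAlgebra.involute_involute _

theorem gCtr_comm (i j : U) (a : ExteriorAlgebra 𝕜 (U → 𝕜)) :
    gCtr 𝕜 i (gCtr 𝕜 j a) = - gCtr 𝕜 j (gCtr 𝕜 i a) :=
  CliffordAlgebra.contractLeft_comm _ _ _

theorem gCtr_self (i : U) (a : ExteriorAlgebra 𝕜 (U → 𝕜)) :
    gCtr 𝕜 i (gCtr 𝕜 i a) = 0 :=
  CliffordAlgebra.contractLeft_contractLeft _ _

/-- The generic Koszul differential. -/
noncomputable def gKd (v : U → R) :
    ExteriorAlgebra 𝕜 (U → 𝕜) ⊗[𝕜] R →ₗ[𝕜] ExteriorAlgebra 𝕜 (U → 𝕜) ⊗[𝕜] R :=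
  ∑ i : U, TensorProduct.map (gCtr 𝕜 i) (LinearMap.mulLeft 𝕜 (v i))

theorem gKd_tmul (v : U → R) (a : ExteriorAlgebra 𝕜 (U → 𝕜)) (p : R) :
    gKd v (a ⊗ₜ[𝕜] p) = ∑ i : U, gCtr 𝕜 i a ⊗ₜ[𝕜] (v i * p) := by
  simp [gKd, LinearMap.sum_apply]

/-- The sign automorphism on the Koszul complex. -/
noncomputable def gKs (𝕜 : Type) [Field 𝕜] (U R : Type) [CommRing R] [Algebra 𝕜 R] :
    ExteriorAlgebra 𝕜 (U → 𝕜) ⊗[𝕜] R →ₐ[𝕜] ExteriorAlgebra 𝕜 (U → 𝕜) ⊗[𝕜] R :=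
  Algebra.TensorProduct.map (gInv 𝕜 U) (AlgHom.id 𝕜 R)

theorem gKs_tmul (a : ExteriorAlgebra 𝕜 (U → 𝕜)) (p : R) :
    gKs 𝕜 U R (a ⊗ₜ[𝕜] p) = gInv 𝕜 U a ⊗ₜ[𝕜] p := rfl

theorem gKs_gKs (x : ExteriorAlgebra 𝕜 (U → 𝕜) ⊗[𝕜] R) : gKs 𝕜 U R (gKs 𝕜 U R x) = x := by
  induction x using TensorProduct.induction_on with
  | zero => simp
  | add x y hx hy => rw [map_add, map_add, hx, hy]
  | tmul a p => rw [gKs_tmul, gKs_tmul, gInv_inv]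

theorem gKd_leib (v : U → R) (x y : ExteriorAlgebra 𝕜 (U → 𝕜) ⊗[𝕜] R) :
    gKd v (x * y) = gKd v x * y + gKs 𝕜 U R x * gKd v y := by
  induction x using TensorProduct.induction_on with
  | zero => simp
  | add x x' hx hx' => simp only [add_mul, map_add, hx, hx']; abel
  | tmul a p =>
    induction y using TensorProduct.induction_on with
    | zero => simp
    | add x x' hx hx' => simp only [mul_add, map_add, hx, hx']; abel
    | tmul b q =>
      rw [Algebra.TensorProduct.tmul_mul_tmul, gKd_tmul, gKd_tmul, gKd_tmul, gKs_tmul,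
        Finset.sum_mul, Finset.mul_sum, ← Finset.sum_add_distrib]
      refine Finset.sum_congr rfl fun i _ => ?_
      rw [Algebra.TensorProduct.tmul_mul_tmul, Algebra.TensorProduct.tmul_mul_tmul, gCtr_mul,
        TensorProduct.add_tmul, mul_assoc, mul_left_comm]

theorem gKd_ks (v : U → R) (x : ExteriorAlgebra 𝕜 (U → 𝕜) ⊗[𝕜] R) :
    gKd v (gKs 𝕜 U R x) = - gKs 𝕜 U R (gKd v x) := by
  induction x using TensorProduct.induction_on with
  | zero => simp
  | add x x' hx hx' => simp only [map_add, hx, hx']; abel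
  | tmul a p =>
    rw [gKs_tmul, gKd_tmul, gKd_tmul, map_sum, ← Finset.sum_neg_distrib]
    refine Finset.sum_congr rfl fun i _ => ?_
    rw [gCtr_inv, gKs_tmul, TensorProduct.neg_tmul]

/-- Contraction on the Koszul complex. -/
noncomputable def gKc (R : Type) [CommRing R] [Algebra 𝕜 R] (i : U) :
    ExteriorAlgebra 𝕜 (U → 𝕜) ⊗[𝕜] R →ₗ[𝕜] ExteriorAlgebra 𝕜 (U → 𝕜) ⊗[𝕜] R :=
  TensorProduct.map (gCtr 𝕜 i) LinearMap.id

theorem gKc_tmul (i : U) (a : ExteriorAlgebra 𝕜 (U → 𝕜)) (p : R) :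
    gKc R i (a ⊗ₜ[𝕜] p) = gCtr 𝕜 i a ⊗ₜ[𝕜] p := rfl

theorem gKd_kc (v : U → R) (i : U) (x : ExteriorAlgebra 𝕜 (U → 𝕜) ⊗[𝕜] R) :
    gKd v (gKc R i x) = - gKc R i (gKd v x) := by
  induction x using TensorProduct.induction_on with
  | zero => simp
  | add x x' hx hx' => simp only [map_add, hx, hx']; abel
  | tmul a p =>
    rw [gKc_tmul, gKd_tmul, gKd_tmul, map_sum, ← Finset.sum_neg_distrib]
    refine Finset.sum_congr rfl fun j _ => ?_
    rw [gCtr_comm, gKc_tmul, TensorProduct.neg_tmul]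

theorem gKc_comm (i j : U) (x : ExteriorAlgebra 𝕜 (U → 𝕜) ⊗[𝕜] R) :
    gKc R i (gKc R j x) = - gKc R j (gKc R i x) := by
  induction x using TensorProduct.induction_on with
  | zero => simp
  | add x x' hx hx' => simp only [map_add, hx, hx']; abel
  | tmul a p => simp only [gKc_tmul]; rw [gCtr_comm, TensorProduct.neg_tmul]

theorem gKc_self (i : U) (x : ExteriorAlgebra 𝕜 (U → 𝕜) ⊗[𝕜] R) :
    gKc R i (gKc R i x) = 0 := by
  induction x using TensorProduct.induction_on with
  | zero => simp
  | add x x' hx hx' => simp only [map_add, hx, hx', add_zero]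
  | tmul a p => simp only [gKc_tmul]; rw [gCtr_self, TensorProduct.zero_tmul]

theorem gKd_gKd (v : U → R) (x : ExteriorAlgebra 𝕜 (U → 𝕜) ⊗[𝕜] R) : gKd v (gKd v x) = 0 := by
  classical
  induction x using TensorProduct.induction_on with
  | zero => simp
  | add x x' hx hx' => simp only [map_add, hx, hx', add_zero]
  | tmul a p =>
    rw [gKd_tmul, map_sum]
    simp only [gKd_tmul]
    rw [← Finset.sum_product']
    refine Finset.sum_involution (fun q _ => (q.2, q.1)) ?_ ?_ (by simp) (by simp)
    · rintro ⟨i, j⟩ -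
      simp only
      rw [gCtr_comm i j, TensorProduct.neg_tmul, mul_left_comm]
      abel
    · rintro ⟨i, j⟩ - h hij
      simp only [Prod.mk.injEq] at hij
      rw [hij.1, gCtr_self, TensorProduct.zero_tmul] at h
      exact h rfl

/-- The generator `u_i`. -/
noncomputable def gU (R : Type) [CommRing R] [Algebra 𝕜 R] [DecidableEq U] (i : U) :
    ExteriorAlgebra 𝕜 (U → 𝕜) ⊗[𝕜] R :=
  ExteriorAlgebra.ι 𝕜 (Pi.single i 1) ⊗ₜ[𝕜] 1

theorem gKd_gU [DecidableEq U] (v : U → R) (i : U) :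
    gKd v (gU (𝕜 := 𝕜) R i) = 1 ⊗ₜ[𝕜] v i := by
  rw [gU, gKd_tmul, Finset.sum_eq_single i]
  · rw [CliffordAlgebra.contractLeft_ι]; simp
  · intro j _ hj
    have : gCtr 𝕜 j (ExteriorAlgebra.ι 𝕜 (Pi.single i (1 : 𝕜))) = 0 := by
      rw [ExteriorAlgebra.ι, CliffordAlgebra.contractLeft_ι]; simp [hj]
    rw [this, TensorProduct.zero_tmul]
  · simp

theorem gKc_gU_mul [DecidableEq U] (i j : U) (x : ExteriorAlgebra 𝕜 (U → 𝕜) ⊗[𝕜] R) :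
    gKc R i (gU R j * x) = (if i = j then x else 0) - gU R j * gKc R i x := by
  induction x using TensorProduct.induction_on with
  | zero => simp
  | add x x' hx hx' => simp only [map_add, mul_add, hx, hx']; split_ifs <;> abel
  | tmul a p =>
    rw [gU, Algebra.TensorProduct.tmul_mul_tmul, gKc_tmul, gKc_tmul, gCtr_iota_mul,
      Algebra.TensorProduct.tmul_mul_tmul, TensorProduct.sub_tmul, one_mul]
    split_ifs with h
    · subst h; simp
    · simp [h]

theorem gKs_gU [DecidableEq U] (i : U) : gKs 𝕜 U R (gU R i) = - gU R i := by
  rw [gU, gKs_tmul, gInv_iota, TensorProduct.neg_tmul]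

/-- The linear map killing the coordinates in `T`. -/
def gKill (𝕜 : Type) [Field 𝕜] {U : Type} [DecidableEq U] (T : Finset U) :
    (U → 𝕜) →ₗ[𝕜] (U → 𝕜) where
  toFun m i := if i ∈ T then 0 else m i
  map_add' a b := by ext i; simp only [Pi.add_apply]; split_ifs <;> simp
  map_smul' a b := by ext i; simp

theorem gKill_single [DecidableEq U] (j : U) (x : ExteriorAlgebra 𝕜 (U → 𝕜)) :
    ExteriorAlgebra.map (gKill 𝕜 {j}) x =
      x - ExteriorAlgebra.ι 𝕜 (Pi.single j 1) * gCtr 𝕜 j x := by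
  induction x using gExt_induction with
  | h0 r => rw [AlgHom.commutes, CliffordAlgebra.contractLeft_algebraMap]; simp
  | hadd a a' h h' => simp only [map_add, h, h', mul_add]; abel
  | hm m x h =>
    have hm : gKill 𝕜 {j} m = m - m j • Pi.single j 1 := by
      ext i
      by_cases hi : i = j
      · subst hi; simp [gKill]
      · simp [gKill, hi]
    have hsq := ExteriorAlgebra.ι_sq_zero (R := 𝕜) (Pi.single j (1 : 𝕜) : U → 𝕜)
    have hanti : ExteriorAlgebra.ι 𝕜 (Pi.single j (1 : 𝕜) : U → 𝕜) * ExteriorAlgebra.ι 𝕜 m =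
        - (ExteriorAlgebra.ι 𝕜 m * ExteriorAlgebra.ι 𝕜 (Pi.single j (1 : 𝕜) : U → 𝕜)) :=
      eq_neg_of_add_eq_zero_left (ExteriorAlgebra.ι_add_mul_swap _ _)
    rw [map_mul, ExteriorAlgebra.map_apply_ι, h, hm, gCtr_iota_mul, map_sub, map_smul]
    simp only [mul_sub, sub_mul, smul_mul_assoc, mul_smul_comm, ← mul_assoc, hsq, hanti]
    simp
    abel

/-- The base change of `gKill`. -/
noncomputable def gTheta (R : Type) [CommRing R] [Algebra 𝕜 R] [DecidableEq U] (T : Finset U) :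
    ExteriorAlgebra 𝕜 (U → 𝕜) ⊗[𝕜] R →ₐ[𝕜] ExteriorAlgebra 𝕜 (U → 𝕜) ⊗[𝕜] R :=
  Algebra.TensorProduct.map (ExteriorAlgebra.map (gKill 𝕜 T)) (AlgHom.id 𝕜 R)

theorem gTheta_single [DecidableEq U] (j : U) (x : ExteriorAlgebra 𝕜 (U → 𝕜) ⊗[𝕜] R) :
    gTheta R {j} x = x - gU R j * gKc R j x := by
  induction x using TensorProduct.induction_on with
  | zero => simp
  | add x x' hx hx' => simp only [map_add, mul_add, hx, hx']; abel
  | tmul a p =>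
    rw [gTheta, Algebra.TensorProduct.map_tmul, gKill_single, gU, gKc_tmul,
      Algebra.TensorProduct.tmul_mul_tmul, TensorProduct.sub_tmul]
    simp

theorem gTheta_fix [DecidableEq U] (T : Finset U) (x : ExteriorAlgebra 𝕜 (U → 𝕜) ⊗[𝕜] R)
    (h : ∀ j ∈ T, gKc R j x = 0) : gTheta R T x = x := by
  induction T using Finset.induction_on with
  | empty =>
    have : gKill 𝕜 (∅ : Finset U) = LinearMap.id := by ext; simp [gKill]
    rw [gTheta, this, ExteriorAlgebra.map_id]; simp
  | insert j T hj ih =>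
    have hk : gKill 𝕜 (insert j T) = (gKill 𝕜 {j}).comp (gKill 𝕜 T) := by
      ext a i; simp [gKill]; by_cases h1 : i = j <;> simp [h1]
    have : gTheta (𝕜 := 𝕜) R (insert j T) = (gTheta R {j}).comp (gTheta R T) := by
      rw [gTheta, hk, gTheta, gTheta, ← ExteriorAlgebra.map_comp_map]
      ext <;> simp
    rw [this, AlgHom.comp_apply, ih fun i hi => h i (Finset.mem_insert_of_mem hi), gTheta_single,
      h j (Finset.mem_insert_self _ _)]
    simp

end KosSec

section MapSec
set_option linter.unusedSectionVars false
open scoped TensorProduct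
variable {𝕜 : Type} [Field 𝕜] {U : Type} [Fintype U] {R : Type} [CommRing R] [Algebra 𝕜 R]
  {S : Type} [CommRing S] [Algebra 𝕜 S] {S' : Type} [CommRing S'] [Algebra 𝕜 S']

/-- Base change along an algebra map. -/
noncomputable def gM (U : Type) (φ : R →ₐ[𝕜] S) :
    ExteriorAlgebra 𝕜 (U → 𝕜) ⊗[𝕜] R →ₐ[𝕜] ExteriorAlgebra 𝕜 (U → 𝕜) ⊗[𝕜] S :=
  Algebra.TensorProduct.map (AlgHom.id 𝕜 _) φ

theorem gM_tmul (φ : R →ₐ[𝕜] S) (a : ExteriorAlgebra 𝕜 (U → 𝕜)) (p : R) :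
    gM U φ (a ⊗ₜ[𝕜] p) = a ⊗ₜ[𝕜] φ p := rfl

theorem gM_d (φ : R →ₐ[𝕜] S) (v : U → R) (w : U → S) (h : ∀ j, φ (v j) = w j)
    (x : ExteriorAlgebra 𝕜 (U → 𝕜) ⊗[𝕜] R) : gM U φ (gKd v x) = gKd w (gM U φ x) := by
  induction x using TensorProduct.induction_on with
  | zero => simp
  | add x x' hx hx' => simp only [map_add, hx, hx']
  | tmul a p =>
    rw [gKd_tmul, gM_tmul, gKd_tmul, map_sum]
    refine Finset.sum_congr rfl fun i _ => ?_
    rw [gM_tmul, map_mul, h]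

theorem gM_s (φ : R →ₐ[𝕜] S) (x : ExteriorAlgebra 𝕜 (U → 𝕜) ⊗[𝕜] R) :
    gM U φ (gKs 𝕜 U R x) = gKs 𝕜 U S (gM U φ x) := by
  induction x using TensorProduct.induction_on with
  | zero => simp
  | add x x' hx hx' => simp only [map_add, hx, hx']
  | tmul a p => rfl

theorem gM_comp (φ : R →ₐ[𝕜] S) (ψ : S →ₐ[𝕜] S') (x : ExteriorAlgebra 𝕜 (U → 𝕜) ⊗[𝕜] R) :
    gM U ψ (gM U φ x) = gM U (ψ.comp φ) x := by
  induction x using TensorProduct.induction_on with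
  | zero => simp
  | add x x' hx hx' => simp only [map_add, hx, hx']
  | tmul a p => rfl

theorem gM_id (x : ExteriorAlgebra 𝕜 (U → 𝕜) ⊗[𝕜] R) : gM U (AlgHom.id 𝕜 R) x = x := by
  induction x using TensorProduct.induction_on with
  | zero => simp
  | add x x' hx hx' => simp only [map_add, hx, hx']
  | tmul a p => rfl

/-- The extension of an ideal. -/
def gT (𝕜 : Type) [Field 𝕜] (U : Type) {R : Type} [CommRing R] [Algebra 𝕜 R] (I : Ideal R) :
    Submodule 𝕜 (ExteriorAlgebra 𝕜 (U → 𝕜) ⊗[𝕜] R) :=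
  Submodule.span 𝕜 {x | ∃ a, ∃ p ∈ I, x = a ⊗ₜ[𝕜] p}

theorem gT_tmul (I : Ideal R) (a : ExteriorAlgebra 𝕜 (U → 𝕜)) {p : R} (hp : p ∈ I) :
    a ⊗ₜ[𝕜] p ∈ gT 𝕜 U I := Submodule.subset_span ⟨a, p, hp, rfl⟩


theorem gT_le (I : Ideal R) (N : Submodule 𝕜 (ExteriorAlgebra 𝕜 (U → 𝕜) ⊗[𝕜] R))
    (h : ∀ a, ∀ p ∈ I, a ⊗ₜ[𝕜] p ∈ N) : gT 𝕜 U I ≤ N := by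
  refine Submodule.span_le.2 ?_
  rintro _ ⟨a, p, hp, rfl⟩
  exact h a p hp

theorem gT_eq {E : Type*} [AddCommGroup E] [Module 𝕜 E] (I : Ideal R)
    (F G : (ExteriorAlgebra 𝕜 (U → 𝕜) ⊗[𝕜] R) →ₗ[𝕜] E)
    (h : ∀ a, ∀ p ∈ I, F (a ⊗ₜ[𝕜] p) = G (a ⊗ₜ[𝕜] p)) {x} (hx : x ∈ gT 𝕜 U I) : F x = G x :=
  gT_le I (LinearMap.eqLocus F G) (fun a p hp => h a p hp) hx

theorem gT_mul_left (I : Ideal R) (b : ExteriorAlgebra 𝕜 (U → 𝕜) ⊗[𝕜] R) {x}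
    (hx : x ∈ gT 𝕜 U I) : b * x ∈ gT 𝕜 U I := by
  refine gT_le I ((gT 𝕜 U I).comap (LinearMap.mulLeft 𝕜 b)) (fun a p hp => ?_) hx
  simp only [Submodule.mem_comap, LinearMap.mulLeft_apply]
  induction b using TensorProduct.induction_on with
  | zero => simp
  | add x x' hx hx' => rw [add_mul]; exact add_mem hx hx'
  | tmul a' p' =>
    rw [Algebra.TensorProduct.tmul_mul_tmul]; exact gT_tmul _ _ (I.mul_mem_left _ hp)

theorem gT_mul_right (I : Ideal R) (b : ExteriorAlgebra 𝕜 (U → 𝕜) ⊗[𝕜] R) {x}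
    (hx : x ∈ gT 𝕜 U I) : x * b ∈ gT 𝕜 U I := by
  refine gT_le I ((gT 𝕜 U I).comap (LinearMap.mulRight 𝕜 b)) (fun a p hp => ?_) hx
  simp only [Submodule.mem_comap, LinearMap.mulRight_apply]
  induction b using TensorProduct.induction_on with
  | zero => simp
  | add x x' hx hx' => rw [mul_add]; exact add_mem hx hx'
  | tmul a' p' =>
    rw [Algebra.TensorProduct.tmul_mul_tmul]; exact gT_tmul _ _ (I.mul_mem_right _ hp)

theorem gT_d (I : Ideal R) (v : U → R) {x} (hx : x ∈ gT 𝕜 U I) : gKd v x ∈ gT 𝕜 U I := by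
  refine gT_le I ((gT 𝕜 U I).comap (gKd v)) (fun a p hp => ?_) hx
  simp only [Submodule.mem_comap, gKd_tmul]
  exact Submodule.sum_mem _ fun i _ => gT_tmul _ _ (I.mul_mem_left _ hp)

theorem gT_map (I : Ideal R) (J : Ideal S) (φ : R →ₐ[𝕜] S) (h : ∀ p ∈ I, φ p ∈ J) {x}
    (hx : x ∈ gT 𝕜 U I) : gM U φ x ∈ gT 𝕜 U J := by
  refine gT_le I ((gT 𝕜 U J).comap (gM U φ).toLinearMap) (fun a p hp => ?_) hx
  exact gT_tmul _ _ (h p hp)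

theorem gT_kill (I : Ideal R) (φ : R →ₐ[𝕜] S) (h : ∀ p ∈ I, φ p = 0) {x}
    (hx : x ∈ gT 𝕜 U I) : gM U φ x = 0 := by
  refine gT_eq I (gM U φ).toLinearMap 0 (fun a p hp => ?_) hx
  rw [AlgHom.toLinearMap_apply, gM_tmul, h p hp]; simp

theorem gT_sub (I : Ideal R) (φ : R →ₐ[𝕜] R) (h : ∀ p, p - φ p ∈ I)
    (x : ExteriorAlgebra 𝕜 (U → 𝕜) ⊗[𝕜] R) : x - gM U φ x ∈ gT 𝕜 U I := by
  induction x using TensorProduct.induction_on with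
  | zero => simp
  | add x x' hx hx' => rw [map_add, add_sub_add_comm]; exact add_mem hx hx'
  | tmul a p => rw [gM_tmul, ← TensorProduct.tmul_sub]; exact gT_tmul _ _ (h p)

theorem gT_sup (I J : Ideal R) {x} (hx : x ∈ gT 𝕜 U (I ⊔ J)) :
    x ∈ gT 𝕜 U I ⊔ gT 𝕜 U J := by
  refine gT_le _ _ (fun a p hp => ?_) hx
  obtain ⟨y, hy, z, hz, rfl⟩ := Submodule.mem_sup.1 hp
  rw [TensorProduct.tmul_add]
  exact Submodule.add_mem_sup (gT_tmul _ _ hy) (gT_tmul _ _ hz)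

theorem gT_mul_zero (I J : Ideal R) (h : ∀ p ∈ I, ∀ q ∈ J, p * q = 0) {x y}
    (hx : x ∈ gT 𝕜 U I) (hy : y ∈ gT 𝕜 U J) : x * y = 0 := by
  refine gT_eq J (LinearMap.mulLeft 𝕜 x) 0 (fun a p hp => ?_) hy
  refine gT_eq I (LinearMap.mulRight 𝕜 (a ⊗ₜ[𝕜] p)) 0 (fun b q hq => ?_) hx
  simp [h q hq p hp]

/-- Two algebra maps agreeing on generators. -/
theorem gHom_eq {W : Type} {x : W → R} (hπ : Function.Surjective (MvPolynomial.aeval (R := 𝕜) x))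
    (φ ψ : R →ₐ[𝕜] S) (h : ∀ i, φ (x i) = ψ (x i)) : φ = ψ := by
  have : φ.comp (MvPolynomial.aeval x) = ψ.comp (MvPolynomial.aeval x) := by
    ext i; simp [h]
  ext r
  obtain ⟨p, rfl⟩ := hπ r
  exact DFunLike.congr_fun this p

end MapSec

section PoinSec
set_option linter.unusedSectionVars false
open scoped TensorProduct
variable {𝕜 : Type} [Field 𝕜] {U : Type} [Fintype U] [DecidableEq U] {W : Type} [DecidableEq W]
open MvPolynomial

/-- Setting the variables in `T` to zero. -/
noncomputable def gEv (𝕜 : Type) [Field 𝕜] {W : Type} [DecidableEq W] (T : Finset W) :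
    MvPolynomial W 𝕜 →ₐ[𝕜] MvPolynomial W 𝕜 :=
  aeval fun i => if i ∈ T then 0 else X i

/-- Division by a variable. -/
noncomputable def gDelta (i : W) : MvPolynomial W 𝕜 →ₗ[𝕜] MvPolynomial W 𝕜 where
  toFun p := p.divMonomial (Finsupp.single i 1)
  map_add' a b := add_divMonomial _ _ _
  map_smul' c a := by
    ext m; simp [coeff_divMonomial]

theorem gDelta_X_mul (i : W) (p : MvPolynomial W 𝕜) : gDelta i (X i * p) = p :=
  X_mul_divMonomial _ _

theorem gDelta_X_ne (i j : W) (hij : j ≠ i) (p : MvPolynomial W 𝕜) :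
    gDelta i (X j * p) = X j * gDelta i p := by
  ext m
  simp only [gDelta, LinearMap.coe_mk, AddHom.coe_mk, coeff_divMonomial, coeff_X_mul']
  have h1 : j ∈ (Finsupp.single i 1 + m).support ↔ j ∈ m.support := by
    simp [hij.symm]
  by_cases h : j ∈ m.support
  · rw [if_pos (h1.2 h), if_pos h]
    congr 1
    refine add_tsub_assoc_of_le ?_ _
    rw [Finsupp.single_le_iff]
    have := Finsupp.mem_support_iff.1 h
    omega
  · rw [if_neg (fun h' => h (h1.1 h')), if_neg h]

theorem gDelta_spec (i : W) (p : MvPolynomial W 𝕜) :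
    X i * gDelta i p = p - gEv 𝕜 {i} p := by
  induction p using MvPolynomial.induction_on with
  | C a =>
    have h1 : gDelta i (C a : MvPolynomial W 𝕜) = 0 := by
      ext m
      simp only [gDelta, LinearMap.coe_mk, AddHom.coe_mk, coeff_divMonomial, coeff_C, coeff_zero]
      rw [if_neg]
      intro h
      have := DFunLike.congr_fun h i
      simp at this
      omega
    rw [h1]; simp [gEv]
  | add p q hp hq => rw [map_add, mul_add, hp, hq, map_add]; ring
  | mul_X p j hp =>
    rw [mul_comm p]
    by_cases hj : j = i
    · subst hj; rw [gDelta_X_mul, map_mul]; simp [gEv]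
    · rw [gDelta_X_ne i j hj, mul_left_comm, hp, map_mul, mul_sub]; simp [gEv, hj]

/-- The map killing the exterior and polynomial variables in `T`. -/
noncomputable def gKap (𝕜 : Type) [Field 𝕜] {U : Type} [DecidableEq U] {W : Type} [DecidableEq W]
    (f : W → U) (T : Finset W) :
    ExteriorAlgebra 𝕜 (U → 𝕜) ⊗[𝕜] MvPolynomial W 𝕜 →ₐ[𝕜]
      ExteriorAlgebra 𝕜 (U → 𝕜) ⊗[𝕜] MvPolynomial W 𝕜 :=
  Algebra.TensorProduct.map (ExteriorAlgebra.map (gKill 𝕜 (T.image f))) (gEv 𝕜 T)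

theorem gKap_insert (f : W → U) (T : Finset W) (i : W) :
    gKap 𝕜 f (insert i T) = (gKap 𝕜 f {i}).comp (gKap 𝕜 f T) := by
  have hk : gKill 𝕜 ((insert i T).image f) = (gKill 𝕜 (({i} : Finset W).image f)).comp
      (gKill 𝕜 (T.image f)) := by
    ext a k; simp only [gKill, Finset.image_insert, Finset.image_singleton]
    simp
    by_cases h1 : k = f i <;> simp [h1]
  have he : gEv 𝕜 (insert i T) = (gEv 𝕜 {i}).comp (gEv 𝕜 T) := by
    ext k : 1
    simp only [gEv, aeval_X, AlgHom.comp_apply]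
    by_cases h2 : k = i
    · subst h2; by_cases h1 : k ∈ T <;> simp [h1]
    · by_cases h1 : k ∈ T <;> simp [h1, h2]
  rw [gKap, hk, he, ← ExteriorAlgebra.map_comp_map]
  apply Algebra.TensorProduct.ext
  · ext m; simp [gKap]
  · ext m; simp [gKap]

theorem gPoin_one (f : W → U) (hf : Function.Injective f) (w : U → MvPolynomial W 𝕜)
    (i : W) (hwi : w (f i) = X i)
    (hw : ∀ u, u ≠ f i → w u = 0 ∨ ∃ j, j ≠ i ∧ w u = X j)
    (z : ExteriorAlgebra 𝕜 (U → 𝕜) ⊗[𝕜] MvPolynomial W 𝕜) (hz : gKd w z = 0) :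
    ∃ y, z - gKd w y = gKap 𝕜 f {i} z := by
  let h : ExteriorAlgebra 𝕜 (U → 𝕜) ⊗[𝕜] MvPolynomial W 𝕜 →ₗ[𝕜]
      ExteriorAlgebra 𝕜 (U → 𝕜) ⊗[𝕜] MvPolynomial W 𝕜 :=
    TensorProduct.map (LinearMap.mulLeft 𝕜 (ExteriorAlgebra.ι 𝕜 (Pi.single (f i) 1))) (gDelta i)
  have hh : ∀ a p, h (a ⊗ₜ[𝕜] p) =
      (ExteriorAlgebra.ι 𝕜 (Pi.single (f i) 1) * a) ⊗ₜ[𝕜] gDelta i p := fun a p => rfl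
  have key : ∀ x, gKd w (h x) + h (gKd w x) = x - gKap 𝕜 f {i} x := by
    intro x
    induction x using TensorProduct.induction_on with
    | zero => simp
    | add x y hx hy =>
      simp only [map_add]
      rw [add_add_add_comm, hx, hy]; abel
    | tmul a p =>
      rw [hh, gKd_tmul, gKd_tmul, map_sum, ← Finset.sum_add_distrib, Finset.sum_eq_single (f i)]
      · rw [hh, gCtr_iota_mul, hwi, gDelta_X_mul, gDelta_spec, gKap,
          Algebra.TensorProduct.map_tmul, Finset.image_singleton, gKill_single]
        simp only [Pi.single_eq_same, one_smul, TensorProduct.sub_tmul, TensorProduct.tmul_sub]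
        abel
      · intro u _ hu
        rw [hh, gCtr_iota_mul, Pi.single_eq_of_ne hu, zero_smul, zero_sub, TensorProduct.neg_tmul]
        rcases hw u hu with h0 | ⟨j, hj, h0⟩
        · rw [h0]; simp
        · rw [h0, gDelta_X_ne i j hj, neg_add_cancel]
      · simp
  refine ⟨h z, ?_⟩
  have := key z
  rw [hz, map_zero, add_zero] at this
  rw [this]; abel

theorem gPoin (f : W → U) (hf : Function.Injective f) (σ : Finset W) (w : U → MvPolynomial W 𝕜)
    (hwi : ∀ i ∈ σ, w (f i) = X i) (hw : ∀ u, (¬ ∃ i ∈ σ, f i = u) → w u = 0)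
    (T : Finset W) (hT : T ⊆ σ)
    (z : ExteriorAlgebra 𝕜 (U → 𝕜) ⊗[𝕜] MvPolynomial W 𝕜) (hz : gKd w z = 0) :
    ∃ y, z - gKd w y = gKap 𝕜 f T z := by
  induction T using Finset.induction_on with
  | empty =>
    refine ⟨0, ?_⟩
    have : gKill 𝕜 (∅ : Finset U) = LinearMap.id := by ext; simp [gKill]
    have h2 : gEv 𝕜 (∅ : Finset W) = AlgHom.id 𝕜 _ := by ext; simp [gEv]
    rw [gKap, Finset.image_empty, this, h2, ExteriorAlgebra.map_id]; simp
  | insert i T hi ih =>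
    obtain ⟨y, hy⟩ := ih fun _ h => hT (Finset.mem_insert_of_mem h)
    have hc : gKd w (gKap 𝕜 f T z) = 0 := by rw [← hy, map_sub, hz, gKd_gKd, sub_zero]
    obtain ⟨y', hy'⟩ := gPoin_one f hf w i (hwi i (hT (Finset.mem_insert_self _ _))) (by
      intro u hu
      by_cases h : ∃ i ∈ σ, f i = u
      · obtain ⟨j, hj, rfl⟩ := h
        exact Or.inr ⟨j, fun h => hu (by rw [h]), hwi j hj⟩
      · exact Or.inl (hw u h)) _ hc
    refine ⟨y + y', ?_⟩
    rw [gKap_insert, AlgHom.comp_apply, ← hy', ← hy, map_add]; abel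

/-- The comparison lemma with the full simplex. -/
theorem gL2 {R : Type} [CommRing R] [Algebra 𝕜 R] (f : W → U) (hf : Function.Injective f)
    (x : W → R) (v : U → R) (hvx : ∀ i, v (f i) = x i) (hv0 : ∀ u, (¬ ∃ i, f i = u) → v u = 0)
    (hπ : Function.Surjective (aeval (R := 𝕜) x)) (σ : Finset W) (q : R →ₐ[𝕜] MvPolynomial W 𝕜)
    (hq : ∀ i, q (x i) = if i ∈ σ then X i else 0) (e : R →ₐ[𝕜] 𝕜) (he : ∀ i, e (x i) = 0)
    (r : ExteriorAlgebra 𝕜 (U → 𝕜) ⊗[𝕜] R) (hr : gM U e r = 0)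
    (hdr : gKd v r ∈ gT 𝕜 U (Ideal.span (x '' {i | i ∉ σ}))) :
    ∃ y, r - gKd v y ∈ gT 𝕜 U (Ideal.span (x '' {i | i ∉ σ})) := by
  set I := Ideal.span (x '' {i | i ∉ σ}) with hI
  set π : MvPolynomial W 𝕜 →ₐ[𝕜] R := aeval x with hπd
  have hqI : ∀ p ∈ I, q p = 0 := by
    intro p hp
    have : I ≤ RingHom.ker q := by
      rw [hI, Ideal.span_le]
      rintro _ ⟨i, hi, rfl⟩
      have hi' : i ∉ σ := hi
      simp [RingHom.mem_ker, hq, hi']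
    exact this hp
  let w : U → MvPolynomial W 𝕜 := fun u => q (v u)
  have hw1 : ∀ i ∈ σ, w (f i) = X i := fun i hi => by simp [w, hvx, hq, hi]
  have hw0 : ∀ u, (¬ ∃ i ∈ σ, f i = u) → w u = 0 := by
    intro u hu
    by_cases h : ∃ i, f i = u
    · obtain ⟨i, rfl⟩ := h
      have : i ∉ σ := fun h => hu ⟨i, h, rfl⟩
      simp [w, hvx, hq, this]
    · simp [w, hv0 u h]
  have hz : gKd w (gM U q r) = 0 := by
    rw [← gM_d q v w (fun _ => rfl)]
    exact gT_kill I q hqI hdr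
  obtain ⟨y, hy⟩ := gPoin f hf σ w hw1 hw0 σ subset_rfl _ hz
  have hκ : gKap 𝕜 f σ (gM U q r) = 0 := by
    have h1 : (gEv 𝕜 σ).comp q = (Algebra.ofId 𝕜 (MvPolynomial W 𝕜)).comp e := by
      refine gHom_eq hπ _ _ fun i => ?_
      simp only [AlgHom.comp_apply, hq, he, map_zero]
      split_ifs with h
      · simp [gEv, h]
      · simp
    have h2 : ∀ r, gKap 𝕜 f σ (gM U q r) =
        Algebra.TensorProduct.map (ExteriorAlgebra.map (gKill 𝕜 (σ.image f)))
          (Algebra.ofId 𝕜 (MvPolynomial W 𝕜)) (gM U e r) := by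
      intro r
      induction r using TensorProduct.induction_on with
      | zero => simp
      | add a b ha hb => simp only [map_add, ha, hb]
      | tmul a p =>
        rw [gM_tmul, gM_tmul, gKap, Algebra.TensorProduct.map_tmul, Algebra.TensorProduct.map_tmul]
        congr 1
        exact DFunLike.congr_fun h1 p
    rw [h2, hr, map_zero]
  rw [hκ, sub_eq_zero] at hy
  have hqπ : ∀ p, q (π (q p)) = q p := by
    intro p
    have : (q.comp π).comp q = q := by
      refine gHom_eq hπ _ _ fun i => ?_
      simp only [AlgHom.comp_apply, hq]
      split_ifs with h
      · simp [π, hq, h]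
      · simp
    exact DFunLike.congr_fun this p
  have hπq : ∀ p, p - π (q p) ∈ I := by
    intro p
    have : (Ideal.Quotient.mkₐ 𝕜 I) = (Ideal.Quotient.mkₐ 𝕜 I).comp (π.comp q) := by
      refine gHom_eq hπ _ _ fun i => ?_
      simp only [AlgHom.comp_apply, hq]
      split_ifs with h
      · simp [π]
      · simp only [map_zero, Ideal.Quotient.mkₐ_eq_mk]
        exact Ideal.Quotient.eq_zero_iff_mem.2 (Ideal.subset_span ⟨i, h, rfl⟩)
    exact (Ideal.Quotient.eq).1 (DFunLike.congr_fun this p)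
  refine ⟨gM U π y, ?_⟩
  have hQ : gM U q (r - gKd v (gM U π y)) = 0 := by
    rw [map_sub, gM_d q v w (fun _ => rfl), gM_comp, ← gM_d (q.comp π) w w (fun u => hqπ _), ← hy,
      gM_comp]
    have : (q.comp π).comp q = q := by ext1 p; exact hqπ p
    rw [this, sub_self]
  have := gT_sub (U := U) I (π.comp q) hπq (r - gKd v (gM U π y))
  rwa [← gM_comp, hQ, map_zero, sub_zero] at this

end PoinSec

section GolSec
set_option linter.unusedSectionVars false
open scoped TensorProduct
variable {𝕜 : Type} [Field 𝕜] {U : Type} [Fintype U] {W : Type} [Fintype W]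
  {R : Type} [CommRing R] [Algebra 𝕜 R]

/-- Vanishing criterion for the reduction modulo the augmentation ideal of `R`. -/
theorem gL1 (x : U → R) (e : R →ₐ[𝕜] 𝕜) (c : U → R →ₗ[𝕜] 𝕜)
    (a : ExteriorAlgebra 𝕜 (U → 𝕜) ⊗[𝕜] R →ₐ[𝕜] 𝕜)
    (ha1 : ∀ m, a (ExteriorAlgebra.ι 𝕜 m ⊗ₜ[𝕜] 1) = 0) (ha2 : ∀ p, a (1 ⊗ₜ[𝕜] p) = e p)
    (hcx : ∀ i j p, c i (x j * p) = (by classical exact if j = i then e p else 0))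
    (z : ExteriorAlgebra 𝕜 (U → 𝕜) ⊗[𝕜] R) (hz : a z = 0)
    (hc : ∀ i, TensorProduct.map (LinearMap.id : ExteriorAlgebra 𝕜 (U → 𝕜) →ₗ[𝕜] _) (c i)
      (gKd x z) = 0) :
    gM U e z = 0 := by
  classical
  have h1 : ∀ i z, TensorProduct.map (LinearMap.id : ExteriorAlgebra 𝕜 (U → 𝕜) →ₗ[𝕜] _) (c i)
      (gKd x z) = gKc 𝕜 i (gM U e z) := by
    intro i z
    induction z using TensorProduct.induction_on with
    | zero => simp
    | add a b ha hb => simp only [map_add, ha, hb]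
    | tmul a p =>
      rw [gKd_tmul, map_sum, gM_tmul, gKc_tmul, Finset.sum_eq_single i]
      · rw [TensorProduct.map_tmul, hcx]; simp
      · intro j _ hj
        rw [TensorProduct.map_tmul, hcx]; simp [hj]
      · simp
  have h2 : gTheta 𝕜 Finset.univ (gM U e z) = gM U e z :=
    gTheta_fix _ _ fun j _ => by rw [← h1, hc]
  have h3 : ((gTheta 𝕜 Finset.univ).comp (gM U e)) = (Algebra.ofId 𝕜 _).comp a := by
    have hk : gKill 𝕜 (Finset.univ : Finset U) = 0 := by ext; simp [gKill]
    apply Algebra.TensorProduct.ext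
    · apply ExteriorAlgebra.hom_ext
      ext m
      simp [gM_tmul, gTheta, hk, ha1]
    · ext p
      simp [gM_tmul, gTheta, ha2]
      rw [Algebra.algebraMap_eq_smul_one, TensorProduct.smul_tmul]
      simp
  rw [← h2]
  have := DFunLike.congr_fun h3 z
  simp only [AlgHom.comp_apply, hz, map_zero] at this
  exact this

theorem gC_mul (e : R →ₐ[𝕜] 𝕜) (c : R →ₗ[𝕜] 𝕜)
    (hc : ∀ p p', c (p * p') = e p * c p' + c p * e p')
    (y z : ExteriorAlgebra 𝕜 (U → 𝕜) ⊗[𝕜] R) (hy : gM U e y = 0) (hz : gM U e z = 0) :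
    TensorProduct.map (LinearMap.id : ExteriorAlgebra 𝕜 (U → 𝕜) →ₗ[𝕜] _) c (y * z) = 0 := by
  have h : ∀ y z, TensorProduct.map (LinearMap.id : ExteriorAlgebra 𝕜 (U → 𝕜) →ₗ[𝕜] _) c (y * z) =
      gM U e y * TensorProduct.map LinearMap.id c z +
        TensorProduct.map LinearMap.id c y * gM U e z := by
    intro y z
    induction y using TensorProduct.induction_on with
    | zero => simp
    | add a b ha hb => simp only [add_mul, map_add, ha, hb]; abel
    | tmul a p =>
      induction z using TensorProduct.induction_on with
      | zero => simp
      | add a b ha hb => simp only [mul_add, map_add, ha, hb]; abel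
      | tmul b q =>
        simp only [gM_tmul, Algebra.TensorProduct.tmul_mul_tmul, TensorProduct.map_tmul, hc,
          TensorProduct.tmul_add, LinearMap.id_apply]
  rw [h, hy, hz]; simp

/-- Generic form of the Golod property. -/
def gGol (x : W → R) (e : R →ₐ[𝕜] 𝕜) : Prop :=
  ∃ (X : Type) (ω : List X → ExteriorAlgebra 𝕜 (W → 𝕜) ⊗[𝕜] R), ω [] = 0 ∧
    (∀ l, gM W e (ω l) = 0) ∧
    (∀ l, gKd x (ω l) = - gConv (fun t => gKs 𝕜 W R (ω t)) ω l) ∧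
    ∀ r, gM W e r = 0 → gKd x r = 0 →
      r ∈ Submodule.span 𝕜 (Set.range fun y => ω [y]) ⊔ LinearMap.range (gKd x)

theorem gCtr_map (L : (W → 𝕜) →ₗ[𝕜] (U → 𝕜)) (i : W) (u : U) (h : ∀ m, L m u = m i)
    (a : ExteriorAlgebra 𝕜 (W → 𝕜)) :
    gCtr 𝕜 u (ExteriorAlgebra.map L a) = ExteriorAlgebra.map L (gCtr 𝕜 i a) := by
  induction a using gExt_induction with
  | h0 r => rw [AlgHom.commutes, CliffordAlgebra.contractLeft_algebraMap,
      CliffordAlgebra.contractLeft_algebraMap, map_zero]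
  | hadd a b ha hb => simp only [map_add, ha, hb]
  | hm m a ha =>
    rw [map_mul, ExteriorAlgebra.map_apply_ι, gCtr_iota_mul, gCtr_iota_mul, map_sub, map_smul,
      map_mul, ExteriorAlgebra.map_apply_ι, ha, h]

theorem gInv_map (L : (W → 𝕜) →ₗ[𝕜] (U → 𝕜)) (a : ExteriorAlgebra 𝕜 (W → 𝕜)) :
    gInv 𝕜 U (ExteriorAlgebra.map L a) = ExteriorAlgebra.map L (gInv 𝕜 W a) := by
  induction a using gExt_induction with
  | h0 r => simp only [AlgHom.commutes]
  | hadd a b ha hb => simp only [map_add, ha, hb]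
  | hm m a ha =>
    rw [map_mul, ExteriorAlgebra.map_apply_ι, map_mul, map_mul, gInv_iota, gInv_iota, map_mul,
      map_neg, ExteriorAlgebra.map_apply_ι, ha]

/-- Change of the exterior variables. -/
noncomputable def gL (R : Type) [CommRing R] [Algebra 𝕜 R] (L : (W → 𝕜) →ₗ[𝕜] (U → 𝕜)) :
    ExteriorAlgebra 𝕜 (W → 𝕜) ⊗[𝕜] R →ₐ[𝕜] ExteriorAlgebra 𝕜 (U → 𝕜) ⊗[𝕜] R :=
  Algebra.TensorProduct.map (ExteriorAlgebra.map L) (AlgHom.id 𝕜 R)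

theorem gL_tmul (L : (W → 𝕜) →ₗ[𝕜] (U → 𝕜)) (a : ExteriorAlgebra 𝕜 (W → 𝕜)) (p : R) :
    gL R L (a ⊗ₜ[𝕜] p) = ExteriorAlgebra.map L a ⊗ₜ[𝕜] p := rfl

theorem gL_s (L : (W → 𝕜) →ₗ[𝕜] (U → 𝕜)) (z : ExteriorAlgebra 𝕜 (W → 𝕜) ⊗[𝕜] R) :
    gL R L (gKs 𝕜 W R z) = gKs 𝕜 U R (gL R L z) := by
  induction z using TensorProduct.induction_on with
  | zero => simp
  | add a b ha hb => simp only [map_add, ha, hb]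
  | tmul a p => rw [gKs_tmul, gL_tmul, gL_tmul, gKs_tmul, gInv_map]

theorem gL_e {S : Type} [CommRing S] [Algebra 𝕜 S] (L : (W → 𝕜) →ₗ[𝕜] (U → 𝕜)) (e : R →ₐ[𝕜] S)
    (z : ExteriorAlgebra 𝕜 (W → 𝕜) ⊗[𝕜] R) :
    gM U e (gL R L z) = gL S L (gM W e z) := by
  induction z using TensorProduct.induction_on with
  | zero => simp
  | add a b ha hb => simp only [map_add, ha, hb]
  | tmul a p => rfl

theorem gL_d_ext (f : W → U) (hf : Function.Injective f) (x : W → R) (v : U → R)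
    (hvx : ∀ i, v (f i) = x i) (hv0 : ∀ u, (¬ ∃ i, f i = u) → v u = 0)
    (L : (W → 𝕜) →ₗ[𝕜] (U → 𝕜)) (hL : ∀ m i, L m (f i) = m i)
    (z : ExteriorAlgebra 𝕜 (W → 𝕜) ⊗[𝕜] R) :
    gKd v (gL R L z) = gL R L (gKd x z) := by
  induction z using TensorProduct.induction_on with
  | zero => simp
  | add a b ha hb => simp only [map_add, ha, hb]
  | tmul a p =>
    rw [gKd_tmul, gL_tmul, gKd_tmul, map_sum]
    symm
    refine Fintype.sum_of_injective f hf _ _ ?_ ?_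
    · intro u hu
      rw [hv0 u (fun ⟨i, hi⟩ => hu ⟨i, hi⟩)]; simp
    · intro i
      rw [gL_tmul, hvx, gCtr_map L i (f i) (fun m => hL m i)]

theorem gL_d_res (f : W → U) (hf : Function.Injective f) (x : W → R) (v : U → R)
    (hvx : ∀ i, v (f i) = x i) (hv0 : ∀ u, (¬ ∃ i, f i = u) → v u = 0)
    (L : (U → 𝕜) →ₗ[𝕜] (W → 𝕜)) (hL : ∀ m i, L m i = m (f i))
    (z : ExteriorAlgebra 𝕜 (U → 𝕜) ⊗[𝕜] R) :
    gKd x (gL R L z) = gL R L (gKd v z) := by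
  induction z using TensorProduct.induction_on with
  | zero => simp
  | add a b ha hb => simp only [map_add, ha, hb]
  | tmul a p =>
    rw [gKd_tmul, gL_tmul, gKd_tmul, map_sum]
    refine Fintype.sum_of_injective f hf _ _ ?_ ?_
    · intro u hu
      rw [hv0 u (fun ⟨i, hi⟩ => hu ⟨i, hi⟩)]; simp
    · intro i
      rw [gL_tmul, hvx, gCtr_map L (f i) i (fun m => hL m i)]

end GolSec

section HalfSec
set_option linter.unusedSectionVars false
open scoped TensorProduct
variable {𝕜 : Type} [Field 𝕜] {U : Type} [Fintype U] {W : Type} [Fintype W]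
  {R : Type} [CommRing R] [Algebra 𝕜 R] {S : Type} [CommRing S] [Algebra 𝕜 S]

theorem gL3 [DecidableEq U] (f : W → U) (hf : Function.Injective f) (x : W → R) (v : U → R)
    (hvx : ∀ i, v (f i) = x i) (hv0 : ∀ u, (¬ ∃ i, f i = u) → v u = 0) (e : R →ₐ[𝕜] 𝕜)
    {X : Type} (ω : List X → ExteriorAlgebra 𝕜 (W → 𝕜) ⊗[𝕜] R)
    (hω : ∀ r, gM W e r = 0 → gKd x r = 0 →
      r ∈ Submodule.span 𝕜 (Set.range fun y => ω [y]) ⊔ LinearMap.range (gKd x))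
    (L : (W → 𝕜) →ₗ[𝕜] (U → 𝕜)) (hL : ∀ m i, L m (f i) = m i)
    (hL0 : ∀ m u, (¬ ∃ i, f i = u) → L m u = 0)
    (r : ExteriorAlgebra 𝕜 (U → 𝕜) ⊗[𝕜] R) (hr : gM U e r = 0) (hdr : gKd v r = 0) :
    r ∈ AddSubgroup.closure {r | ∃ b y, gKd v b = 0 ∧ r = b * gL R L (ω [y])} ⊔
      (gKd (𝕜 := 𝕜) v).toAddMonoidHom.range := by
  classical
  set N := AddSubgroup.closure {r | ∃ b y, gKd v b = 0 ∧ r = b * gL R L (ω [y])} ⊔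
      (gKd (𝕜 := 𝕜) v).toAddMonoidHom.range with hN
  set T₀ : Finset U := Finset.univ.filter fun u => ¬ ∃ i, f i = u with hT₀
  have hT₀' : ∀ j, j ∈ T₀ ↔ ¬ ∃ i, f i = j := by intro j; simp [T₀]
  have hNmul : ∀ b, gKd v b = 0 → ∀ n ∈ N, b * n ∈ N := by
    intro b hb n hn
    rw [hN, AddSubgroup.mem_sup] at hn
    obtain ⟨n1, h1, n2, ⟨y, rfl⟩, rfl⟩ := hn
    rw [mul_add]
    refine AddSubgroup.add_mem _ ?_ ?_
    · refine AddSubgroup.closure_induction (p := fun n _ => b * n ∈ N) ?_ ?_ ?_ ?_ h1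
      · rintro _ ⟨b', y, hb', rfl⟩
        refine AddSubgroup.mem_sup_left (AddSubgroup.subset_closure ⟨b * b', y, ?_, ?_⟩)
        · rw [gKd_leib, hb, hb']; simp
        · rw [mul_assoc]
      · simp
      · intro x y _ _ h h'; rw [mul_add]; exact add_mem h h'
      · intro x _ h; rw [mul_neg]; exact neg_mem h
    · refine AddSubgroup.mem_sup_right ⟨gKs 𝕜 U R b * y, ?_⟩
      have : gKd v (gKs 𝕜 U R b * y) = b * gKd v y := by
        rw [gKd_leib, gKd_ks, hb, gKs_gKs]; simp
      exact this
  have he_c : ∀ j z, gM U e (gKc R j z) = gKc 𝕜 j (gM U e z) := by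
    intro j z
    induction z using TensorProduct.induction_on with
    | zero => simp
    | add a b ha hb => simp only [map_add, ha, hb]
    | tmul a p => rfl
  have main : ∀ T : Finset U, T ⊆ T₀ → ∀ r, gM U e r = 0 → gKd v r = 0 →
      (∀ j ∈ T₀, j ∉ T → gKc R j r = 0) → r ∈ N := by
    intro T
    induction T using Finset.induction_on with
    | empty =>
      intro _ r hr hdr hc
      have h1 : gTheta R T₀ r = r := gTheta_fix _ _ fun j hj => hc j hj (by simp)
      let L' : (U → 𝕜) →ₗ[𝕜] (W → 𝕜) := LinearMap.funLeft 𝕜 𝕜 f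
      have hL' : ∀ m i, L' m i = m (f i) := fun m i => rfl
      have h2 : gTheta R T₀ r = gL R L (gL R L' r) := by
        have hk : gKill 𝕜 T₀ = L.comp L' := by
          refine LinearMap.ext fun m => funext fun u => ?_
          simp only [gKill, LinearMap.coe_mk, AddHom.coe_mk, LinearMap.comp_apply, hT₀']
          split_ifs with h
          · obtain ⟨i, rfl⟩ := h
            rw [hL]; rfl
          · exact (hL0 _ _ h).symm
        rw [gTheta, hk, ← ExteriorAlgebra.map_comp_map]
        generalize r = r
        induction r using TensorProduct.induction_on with
        | zero => simp
        | add a b ha hb => simp only [map_add, ha, hb]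
        | tmul a p => rfl
      rw [h1] at h2
      have h3 := hω (gL R L' r) (by rw [gL_e, hr, map_zero])
        (by rw [gL_d_res f hf x v hvx hv0 L' hL', hdr, map_zero])
      rw [h2]
      obtain ⟨a, ha, _, ⟨b, rfl⟩, hab⟩ := Submodule.mem_sup.1 h3
      rw [← hab, map_add, ← gL_d_ext f hf x v hvx hv0 L hL]
      refine add_mem ?_ (AddSubgroup.mem_sup_right ⟨_, rfl⟩)
      refine Submodule.span_induction (p := fun a _ => gL R L a ∈ N) ?_ ?_ ?_ ?_ ha
      · rintro _ ⟨y, rfl⟩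
        refine AddSubgroup.mem_sup_left (AddSubgroup.subset_closure ⟨1, y, ?_, by simp⟩)
        rw [Algebra.TensorProduct.one_def, gKd_tmul]
        refine Finset.sum_eq_zero fun i _ => ?_
        rw [CliffordAlgebra.contractLeft_one, TensorProduct.zero_tmul]
      · simp
      · intro a b _ _ ha hb; rw [map_add]; exact add_mem ha hb
      · intro c a _ ha
        rw [map_smul, Algebra.smul_def]
        refine hNmul _ ?_ _ ha
        rw [Algebra.TensorProduct.algebraMap_apply, gKd_tmul]
        refine Finset.sum_eq_zero fun i _ => ?_
        rw [CliffordAlgebra.contractLeft_algebraMap, TensorProduct.zero_tmul]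
    | insert j T hj ih =>
      intro hT r hr hdr hc
      have hjT₀ := hT (Finset.mem_insert_self j T)
      have hT' : T ⊆ T₀ := fun _ h => hT (Finset.mem_insert_of_mem h)
      have hvj : v j = 0 := hv0 j ((hT₀' j).1 hjT₀)
      have hdu : gKd v (gU (𝕜 := 𝕜) R j) = 0 := by rw [gKd_gU, hvj]; simp
      have hdc : gKd v (gKc R j r) = 0 := by rw [gKd_kc, hdr]; simp
      have hec : gM U e (gKc R j r) = 0 := by rw [he_c, hr, map_zero]
      have h1 : gKc R j r ∈ N := by
        refine ih hT' _ hec hdc fun i hi hiT => ?_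
        by_cases hij : i = j
        · subst hij; exact gKc_self _ _
        · rw [gKc_comm, hc i hi (by simp [hij, hiT])]; simp
      have h2 : r - gU R j * gKc R j r ∈ N := by
        refine ih hT' _ ?_ ?_ fun i hi hiT => ?_
        · rw [map_sub, map_mul, hr, hec]; simp
        · rw [map_sub, gKd_leib, hdr, hdu, hdc]; simp
        · rw [map_sub, gKc_gU_mul]
          by_cases hij : i = j
          · subst hij; rw [gKc_self]; simp
          · rw [gKc_comm, hc i hi (by simp [hij, hiT])]; simp [hij]
      have := add_mem h2 (hNmul _ hdu _ h1)
      rwa [sub_add_cancel] at this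
  exact main T₀ subset_rfl r hr hdr fun j h h' => absurd h h'

theorem gConv_map {A B X : Type*} [Ring A] [Ring B] (φ : A →+* B) (f g : List X → A) (l : List X) :
    φ (gConv f g l) = gConv (fun t => φ (f t)) (fun t => φ (g t)) l := by
  rw [gConv_eq_sum, gConv_eq_sum, map_sum]
  exact Finset.sum_congr rfl fun i _ => by simp

theorem gHalf [DecidableEq U] [DecidableEq W] (f : W → U) (hf : Function.Injective f)
    (x : W → R) (hπ : Function.Surjective (MvPolynomial.aeval (R := 𝕜) x))
    (e : R →ₐ[𝕜] 𝕜) (he : ∀ i, e (x i) = 0) (σ : Finset W) (q : R →ₐ[𝕜] MvPolynomial W 𝕜)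
    (hq : ∀ i, q (x i) = if i ∈ σ then MvPolynomial.X i else 0)
    (hG : gGol x e)
    (y : U → S) (hπ' : Function.Surjective (MvPolynomial.aeval (R := 𝕜) y))
    (i₁ : R →ₐ[𝕜] S) (hi₁ : ∀ i, i₁ (x i) = y (f i))
    (r₁ : S →ₐ[𝕜] R) (hr₁ : ∀ i, r₁ (y (f i)) = x i) (hr₀ : ∀ u, (¬ ∃ i, f i = u) → r₁ (y u) = 0)
    (hxy : ∀ i ∉ σ, ∀ u, (¬ ∃ i, f i = u) → y u * y (f i) = 0)
    {Y : Type} (z : Y → ExteriorAlgebra 𝕜 (U → 𝕜) ⊗[𝕜] S)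
    (hz : ∀ t, z t ∈ gT 𝕜 U (Ideal.span ((fun i => y (f i)) '' {i | i ∉ σ})) ∧ gKd y (z t) = 0) :
    (∀ p ∈ Ideal.span ((fun i => y (f i)) '' {i | i ∉ σ}), i₁ (r₁ p) = p) ∧
    ∃ ω : List Y → ExteriorAlgebra 𝕜 (U → 𝕜) ⊗[𝕜] S, ω [] = 0 ∧ (∀ t, ω [t] = z t) ∧
      (∀ l, ω l ∈ gT 𝕜 U (Ideal.span ((fun i => y (f i)) '' {i | i ∉ σ}))) ∧
      ∀ l, gKd y (ω l) = - gConv (fun t => gKs 𝕜 U S (ω t)) ω l := by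
  classical
  obtain ⟨X, ω, hω0, hωe, hMC, hsp⟩ := hG
  set I := Ideal.span (x '' {i | i ∉ σ}) with hI
  set J := Ideal.span ((fun i => y (f i)) '' {i | i ∉ σ}) with hJ
  let v : U → R := fun u => r₁ (y u)
  have hvx : ∀ i, v (f i) = x i := hr₁
  have hv0 : ∀ u, (¬ ∃ i, f i = u) → v u = 0 := hr₀
  let L : (W → 𝕜) →ₗ[𝕜] (U → 𝕜) := Function.ExtendByZero.linearMap 𝕜 f
  have hL : ∀ m i, L m (f i) = m i := fun m i => hf.extend_apply _ _ _
  have hL0 : ∀ m u, (¬ ∃ i, f i = u) → L m u = 0 := fun m u h => Function.extend_apply' _ _ _ h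
  have hIJ : ∀ p ∈ I, i₁ p ∈ J := by
    intro p hp
    have : I ≤ J.comap i₁ := by
      rw [hI, Ideal.span_le]
      rintro _ ⟨i, hi, rfl⟩
      rw [SetLike.mem_coe, Ideal.mem_comap, hi₁]
      exact Ideal.subset_span ⟨i, hi, rfl⟩
    exact this hp
  have hJI : ∀ p ∈ J, r₁ p ∈ I := by
    intro p hp
    have : J ≤ I.comap r₁ := by
      rw [hJ, Ideal.span_le]
      rintro _ ⟨i, hi, rfl⟩
      rw [SetLike.mem_coe, Ideal.mem_comap, hr₁]
      exact Ideal.subset_span ⟨i, hi, rfl⟩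
    exact this hp
  have hJ0 : ∀ u, (¬ ∃ i, f i = u) → ∀ p ∈ J, y u * p = 0 := by
    intro u hu p hp
    refine Submodule.span_induction (p := fun p _ => y u * p = 0) ?_ (by simp) ?_ ?_ hp
    · rintro _ ⟨i, hi, rfl⟩; exact hxy i hi u hu
    · intro a b _ _ ha hb; rw [mul_add, ha, hb, add_zero]
    · intro c p _ hc; rw [smul_eq_mul, mul_left_comm, hc, mul_zero]
  have hJid : ∀ p ∈ J, i₁ (r₁ p) = p := by
    intro p hp
    refine Submodule.span_induction (p := fun p _ => i₁ (r₁ p) = p) ?_ (by simp) ?_ ?_ hp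
    · rintro _ ⟨i, hi, rfl⟩; simp only [hr₁, hi₁]
    · intro a b _ _ ha hb; simp only [map_add, ha, hb]
    · intro c p hp hc
      let A : Ideal S := LinearMap.ker (LinearMap.toSpanSingleton S S p)
      have hA : ∀ c, c ∈ A ↔ c * p = 0 := fun c => by simp [A]
      have : (Ideal.Quotient.mkₐ 𝕜 A).comp (i₁.comp r₁) = Ideal.Quotient.mkₐ 𝕜 A := by
        refine gHom_eq hπ' _ _ fun u => ?_
        simp only [AlgHom.comp_apply]
        by_cases hu : ∃ i, f i = u
        · obtain ⟨i, rfl⟩ := hu; rw [hr₁, hi₁]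
        · rw [hr₀ u hu, map_zero, map_zero]
          exact (Ideal.Quotient.eq_zero_iff_mem.2 ((hA _).2 (hJ0 u hu p hp))).symm
      have h1 := (hA _).1 ((Ideal.Quotient.eq).1 (DFunLike.congr_fun this c))
      rw [sub_mul, sub_eq_zero] at h1
      rw [smul_eq_mul, map_mul, map_mul, hc]
      exact h1
  have hρd : ∀ t, gM U r₁ (gKd y t) = gKd v (gM U r₁ t) := gM_d r₁ y v (fun _ => rfl)
  have hℓd : ∀ t ∈ gT 𝕜 U I, gKd y (gM U i₁ t) = gM U i₁ (gKd v t) := by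
    intro t ht
    refine gT_eq I ((gKd y).comp (gM U i₁).toLinearMap) ((gM U i₁).toLinearMap.comp (gKd v)) ?_ ht
    intro a p hp
    simp only [LinearMap.comp_apply, AlgHom.toLinearMap_apply, gM_tmul, gKd_tmul, map_sum]
    refine Finset.sum_congr rfl fun u _ => ?_
    by_cases hu : ∃ i, f i = u
    · obtain ⟨i, rfl⟩ := hu; rw [map_mul, hvx, hi₁]
    · rw [hJ0 u hu _ (hIJ p hp), hv0 u hu]; simp
  have hℓρ : ∀ t ∈ gT 𝕜 U J, gM U i₁ (gM U r₁ t) = t := by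
    intro t ht
    refine gT_eq J ((gM U i₁).toLinearMap.comp (gM U r₁).toLinearMap) LinearMap.id ?_ ht
    intro a p hp
    simp [gM_tmul, hJid p hp]
  have heI : ∀ p ∈ I, e p = 0 := by
    intro p hp
    have : I ≤ RingHom.ker e := by
      rw [hI, Ideal.span_le]
      rintro _ ⟨i, hi, rfl⟩
      simp [RingHom.mem_ker, he]
    exact this hp
  obtain ⟨ω', h0, h1, h2, h3⟩ := gExt (gKd (𝕜 := 𝕜) v).toAddMonoidHom (gKs 𝕜 U R).toRingHom
    (gKd_leib v) (gKd_gKd v) (gKd_ks v) gKs_gKs (fun l => gL R L (ω l)) (by simp [hω0])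
    (by
      intro l
      have e1 := gL_d_ext f hf x v hvx hv0 L hL (ω l)
      rw [hMC, map_neg] at e1
      refine e1.trans (congrArg _ ?_)
      refine (gConv_map (gL R L).toRingHom _ _ l).trans ?_
      congr 1
      funext t
      exact gL_s L _)
    (RingHom.ker (gM U e)).toAddSubgroup
    (fun b a ha => Ideal.mul_mem_left _ b ha)
    (fun b a ha => by
      have ha' : gM U e a = 0 := ha
      change gM U e (a * b) = 0
      rw [map_mul, ha', zero_mul])
    (fun l => by
      change gM U e (gL R L (ω l)) = 0
      rw [gL_e, hωe, map_zero])
    (fun r hr hdr => gL3 f hf x v hvx hv0 e ω hsp L hL hL0 r hr hdr)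
    (gT 𝕜 U I).toAddSubgroup
    (fun t ht => gT_kill I e heI ht)
    (fun b a ha => gT_mul_left I b ha)
    (fun r hr hdr => gL2 f hf x v hvx hv0 hπ σ q hq e he r hr hdr)
    (fun t => gM U r₁ (z t))
    (fun t => ⟨gT_map J I r₁ hJI (hz t).1, by
      change gKd v (gM U r₁ (z t)) = 0
      rw [← hρd, (hz t).2, map_zero]⟩)
  refine ⟨hJid, fun l => gM U i₁ (ω' l), by simp [h0], fun t => ?_, fun l => gT_map I J i₁ hIJ (h2 l),
    fun l => ?_⟩
  · simp only [h1]; exact hℓρ _ (hz t).1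
  · simp only
    rw [hℓd _ (h2 l)]
    have e1 : gKd v (ω' l) = - gConv (fun t => gKs 𝕜 U R (ω' t)) ω' l := h3 l
    rw [e1, map_neg]
    refine congrArg _ ((gConv_map (gM U i₁).toRingHom _ _ l).trans ?_)
    congr 1
    funext t
    exact gM_s i₁ _

end HalfSec

section FaceSec
set_option linter.unusedSectionVars false
open scoped TensorProduct
open SimComplex
variable {V : Type} [Fintype V] {𝕜 : Type} [Field 𝕜]

/-- The generators of the face ring. -/
noncomputable def gx (𝕜 : Type) [Field 𝕜] (K : SimComplex V) (i : K.VertexType) : K.FaceRing 𝕜 :=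
  Ideal.Quotient.mk (K.faceIdeal 𝕜) (MvPolynomial.X i)

theorem gx_surj (K : SimComplex V) :
    Function.Surjective (MvPolynomial.aeval (R := 𝕜) (gx 𝕜 K)) := by
  have : MvPolynomial.aeval (R := 𝕜) (gx 𝕜 K) = Ideal.Quotient.mkₐ 𝕜 (K.faceIdeal 𝕜) := by
    ext i; simp [gx]
  rw [this]
  exact Ideal.Quotient.mkₐ_surjective _ _

theorem gx_prod (K : SimComplex V) (s : Finset K.VertexType) (hs : s.Nonempty)
    (h : s.map (Function.Embedding.subtype _) ∉ K.faces) : ∏ i ∈ s, gx 𝕜 K i = 0 := by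
  simp only [gx]
  rw [← map_prod]
  exact Ideal.Quotient.eq_zero_iff_mem.2 (Ideal.subset_span ⟨s, ⟨hs, h⟩, rfl⟩)

theorem gLift (K : SimComplex V) {A : Type} [CommRing A] [Algebra 𝕜 A] (g : K.VertexType → A)
    (h : ∀ s : Finset K.VertexType, s.Nonempty → s.map (Function.Embedding.subtype _) ∉ K.faces →
      ∏ i ∈ s, g i = 0) : ∃ φ : K.FaceRing 𝕜 →ₐ[𝕜] A, ∀ i, φ (gx 𝕜 K i) = g i := by
  have h' : ∀ a ∈ K.faceIdeal 𝕜, MvPolynomial.aeval (R := 𝕜) g a = 0 := by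
    intro a ha
    have : K.faceIdeal 𝕜 ≤ RingHom.ker (MvPolynomial.aeval (R := 𝕜) g) := by
      refine Ideal.span_le.2 ?_
      rintro _ ⟨s, ⟨h1, h2⟩, rfl⟩
      rw [SetLike.mem_coe, RingHom.mem_ker, map_prod]
      simp only [MvPolynomial.aeval_X]
      exact h s h1 h2
    exact this ha
  refine ⟨Ideal.Quotient.liftₐ (K.faceIdeal 𝕜) (MvPolynomial.aeval g) h', fun i => ?_⟩
  have : MvPolynomial.aeval (R := 𝕜) g (MvPolynomial.X i) = g i := MvPolynomial.aeval_X _ _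
  exact this

theorem gq (K : SimComplex V) [DecidableEq K.VertexType] (τ : Finset K.VertexType)
    (hτ : ∀ s : Finset K.VertexType, s.Nonempty → s ⊆ τ →
      s.map (Function.Embedding.subtype _) ∈ K.faces) :
    ∃ q : K.FaceRing 𝕜 →ₐ[𝕜] MvPolynomial K.VertexType 𝕜,
      ∀ i, q (gx 𝕜 K i) = if i ∈ τ then MvPolynomial.X i else 0 := by
  refine gLift K _ fun s hs h => ?_
  have : ¬ s ⊆ τ := fun hh => h (hτ s hs hh)
  obtain ⟨i, hi, hiτ⟩ := Finset.not_subset.1 this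
  exact Finset.prod_eq_zero hi (by simp [hiτ])

/-- The augmentation of the face ring. -/
noncomputable def ge (𝕜 : Type) [Field 𝕜] (K : SimComplex V) : K.FaceRing 𝕜 →ₐ[𝕜] 𝕜 :=
  (K.koszulAug 𝕜).comp Algebra.TensorProduct.includeRight

theorem gAug_tmul (K : SimComplex V) (a : ExteriorAlgebra 𝕜 (K.VertexType → 𝕜))
    (p : K.FaceRing 𝕜) : K.koszulAug 𝕜 (a ⊗ₜ[𝕜] p) = K.koszulAug 𝕜 (a ⊗ₜ[𝕜] 1) * ge 𝕜 K p := by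
  rw [ge, AlgHom.comp_apply, Algebra.TensorProduct.includeRight_apply, ← map_mul]; simp

theorem ge_gx (K : SimComplex V) (i : K.VertexType) : ge 𝕜 K (gx 𝕜 K i) = 0 := by
  have h : MvPolynomial.aeval (R := 𝕜) (fun _ : K.VertexType => (0 : 𝕜)) (MvPolynomial.X i) = 0 :=
    MvPolynomial.aeval_X _ _
  rw [ge, AlgHom.comp_apply, Algebra.TensorProduct.includeRight_apply, koszulAug,
    Algebra.TensorProduct.lift_tmul, map_one, one_mul]
  exact h

theorem gAug_iota (K : SimComplex V) (m : K.VertexType → 𝕜) :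
    K.koszulAug 𝕜 (ExteriorAlgebra.ι 𝕜 m ⊗ₜ[𝕜] 1) = 0 := by
  rw [koszulAug, Algebra.TensorProduct.lift_tmul, map_one, mul_one]
  have := CliffordAlgebra.lift_ι_apply (Q := (0 : QuadraticForm 𝕜 (K.VertexType → 𝕜)))
    (0 : (K.VertexType → 𝕜) →ₗ[𝕜] 𝕜) (fun m => by simp) m
  exact this

theorem gD_eq (K : SimComplex V) : K.koszulD 𝕜 = gKd (gx 𝕜 K) := rfl

theorem gBar_eq (K : SimComplex V) (z : K.KoszulCx 𝕜) :
    K.koszulBar 𝕜 z = - gKs 𝕜 _ (K.FaceRing 𝕜) z := rfl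

theorem gNeg_mul' {U R : Type} [CommRing R] [Algebra 𝕜 R]
    (a b : ExteriorAlgebra 𝕜 (U → 𝕜) ⊗[𝕜] R) : (-a) * b = - (a * b) := by
  refine eq_neg_of_add_eq_zero_left ?_
  rw [← add_mul, neg_add_cancel, zero_mul]

theorem gNeg_mul (K : SimComplex V) (a b : K.KoszulCx 𝕜) : (-a) * b = - (a * b) :=
  gNeg_mul' a b

theorem gc_exists (K : SimComplex V) (i : K.VertexType) : ∃ c : K.FaceRing 𝕜 →ₗ[𝕜] 𝕜,
    (∀ p p', c (p * p') = ge 𝕜 K p * c p' + c p * ge 𝕜 K p') ∧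
    ∀ j, c (gx 𝕜 K j) = (by classical exact if j = i then 1 else 0) := by
  classical
  obtain ⟨q, hq⟩ := gq (𝕜 := 𝕜) K {i} (by
    intro s hs hsi
    have : s = {i} := by
      rcases Finset.subset_singleton_iff.1 hsi with h | h
      · exact absurd h hs.ne_empty
      · exact h
    rw [this, Finset.map_singleton]
    exact i.2)
  let c0 : MvPolynomial K.VertexType 𝕜 →ₐ[𝕜] 𝕜 := MvPolynomial.aeval fun _ => 0
  have hce : c0.comp q = ge 𝕜 K := by
    refine gHom_eq (gx_surj K) _ _ fun j => ?_
    rw [AlgHom.comp_apply, hq, ge_gx]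
    split_ifs <;> simp [c0]
  have hce' : ∀ p, c0 (q p) = ge 𝕜 K p := fun p => DFunLike.congr_fun hce p
  refine ⟨c0.toLinearMap.comp ((MvPolynomial.pderiv i).toLinearMap.comp q.toLinearMap), ?_, ?_⟩
  · intro p p'
    simp only [LinearMap.comp_apply, AlgHom.toLinearMap_apply,
      Derivation.coeFn_coe, map_mul, Derivation.leibniz, map_add, smul_eq_mul, hce']
    ring
  · intro j
    simp only [LinearMap.comp_apply, AlgHom.toLinearMap_apply,
      Derivation.coeFn_coe, hq]
    by_cases h : j = i
    · subst h; simp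
    · simp [h]

/-- Elements with decomposable differential lie in the maximal ideal. -/
theorem gVan (K : SimComplex V) (z : K.KoszulCx 𝕜) (hz : K.koszulAug 𝕜 z = 0)
    {ι : Type*} (t : Finset ι) (a b : ι → K.KoszulCx 𝕜)
    (ha : ∀ i ∈ t, gM K.VertexType (ge 𝕜 K) (a i) = 0)
    (hb : ∀ i ∈ t, gM K.VertexType (ge 𝕜 K) (b i) = 0)
    (hd : gKd (gx 𝕜 K) z = ∑ i ∈ t, a i * b i) : gM K.VertexType (ge 𝕜 K) z = 0 := by
  choose c hc1 hc2 using gc_exists (𝕜 := 𝕜) K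
  refine gL1 (gx 𝕜 K) (ge 𝕜 K) c (K.koszulAug 𝕜) (gAug_iota K) (fun p => rfl) ?_ z hz ?_
  · intro i j p
    rw [hc1, hc2, ge_gx]
    by_cases h : j = i <;> simp [h]
  · intro i
    rw [hd, map_sum]
    exact Finset.sum_eq_zero fun k hk => gC_mul (ge 𝕜 K) (c i) (hc1 i) _ _ (ha k hk) (hb k hk)

theorem gT_aug (K : SimComplex V) (I : Ideal (K.FaceRing 𝕜)) (hI : ∀ p ∈ I, ge 𝕜 K p = 0)
    {z : K.KoszulCx 𝕜} (hz : z ∈ gT 𝕜 K.VertexType I) : K.koszulAug 𝕜 z = 0 := by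
  refine gT_eq I (K.koszulAug 𝕜).toLinearMap 0 (fun a p hp => ?_) hz
  rw [AlgHom.toLinearMap_apply, gAug_tmul, hI p hp, mul_zero]; rfl

theorem gGol_of (K : SimComplex V) (h : K.IsGolod 𝕜) : gGol (gx 𝕜 K) (ge 𝕜 K) := by
  classical
  obtain ⟨Z, μ, hZ, hsp, hμ1, hμ⟩ := h
  let ω : List Z → K.KoszulCx 𝕜 := fun l => if l = [] then 0 else μ (l.map Subtype.val)
  have hω0 : ω [] = 0 := by simp [ω]
  have hω1 : ∀ z, ω [z] = z.1 := fun z => by simp [ω, hμ1 z.1 z.2]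
  have hMC : ∀ l, gKd (gx 𝕜 K) (ω l) = - gConv (fun t => gKs 𝕜 _ (K.FaceRing 𝕜) (ω t)) ω l := by
    intro l
    rcases l with _ | ⟨z, _ | ⟨z', l⟩⟩
    · simp [gConv, hω0]
    · rw [hω1]
      have : gKd (gx 𝕜 K) z.1 = 0 := (hZ z.1 z.2).1
      simp [gConv, hω0, this]
    · set L := z :: z' :: l with hL
      have hne : L ≠ [] := by simp [hL]
      have h1 := (hμ (L.map Subtype.val) (by simp [hL]) (by
        intro a ha
        obtain ⟨b, -, rfl⟩ := List.mem_map.1 ha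
        exact b.2)).2
      have h2 : ω L = μ (L.map Subtype.val) := by simp [ω, hne]
      rw [h2, ← gD_eq, h1, gConv_eq_sum, List.length_map, ← Finset.sum_neg_distrib]
      have hsub : Finset.Ioo 0 L.length ⊆ Finset.range (L.length + 1) := by
        intro i; simp; omega
      symm
      rw [← Finset.sum_subset hsub]
      · refine Finset.sum_congr rfl fun j hj => ?_
        rw [Finset.mem_Ioo] at hj
        have e1 : L.take j ≠ [] := by
          intro h; have := congrArg List.length h; simp at this; omega
        have e2 : L.drop j ≠ [] := by
          intro h; have := congrArg List.length h; simp at this; omega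
        simp only [ω, e1, e2, if_false, List.map_take, List.map_drop, gBar_eq, smul_eq_mul]
        exact (gNeg_mul K _ _).symm
      · intro j hj hj'
        have : j = 0 ∨ j = L.length := by
          simp at hj hj'; omega
        rcases this with rfl | rfl <;> simp [hω0]
  have hcyc : ∀ z : K.KoszulCx 𝕜, gKd (gx 𝕜 K) z = 0 → K.koszulAug 𝕜 z = 0 →
      gM K.VertexType (ge 𝕜 K) z = 0 := fun z h1 h2 =>
    gVan K z h2 (∅ : Finset ℕ) (fun _ => 0) (fun _ => 0) (by simp) (by simp) (by simp [h1])
  have haug : ∀ l, K.koszulAug 𝕜 (ω l) = 0 := by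
    intro l
    rcases l with _ | ⟨z, _ | ⟨z', l⟩⟩
    · rw [hω0, map_zero]
    · rw [hω1]; exact (hZ z.1 z.2).2
    · exact (hμ ((z :: z' :: l).map Subtype.val) (by simp) (by
        intro a ha
        obtain ⟨b, -, rfl⟩ := List.mem_map.1 ha
        exact b.2)).1
  refine ⟨Z, ω, hω0, ?_, hMC, ?_⟩
  · intro l
    induction hn : l.length using Nat.strong_induction_on generalizing l with
    | _ n ih =>
      subst hn
      have hM := hMC l
      by_cases hl : l = []
      · rw [hl, hω0, map_zero]
      refine gVan K (ω l) (haug l) (Finset.Ioo 0 l.length)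
        (fun j => - gKs 𝕜 _ (K.FaceRing 𝕜) (ω (l.take j))) (fun j => ω (l.drop j)) ?_ ?_ ?_
      · intro j hj
        rw [Finset.mem_Ioo] at hj
        rw [map_neg, gM_s, ih (l.take j).length (by simp; omega) _ rfl]; simp
      · intro j hj
        rw [Finset.mem_Ioo] at hj
        exact ih (l.drop j).length (by simp; omega) _ rfl
      · rw [hM, gConv_eq_sum, ← Finset.sum_neg_distrib]
        have hsub : Finset.Ioo 0 l.length ⊆ Finset.range (l.length + 1) := by
          intro i; simp; omega
        symm
        rw [← Finset.sum_subset hsub]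
        · refine Finset.sum_congr rfl fun j hj => ?_
          exact gNeg_mul K _ _
        · intro j hj hj'
          have : j = 0 ∨ j = l.length := by
            simp at hj hj'; omega
          rcases this with rfl | rfl <;> simp [hω0]
  · intro r hr hdr
    have ha : K.koszulAug 𝕜 r = 0 := by
      have : ∀ r : K.KoszulCx 𝕜, K.koszulAug 𝕜 r =
          TensorProduct.lift ((LinearMap.mul 𝕜 𝕜).comp ((K.koszulAug 𝕜).comp
            Algebra.TensorProduct.includeLeft).toLinearMap) (gM K.VertexType (ge 𝕜 K) r) := by
        intro r
        induction r using TensorProduct.induction_on with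
        | zero => simp
        | add a b ha hb => simp only [map_add, ha, hb]
        | tmul a p => rw [gAug_tmul, gM_tmul]; rfl
      rw [this, hr, map_zero]
    have := hsp r hdr ha
    have hrg : Set.range (fun y => ω [y]) = Z := by
      ext z; simp [hω1]
    rw [hrg]; exact this

theorem gGolod_of (K : SimComplex V) {Y : Type} (ω : List Y → K.KoszulCx 𝕜) (hω0 : ω [] = 0)
    (haug : ∀ l, K.koszulAug 𝕜 (ω l) = 0)
    (hMC : ∀ l, gKd (gx 𝕜 K) (ω l) = - gConv (fun t => gKs 𝕜 _ (K.FaceRing 𝕜) (ω t)) ω l)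
    (hsp : ∀ r : K.KoszulCx 𝕜, gKd (gx 𝕜 K) r = 0 → K.koszulAug 𝕜 r = 0 →
      r ∈ Submodule.span 𝕜 (Set.range fun y => ω [y]) ⊔ LinearMap.range (gKd (gx 𝕜 K))) :
    K.IsGolod 𝕜 := by
  classical
  by_cases hY : Nonempty Y
  · let pick : K.KoszulCx 𝕜 → Y := fun z => if h : ∃ y, ω [y] = z then h.choose else hY.some
    have hp : ∀ z ∈ Set.range (fun y => ω [y]), ω [pick z] = z := by
      intro z hz
      have hz' : ∃ y, ω [y] = z := hz
      simp only [pick, dif_pos hz']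
      exact hz'.choose_spec
    refine ⟨Set.range fun y => ω [y], fun l => ω (l.map pick), ?_, hsp, ?_, ?_⟩
    · rintro _ ⟨y, rfl⟩
      refine ⟨?_, haug _⟩
      have := hMC [y]
      rw [gD_eq]; simp only
      rw [this]; simp [gConv, hω0]
    · intro z hz; simpa using hp z hz
    · intro l hl hlZ
      refine ⟨haug _, ?_⟩
      rw [gD_eq, hMC, gConv_eq_sum, List.length_map, ← Finset.sum_neg_distrib]
      have hsub : Finset.Ioo 0 l.length ⊆ Finset.range (l.length + 1) := by
        intro i; simp; omega
      symm
      refine (Finset.sum_congr rfl fun j hj => ?_).trans (Finset.sum_subset hsub ?_)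
      · simp only [gBar_eq, List.map_take, List.map_drop, smul_eq_mul]
        exact gNeg_mul K _ _
      · intro j hj hj'
        have : j = 0 ∨ j = l.length := by
          simp at hj hj'; omega
        rcases this with rfl | rfl
        · simp [hω0]
        · rw [List.drop_eq_nil_of_le (by simp), hω0]; simp
  · refine ⟨∅, fun _ => 0, by simp, ?_, by simp, ?_⟩
    · intro r hr ha
      have := hsp r hr ha
      have h0 : Set.range (fun y => ω [y]) = ∅ := by
        rw [not_nonempty_iff] at hY; exact Set.range_eq_empty _
      rw [h0] at this; exact this
    · intro l hl h
      rcases l with _ | ⟨z, l⟩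
      · simp at hl
      · exact absurd (h z (by simp)) (by simp)

end FaceSec

section FinSec
set_option linter.unusedSectionVars false
open scoped TensorProduct
open SimComplex

theorem gSumMC {𝕜 : Type} [Field 𝕜] {U : Type} [Fintype U] {R : Type} [CommRing R] [Algebra 𝕜 R]
    (v : U → R) (I J : Ideal R) (hIJ : ∀ p ∈ I, ∀ q ∈ J, p * q = 0) {Y : Type}
    (ω ω' : List Y → ExteriorAlgebra 𝕜 (U → 𝕜) ⊗[𝕜] R)
    (h : ∀ l, ω l ∈ gT 𝕜 U I) (h' : ∀ l, ω' l ∈ gT 𝕜 U J)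
    (hMC : ∀ l, gKd v (ω l) = - gConv (fun t => gKs 𝕜 U R (ω t)) ω l)
    (hMC' : ∀ l, gKd v (ω' l) = - gConv (fun t => gKs 𝕜 U R (ω' t)) ω' l) (l : List Y) :
    gKd v (ω l + ω' l) =
      - gConv (fun t => gKs 𝕜 U R (ω t + ω' t)) (fun t => ω t + ω' t) l := by
  have hs : ∀ (I : Ideal R) (z : ExteriorAlgebra 𝕜 (U → 𝕜) ⊗[𝕜] R), z ∈ gT 𝕜 U I →
      gKs 𝕜 U R z ∈ gT 𝕜 U I := by
    intro I z hz
    refine gT_le I ((gT 𝕜 U I).comap (gKs 𝕜 U R).toLinearMap) (fun a p hp => ?_) hz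
    exact gT_tmul _ _ hp
  rw [map_add, hMC, hMC', gConv_eq_sum, gConv_eq_sum, gConv_eq_sum, ← neg_add,
    ← Finset.sum_add_distrib]
  refine congrArg _ (Finset.sum_congr rfl fun j _ => ?_)
  have e1 : gKs 𝕜 U R (ω (l.take j)) * ω' (l.drop j) = 0 :=
    gT_mul_zero I J hIJ (hs I _ (h _)) (h' _)
  have e2 : gKs 𝕜 U R (ω' (l.take j)) * ω (l.drop j) = 0 :=
    gT_mul_zero J I (fun p hp q hq => by rw [mul_comm]; exact hIJ q hq p hp) (hs J _ (h' _)) (h _)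
  simp only [map_add, smul_eq_mul, add_mul, mul_add, e1, e2]
  abel

theorem gSplit {𝕜 : Type} [Field 𝕜] {U : Type} [Fintype U] {R : Type} [CommRing R] [Algebra 𝕜 R]
    (v : U → R) (I J : Ideal R) (φ : R →ₐ[𝕜] R) (hI : ∀ p ∈ I, φ p = p) (hJ : ∀ p ∈ J, φ p = 0)
    (a b : ExteriorAlgebra 𝕜 (U → 𝕜) ⊗[𝕜] R) (ha : a ∈ gT 𝕜 U I) (hb : b ∈ gT 𝕜 U J)
    (h : gKd v (a + b) = 0) : gKd v a = 0 ∧ gKd v b = 0 := by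
  rw [map_add] at h
  have h1 : gM U φ (gKd v a) = gKd v a := by
    refine gT_eq I (gM U φ).toLinearMap LinearMap.id (fun a p hp => ?_) (gT_d I v ha)
    simp [gM_tmul, hI p hp]
  have h2 : gM U φ (gKd v b) = 0 := gT_kill J φ hJ (gT_d J v hb)
  have h3 := congrArg (gM U φ) h
  rw [map_add, h1, h2, add_zero, map_zero] at h3
  refine ⟨h3, ?_⟩
  rwa [h3, zero_add] at h

variable {V : Type} [Fintype V] {𝕜 : Type} [Field 𝕜]

/-- The ideal of vertices of `L` outside `σ`. -/
noncomputable def gJ (𝕜 : Type) [Field 𝕜] (K L : SimComplex V) (σ : Finset V) :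
    Ideal (K.FaceRing 𝕜) :=
  Ideal.span (gx 𝕜 K '' {u | {u.1} ∈ L.faces ∧ u.1 ∉ σ})

theorem gHalfK (K L : SimComplex V) (hLK : L.faces ⊆ K.faces)
    (hfull : ∀ s ∈ K.faces, (∀ v ∈ s, {v} ∈ L.faces) → s ∈ L.faces)
    (σ : Finset V) (hσ : σ ∈ L.faces) (hG : L.IsGolod 𝕜)
    (hsep : ∀ i j : K.VertexType, {i.1} ∈ L.faces → i.1 ∉ σ → {j.1} ∉ L.faces →
      gx 𝕜 K j * gx 𝕜 K i = 0)
    {Y : Type} (z : Y → K.KoszulCx 𝕜)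
    (hz : ∀ t, z t ∈ gT 𝕜 K.VertexType (gJ 𝕜 K L σ) ∧ gKd (gx 𝕜 K) (z t) = 0) :
    (∃ φ : K.FaceRing 𝕜 →ₐ[𝕜] K.FaceRing 𝕜, (∀ p ∈ gJ 𝕜 K L σ, φ p = p) ∧
      ∀ u : K.VertexType, {u.1} ∉ L.faces → φ (gx 𝕜 K u) = 0) ∧
    ∃ ω : List Y → K.KoszulCx 𝕜, ω [] = 0 ∧ (∀ t, ω [t] = z t) ∧
      (∀ l, ω l ∈ gT 𝕜 K.VertexType (gJ 𝕜 K L σ)) ∧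
      ∀ l, gKd (gx 𝕜 K) (ω l) = - gConv (fun t => gKs 𝕜 _ (K.FaceRing 𝕜) (ω t)) ω l := by
  classical
  let f : L.VertexType ↪ K.VertexType :=
    ⟨fun i => ⟨i.1, hLK i.2⟩, fun i j h => Subtype.ext (congrArg (fun t => t.1) h)⟩
  have hfr : ∀ u : K.VertexType, (∃ i, f i = u) ↔ {u.1} ∈ L.faces := by
    intro u
    constructor
    · rintro ⟨i, rfl⟩; exact i.2
    · intro h; exact ⟨⟨u.1, h⟩, rfl⟩
  have hmap : ∀ s : Finset L.VertexType, (s.map f).map (Function.Embedding.subtype _) =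
      s.map (Function.Embedding.subtype _) := by
    intro s; rw [Finset.map_map]; rfl
  let τ : Finset L.VertexType := Finset.univ.filter fun i => i.1 ∈ σ
  obtain ⟨q, hq⟩ := gq (𝕜 := 𝕜) L τ (by
    intro s hs hsτ
    refine L.down_closed hσ ?_ (by simpa using hs)
    intro v hv
    obtain ⟨i, hi, rfl⟩ := Finset.mem_map.1 hv
    have := hsτ hi
    simp only [τ, Finset.mem_filter] at this
    exact this.2)
  obtain ⟨i₁, hi₁⟩ := gLift (𝕜 := 𝕜) L (fun i => gx 𝕜 K (f i)) (by
    intro s hs hns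
    rw [← Finset.prod_map s f]
    refine gx_prod K _ (by simpa using hs) ?_
    rw [hmap]
    intro h
    refine hns (hfull _ h ?_)
    intro v hv
    obtain ⟨i, hi, rfl⟩ := Finset.mem_map.1 hv
    exact i.2)
  obtain ⟨r₁, hr₁⟩ := gLift (𝕜 := 𝕜) K
    (fun u => if h : {u.1} ∈ L.faces then gx 𝕜 L ⟨u.1, h⟩ else 0) (by
    intro s hs hns
    by_cases hall : ∀ u ∈ s, {u.1} ∈ L.faces
    · have hst : s = (Finset.univ.filter fun i => f i ∈ s).map f := by
        ext u
        simp only [Finset.mem_map, Finset.mem_filter, Finset.mem_univ, true_and]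
        constructor
        · intro hu
          obtain ⟨i, hi⟩ := (hfr u).2 (hall u hu)
          exact ⟨i, by rwa [hi], hi⟩
        · rintro ⟨i, hi, rfl⟩; exact hi
      set t := Finset.univ.filter fun i => f i ∈ s with ht
      rw [hst, Finset.prod_map]
      have : ∀ i ∈ t, (if h : {(f i).1} ∈ L.faces then gx 𝕜 L ⟨(f i).1, h⟩ else 0) = gx 𝕜 L i := by
        intro i _
        have : {(f i).1} ∈ L.faces := i.2
        rw [dif_pos this]; rfl
      rw [Finset.prod_congr rfl this]
      refine gx_prod L t ?_ ?_
      · rw [hst] at hs; simpa using hs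
      · intro h
        rw [← hmap, ← hst] at h
        exact hns (hLK h)
    · push Not at hall
      obtain ⟨u, hu, hun⟩ := hall
      exact Finset.prod_eq_zero hu (dif_neg hun))
  have hJ : Ideal.span ((fun i => gx 𝕜 K (f i)) '' {i | i ∉ τ}) = gJ 𝕜 K L σ := by
    rw [gJ]
    congr 1
    ext p
    constructor
    · rintro ⟨i, hi, rfl⟩
      refine ⟨f i, ⟨i.2, ?_⟩, rfl⟩
      have hi2 : i.1 ∉ σ := by simpa [τ] using hi
      exact hi2
    · rintro ⟨u, ⟨hu, hus⟩, rfl⟩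
      refine ⟨⟨u.1, hu⟩, ?_, rfl⟩
      simpa [τ] using hus
  have hr0 : ∀ u : K.VertexType, {u.1} ∉ L.faces → r₁ (gx 𝕜 K u) = 0 := by
    intro u hu; rw [hr₁, dif_neg hu]
  obtain ⟨hid, H⟩ := gHalf f f.injective (gx 𝕜 L) (gx_surj L) (ge 𝕜 L) (ge_gx L) τ q hq
    (gGol_of L hG)
    (gx 𝕜 K) (gx_surj K) i₁ hi₁ r₁
    (fun i => by
      have : {(f i).1} ∈ L.faces := i.2
      rw [hr₁, dif_pos this]; rfl)
    (fun u hu => hr0 u (fun h => hu ((hfr u).2 h)))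
    (fun i hi u hu => hsep (f i) u i.2 (show i.1 ∉ σ by simpa [τ] using hi) (fun h => hu ((hfr u).2 h)))
    z (by rw [hJ]; exact hz)
  rw [hJ] at hid H
  refine ⟨⟨i₁.comp r₁, hid, ?_⟩, H⟩
  intro u hu
  rw [AlgHom.comp_apply, hr0 u hu, map_zero]

theorem gMain (K L₁ L₂ : SimComplex V) (hK : K.faces = L₁.faces ∪ L₂.faces)
    (σ : Finset V) (hσ₁ : σ ∈ L₁.faces) (hσ₂ : σ ∈ L₂.faces)
    (hv : ∀ v, {v} ∈ L₁.faces → {v} ∈ L₂.faces → v ∈ σ)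
    (h₁ : L₁.IsGolod 𝕜) (h₂ : L₂.IsGolod 𝕜) : K.IsGolod 𝕜 := by
  classical
  have hσv₁ : ∀ v ∈ σ, {v} ∈ L₁.faces := fun v hv =>
    L₁.down_closed hσ₁ (by simpa using hv) (by simp)
  have hσv₂ : ∀ v ∈ σ, {v} ∈ L₂.faces := fun v hv =>
    L₂.down_closed hσ₂ (by simpa using hv) (by simp)
  have hvK : ∀ u : K.VertexType, {u.1} ∈ L₁.faces ∨ {u.1} ∈ L₂.faces := by
    intro u; have h : ({u.1} : Finset V) ∈ L₁.faces ∪ L₂.faces := hK.subset u.2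
    exact h
  have hne : ∀ (M : SimComplex V) (s : Finset V), s ∈ M.faces → s.Nonempty := by
    intro M s hs
    rw [Finset.nonempty_iff_ne_empty]; rintro rfl; exact M.not_empty_mem hs
  have hsing : ∀ (M : SimComplex V) (s : Finset V), s ∈ M.faces → ∀ v ∈ s, {v} ∈ M.faces :=
    fun M s hs v hv => M.down_closed hs (by simpa using hv) (by simp)
  -- products vanish
  have hzero : ∀ i j : K.VertexType, i.1 ∉ σ → j.1 ∉ σ → {i.1} ∈ L₁.faces → {j.1} ∈ L₂.faces →
      gx 𝕜 K i * gx 𝕜 K j = 0 := by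
    intro i j hi hj hi₁ hj₂
    have hij : i ≠ j := by rintro rfl; exact hi (hv _ hi₁ hj₂)
    rw [← Finset.prod_pair hij]
    refine gx_prod K _ (by simp) ?_
    intro hmem
    rcases hK.subset hmem with h | h
    · have := hsing L₁ _ h j.1 (by simp)
      exact hj (hv _ this hj₂)
    · have := hsing L₂ _ h i.1 (by simp)
      exact hi (hv _ hi₁ this)
  let I₁ := gJ 𝕜 K L₁ σ
  let I₂ := gJ 𝕜 K L₂ σ
  have hprod : ∀ p ∈ I₁, ∀ q ∈ I₂, p * q = 0 := by
    intro p hp q hq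
    refine Submodule.span_induction (p := fun p _ => p * q = 0) ?_ (by simp) ?_ ?_ hp
    · rintro _ ⟨i, ⟨hi, hi'⟩, rfl⟩
      refine Submodule.span_induction (p := fun q _ => gx 𝕜 K i * q = 0) ?_ (by simp) ?_ ?_ hq
      · rintro _ ⟨j, ⟨hj, hj'⟩, rfl⟩; exact hzero i j hi' hj' hi hj
      · intro a b _ _ ha hb; rw [mul_add, ha, hb, add_zero]
      · intro c a _ ha; rw [smul_eq_mul, mul_left_comm, ha, mul_zero]
    · intro a b _ _ ha hb; rw [add_mul, ha, hb, add_zero]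
    · intro c a _ ha; rw [smul_eq_mul, mul_assoc, ha, mul_zero]
  have hle₁ : L₁.faces ⊆ K.faces := by rw [hK]; exact Set.subset_union_left
  have hle₂ : L₂.faces ⊆ K.faces := by rw [hK]; exact Set.subset_union_right
  have hfull₁ : ∀ s ∈ K.faces, (∀ v ∈ s, {v} ∈ L₁.faces) → s ∈ L₁.faces := by
    intro s hs hall
    rw [hK] at hs
    rcases hs with h | h
    · exact h
    · exact L₁.down_closed hσ₁ (fun v hvs => hv v (hall v hvs) (hsing L₂ s h v hvs)) (hne _ _ h)
  have hfull₂ : ∀ s ∈ K.faces, (∀ v ∈ s, {v} ∈ L₂.faces) → s ∈ L₂.faces := by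
    intro s hs hall
    rw [hK] at hs
    rcases hs with h | h
    · exact L₂.down_closed hσ₂ (fun v hvs => hv v (hsing L₁ s h v hvs) (hall v hvs)) (hne _ _ h)
    · exact h
  let Y := {t : K.KoszulCx 𝕜 × K.KoszulCx 𝕜 //
    (t.1 ∈ gT 𝕜 K.VertexType I₁ ∧ gKd (gx 𝕜 K) t.1 = 0) ∧
    (t.2 ∈ gT 𝕜 K.VertexType I₂ ∧ gKd (gx 𝕜 K) t.2 = 0)}
  obtain ⟨⟨φ, hφ1, hφ0⟩, ω₁, h10, h11, h1m, h1d⟩ := gHalfK K L₁ hle₁ hfull₁ σ hσ₁ h₁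
    (by
      intro i j hi hi' hj
      rw [mul_comm]
      exact hzero i j hi' (fun h => hj (hσv₁ _ h)) hi ((hvK j).resolve_left hj))
    (fun t : Y => t.1.1) (fun t => t.2.1)
  obtain ⟨-, ω₂, h20, h21, h2m, h2d⟩ := gHalfK K L₂ hle₂ hfull₂ σ hσ₂ h₂
    (by
      intro i j hi hi' hj
      exact hzero j i (fun h => hj (hσv₂ _ h)) hi' ((hvK j).resolve_right hj) hi)
    (fun t : Y => t.1.2) (fun t => t.2.2)
  have hφ2 : ∀ p ∈ I₂, φ p = 0 := by
    intro p hp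
    have : I₂ ≤ RingHom.ker φ := by
      refine Ideal.span_le.2 ?_
      rintro _ ⟨u, ⟨hu, hu'⟩, rfl⟩
      exact hφ0 u fun h => hu' (hv _ h hu)
    exact this hp
  have heJ : ∀ L : SimComplex V, ∀ p ∈ gJ 𝕜 K L σ, ge 𝕜 K p = 0 := by
    intro L p hp
    have : gJ 𝕜 K L σ ≤ RingHom.ker (ge 𝕜 K) := by
      refine Ideal.span_le.2 ?_
      rintro _ ⟨u, -, rfl⟩
      exact ge_gx K u
    exact this hp
  refine gGolod_of K (fun l => ω₁ l + ω₂ l) ?_ ?_ (gSumMC (gx 𝕜 K) I₁ I₂ hprod ω₁ ω₂ h1m h2m h1d h2d)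
    ?_
  · simp only [h10, h20]; exact add_zero _
  · intro l
    rw [map_add, gT_aug K _ (heJ L₁) (h1m l), gT_aug K _ (heJ L₂) (h2m l), add_zero]
  · intro r hdr har
    have hr : gM K.VertexType (ge 𝕜 K) r = 0 :=
      gVan K r har (∅ : Finset ℕ) (fun _ => 0) (fun _ => 0) (by simp) (by simp) (by simp [hdr])
    let τ : Finset K.VertexType := Finset.univ.filter fun i => i.1 ∈ σ
    obtain ⟨q, hq⟩ := gq (𝕜 := 𝕜) K τ (by
      intro s hs hsτ
      refine hle₁ (L₁.down_closed hσ₁ ?_ (by simpa using hs))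
      intro v hv
      obtain ⟨i, hi, rfl⟩ := Finset.mem_map.1 hv
      have := hsτ hi
      simp only [τ, Finset.mem_filter] at this
      exact this.2)
    obtain ⟨y, hy⟩ := gL2 id Function.injective_id (gx 𝕜 K) (gx 𝕜 K) (fun _ => rfl)
      (fun u hu => absurd ⟨u, rfl⟩ hu) (gx_surj K) τ q hq (ge 𝕜 K) (ge_gx K) r hr
      (by rw [hdr]; exact Submodule.zero_mem _)
    have hle : Ideal.span (gx 𝕜 K '' {i | i ∉ τ}) ≤ I₁ ⊔ I₂ := by
      refine Ideal.span_le.2 ?_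
      rintro _ ⟨u, hu, rfl⟩
      have hu' : u.1 ∉ σ := by simpa [τ] using hu
      rcases hvK u with h | h
      · exact Ideal.mem_sup_left (Ideal.subset_span ⟨u, ⟨h, hu'⟩, rfl⟩)
      · exact Ideal.mem_sup_right (Ideal.subset_span ⟨u, ⟨h, hu'⟩, rfl⟩)
    have hy2 := gT_map (U := K.VertexType) _ (I₁ ⊔ I₂) (AlgHom.id 𝕜 _) (fun p hp => hle hp) hy
    rw [gM_id] at hy2
    obtain ⟨a, ha, b, hb, hab⟩ := Submodule.mem_sup.1 (gT_sup I₁ I₂ hy2)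
    have hdab : gKd (gx 𝕜 K) (a + b) = 0 := by
      rw [hab, map_sub, hdr, gKd_gKd, sub_zero]
    obtain ⟨hda, hdb⟩ := gSplit (gx 𝕜 K) I₁ I₂ φ hφ1 hφ2 a b ha hb hdab
    have hr' : r = (a + b) + gKd (gx 𝕜 K) y := by rw [hab]; exact (sub_add_cancel _ _).symm
    rw [hr']
    refine Submodule.add_mem_sup (Submodule.subset_span ⟨⟨(a, b), ⟨ha, hda⟩, ⟨hb, hdb⟩⟩, ?_⟩)
      ⟨y, rfl⟩
    simp only [h11, h21]

end FinSec


open SimComplex in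
/-- **Gluing Golod complexes along a common simplex** (Limonchenko, Proposition 3.1).
Let `K₁` and `K₂` be simplicial complexes whose vertex sets intersect exactly in a set
`σ` which spans a common face of both, and let `K = K₁ ∪_σ K₂` be the complex obtained
by gluing `K₁` and `K₂` along this common simplex (so that `K₁ ∩ K₂` is the full simplex
on `σ`).  If `K₁` and `K₂` are Golod over a field `𝕜` of characteristic zero, then so
is `K`. -/
theorem isGolod_glue_along_simplex {V : Type} [Fintype V]
    (K₁ K₂ : SimComplex V) (σ : Finset V)
    (hσ₁ : σ ∈ K₁.faces) (hσ₂ : σ ∈ K₂.faces)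
    (hvert : {v : V | {v} ∈ K₁.faces} ∩ {v : V | {v} ∈ K₂.faces} = ↑σ)
    (hint : ∀ s : Finset V, (s ∈ K₁.faces ∧ s ∈ K₂.faces) ↔ (s.Nonempty ∧ s ⊆ σ))
    (𝕜 : Type) [Field 𝕜] [CharZero 𝕜]
    (h₁ : K₁.IsGolod 𝕜) (h₂ : K₂.IsGolod 𝕜) :
    (K₁.glue K₂).IsGolod 𝕜 := by
  refine gMain (K₁.glue K₂) K₁ K₂ rfl σ hσ₁ hσ₂ (fun v h1 h2 => ?_) h₁ h₂
  have : v ∈ (↑σ : Set V) := by rw [← hvert]; exact ⟨h1, h2⟩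
  simpa using this
end
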